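/- Let p be a prime and ψ : ℕ → ℝ a non-negative function with Σ_{n∈ℕ} μ_p(E_n(ψ)) = ∞. If there exists ε > 0 such that Σ_{n∈ℕ} φ(n)·(ψ(n))^{1+ε} = ∞, where φ is Euler's totient function, then μ_p(W_p(ψ)) = 1. -/

import Mathlib

open MeasureTheory Filter
open scoped ENNReal

noncomputable section

/-- The set `E_n(ψ) ⊆ ℤ_p`: union over integers `a` with `|a| ≤ n`, `gcd(a,n) = 1`
of the closed balls `{x : |x - a/n|_p ≤ ψ(n)}`. -/
def padicE (p : ℕ) [Fact p.Prime] (ψ : ℕ → ℝ) (n : ℕ) : Set ℤ_[p] :=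
  {x | ∃ a : ℤ, |a| ≤ (n : ℤ) ∧ Int.gcd a n = 1 ∧
    ‖(x : ℚ_[p]) - (a : ℚ_[p]) / (n : ℚ_[p])‖ ≤ ψ n}

/-- `W_p(ψ)`: the points of `ℤ_p` lying in infinitely many of the sets `E_n(ψ)`. -/
def padicW (p : ℕ) [Fact p.Prime] (ψ : ℕ → ℝ) : Set ℤ_[p] :=
  {x | {n : ℕ | x ∈ padicE p ψ n}.Infinite}

/-- The kernel comparing exponents `i` and `j` at one prime. -/
def expKernel (r : ℝ) (i j : ℕ) : ℝ := if i = j then 1 else 2 * r ^ ((i - j) + (j - i))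

lemma expKernel_nonneg {r : ℝ} (hr : 0 ≤ r) (i j : ℕ) : 0 ≤ expKernel r i j := by
  unfold expKernel; split_ifs <;> positivity

lemma expKernel_comm (r : ℝ) (i j : ℕ) : expKernel r i j = expKernel r j i := by
  unfold expKernel
  by_cases h : i = j
  · simp [h]
  · simp [h, Ne.symm h, add_comm]

lemma sum_pow_dist_le {r : ℝ} (hr : 0 ≤ r) (hr1 : r < 1) (I : Finset ℕ) (i : ℕ) :
    ∑ j ∈ I.erase i, r ^ ((i - j) + (j - i)) ≤ 2 * (r / (1 - r)) := by
  have hgeo : ∀ s : Finset ℕ, ∑ d ∈ s, r ^ (d + 1) ≤ r / (1 - r) := by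
    intro s
    have h := (summable_geometric_of_lt_one hr hr1).sum_le_tsum s (fun _ _ => by positivity)
    rw [tsum_geometric_of_lt_one hr hr1] at h
    calc ∑ d ∈ s, r ^ (d + 1) = r * ∑ d ∈ s, r ^ d := by
          rw [Finset.mul_sum]; exact Finset.sum_congr rfl fun _ _ => by ring
      _ ≤ r * (1 - r)⁻¹ := by gcongr
      _ = _ := by rw [div_eq_mul_inv]
  rw [← Finset.sum_filter_add_sum_filter_not (I.erase i) (fun j => j < i)]
  have h1 : ∑ j ∈ (I.erase i).filter (fun j => j < i), r ^ ((i - j) + (j - i)) ≤ r / (1 - r) := by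
    refine le_trans (le_of_eq ?_) (hgeo (((I.erase i).filter (fun j => j < i)).image (fun j => i - j - 1)))
    rw [Finset.sum_image]
    · refine Finset.sum_congr rfl fun j hj => ?_
      simp only [Finset.mem_filter] at hj
      congr 1; omega
    · intro x hx y hy hxy
      simp only [Finset.coe_filter, Set.mem_ofPred_eq] at hx hy hxy
      omega
  have h2 : ∑ j ∈ (I.erase i).filter (fun j => ¬ j < i), r ^ ((i - j) + (j - i)) ≤ r / (1 - r) := by
    refine le_trans (le_of_eq ?_) (hgeo (((I.erase i).filter (fun j => ¬ j < i)).image (fun j => j - i - 1)))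
    rw [Finset.sum_image]
    · refine Finset.sum_congr rfl fun j hj => ?_
      simp only [Finset.mem_filter, Finset.mem_erase] at hj
      congr 1; omega
    · intro x hx y hy hxy
      simp only [Finset.coe_filter, Set.mem_ofPred_eq, Finset.mem_erase] at hx hy hxy
      omega
  linarith

lemma expKernel_row_le {r : ℝ} (hr : 0 ≤ r) (hr1 : r < 1) (I : Finset ℕ) (i : ℕ) :
    ∑ j ∈ I, expKernel r i j ≤ 1 + 4 * (r / (1 - r)) := by
  have h0 : ∑ j ∈ I.erase i, expKernel r i j ≤ 4 * (r / (1 - r)) := by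
    calc ∑ j ∈ I.erase i, expKernel r i j = 2 * ∑ j ∈ I.erase i, r ^ ((i - j) + (j - i)) := by
          rw [Finset.mul_sum]
          refine Finset.sum_congr rfl fun j hj => ?_
          simp [expKernel, (Finset.ne_of_mem_erase hj).symm]
      _ ≤ _ := by have := sum_pow_dist_le hr hr1 I i; linarith
  by_cases hi : i ∈ I
  · rw [← Finset.add_sum_erase I _ hi]
    simp only [expKernel, if_true] at h0 ⊢
    linarith
  · rw [Finset.erase_eq_of_notMem hi] at h0; linarith

lemma schur_bound {K : ℕ → ℕ → ℝ} (hK : ∀ i j, 0 ≤ K i j) (hs : ∀ i j, K i j = K j i) {R : ℝ}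
    {I : Finset ℕ} (hrow : ∀ i, ∑ j ∈ I, K i j ≤ R) (x y : ℕ → ℝ) :
    ∑ i ∈ I, ∑ j ∈ I, K i j * (x i * y j) ≤ R / 2 * (∑ i ∈ I, x i ^ 2 + ∑ i ∈ I, y i ^ 2) := by
  have h1 : ∑ i ∈ I, ∑ j ∈ I, K i j * (x i * y j) ≤
      ∑ i ∈ I, ∑ j ∈ I, (K i j * x i ^ 2 / 2 + K i j * y j ^ 2 / 2) := by
    refine Finset.sum_le_sum fun i _ => Finset.sum_le_sum fun j _ => ?_
    nlinarith [hK i j, mul_nonneg (hK i j) (sq_nonneg (x i - y j))]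
  have h2 : ∑ i ∈ I, ∑ j ∈ I, K i j * x i ^ 2 / 2 ≤ R / 2 * ∑ i ∈ I, x i ^ 2 := by
    rw [Finset.mul_sum]
    refine Finset.sum_le_sum fun i _ => ?_
    rw [← Finset.sum_div, ← Finset.sum_mul]
    nlinarith [hrow i, sq_nonneg (x i)]
  have h3 : ∑ i ∈ I, ∑ j ∈ I, K i j * y j ^ 2 / 2 ≤ R / 2 * ∑ i ∈ I, y i ^ 2 := by
    rw [Finset.sum_comm, Finset.mul_sum]
    refine Finset.sum_le_sum fun j _ => ?_
    rw [← Finset.sum_div, ← Finset.sum_mul]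
    have : ∑ i ∈ I, K i j ≤ R := by simpa only [hs _ j] using hrow j
    nlinarith [sq_nonneg (y j)]
  simp only [Finset.sum_add_distrib] at h1
  linarith

lemma cube_mul_le {b r : ℝ} (hb : 0 ≤ b) (hr : 0 ≤ r) :
    b ^ 3 * r ≤ b ^ 4 / 16 + 4096 * r ^ 4 := by
  rcases le_total (16 * r) b with h | h
  · have : b ^ 3 * r ≤ b ^ 3 * (b / 16) := by gcongr; linarith
    have h4 : 0 ≤ r ^ 4 := by positivity
    nlinarith
  · have : b ^ 3 * r ≤ (16 * r) ^ 3 * r := by gcongr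
    have h4 : 0 ≤ b ^ 4 := by positivity
    nlinarith

lemma expKernel_concentration {p r : ℝ} (hp : 1 ≤ p) (hr : 0 ≤ r) (hrp : r ^ 4 * p = 1)
    (hr1 : r ≤ 1 / 1025) (I : Finset ℕ) (a b : ℕ → ℝ) (ha : ∀ i, 0 ≤ a i) (hb : ∀ i, 0 ≤ b i)
    (ha1 : ∑ i ∈ I, a i ^ 4 = 1) (hb1 : ∑ i ∈ I, b i ^ 4 = 1)
    (hS : 1 < ∑ i ∈ I, ∑ j ∈ I, expKernel r i j * (a i ^ 3 * b j ^ 3)) :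
    ∃ k ∈ I, ∑ i ∈ I.erase k, ∑ j ∈ I.erase k, expKernel r i j * (a i ^ 3 * b j ^ 3) ≤
      2 * (2 ^ 18 / p) * Real.sqrt (2 ^ 18 / p) := by
  have hle : ∀ {f : ℕ → ℝ}, (∀ i, 0 ≤ f i) → ∑ i ∈ I, f i ^ 4 = 1 → ∀ i ∈ I, f i ≤ 1 := by
    intro f hf h1 i hi
    have := Finset.single_le_sum (f := fun i => f i ^ 4) (fun i _ => by positivity) hi
    rw [h1] at this
    by_contra hc
    push Not at hc
    have : (1:ℝ) < f i ^ 4 := one_lt_pow₀ hc (by norm_num)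
    linarith
  have ha1' := hle ha ha1
  have hb1' := hle hb hb1
  have h6 : ∀ {f : ℕ → ℝ}, (∀ i, 0 ≤ f i) → (∀ i ∈ I, f i ≤ 1) → ∀ i ∈ I, (f i ^ 3) ^ 2 ≤ f i ^ 4 := by
    intro f hf h1 i hi
    rw [← pow_mul]
    exact pow_le_pow_of_le_one (hf i) (h1 i hi) (by norm_num)
  have hr1' : r < 1 := by linarith
  have hrr : r / (1 - r) ≤ 1 / 1024 := by
    rw [div_le_div_iff₀ (by linarith) (by norm_num)]; linarith
  have hIne : I.Nonempty := by
    rw [Finset.nonempty_iff_ne_empty]; rintro rfl; simp at ha1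
  obtain ⟨k, hk, hkmax⟩ := Finset.exists_max_image I (fun i => a i * b i) hIne
  -- off-diagonal part
  have hoff : ∑ i ∈ I, ∑ j ∈ I, (expKernel r i j - if i = j then 1 else 0) * (a i ^ 3 * b j ^ 3) ≤ 1 / 256 := by
    have := schur_bound (K := fun i j => expKernel r i j - if i = j then 1 else 0) (I := I) (R := 1 / 256)
      (x := fun i => a i ^ 3) (y := fun i => b i ^ 3) ?_ ?_ ?_
    · refine this.trans ?_
      have e1 := Finset.sum_le_sum (h6 ha ha1')
      have e2 := Finset.sum_le_sum (h6 hb hb1')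
      rw [ha1] at e1
      rw [hb1] at e2
      linarith
    · intro i j
      by_cases h : i = j
      · simp [expKernel, h]
      · simp only [h, if_false, sub_zero]; exact expKernel_nonneg hr i j
    · intro i j; simp only [expKernel_comm r i j, eq_comm]
    · intro i
      have h0 := sum_pow_dist_le hr hr1' I i
      have : ∑ j ∈ I, (expKernel r i j - if i = j then 1 else 0) ≤
          2 * ∑ j ∈ I.erase i, r ^ ((i - j) + (j - i)) := by
        rw [Finset.mul_sum]
        have : ∀ s : Finset ℕ, i ∉ s → ∑ j ∈ s, (expKernel r i j - if i = j then 1 else 0) =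
            ∑ j ∈ s, 2 * r ^ ((i - j) + (j - i)) := by
          intro s hs
          refine Finset.sum_congr rfl fun j hj => ?_
          have : i ≠ j := by rintro rfl; exact hs hj
          simp [expKernel, this]
        by_cases hi : i ∈ I
        · rw [← Finset.add_sum_erase I _ hi, this _ (Finset.notMem_erase i I)]
          simp [expKernel]
        · rw [Finset.erase_eq_of_notMem hi, this _ hi]
      linarith
  have hdiag : ∑ i ∈ I, a i ^ 3 * b i ^ 3 ≤ a k * b k := by
    have h2 : ∑ i ∈ I, (a i * b i) ^ 2 ≤ 1 := by
      have : ∀ i ∈ I, (a i * b i) ^ 2 ≤ (a i ^ 4 + b i ^ 4) / 2 := fun i _ => by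
        nlinarith [sq_nonneg (a i ^ 2 - b i ^ 2)]
      refine (Finset.sum_le_sum this).trans ?_
      rw [← Finset.sum_div, Finset.sum_add_distrib, ha1, hb1]; norm_num
    calc ∑ i ∈ I, a i ^ 3 * b i ^ 3 ≤ ∑ i ∈ I, (a k * b k) * (a i * b i) ^ 2 := by
          refine Finset.sum_le_sum fun i hi => ?_
          have := hkmax i hi
          have h0 : 0 ≤ (a i * b i) ^ 2 := by positivity
          calc a i ^ 3 * b i ^ 3 = (a i * b i) * (a i * b i) ^ 2 := by ring
            _ ≤ _ := by gcongr
      _ = (a k * b k) * ∑ i ∈ I, (a i * b i) ^ 2 := by rw [Finset.mul_sum]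
      _ ≤ (a k * b k) * 1 := by
          have := mul_nonneg (ha k) (hb k); gcongr
      _ = _ := mul_one _
  have hsplit : ∑ i ∈ I, ∑ j ∈ I, expKernel r i j * (a i ^ 3 * b j ^ 3) =
      ∑ i ∈ I, ∑ j ∈ I, (expKernel r i j - if i = j then 1 else 0) * (a i ^ 3 * b j ^ 3) +
        ∑ i ∈ I, a i ^ 3 * b i ^ 3 := by
    rw [← Finset.sum_add_distrib]
    refine Finset.sum_congr rfl fun i hi => ?_
    simp only [sub_mul, Finset.sum_sub_distrib, ite_mul, one_mul, zero_mul, Finset.sum_ite_eq, hi,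
      if_true]
    ring
  have hab : 255 / 256 < a k * b k := by linarith
  have hak := ha1' k hk
  have hbk := hb1' k hk
  have hak' : 255 / 256 < a k := by nlinarith [ha k, hb k]
  have hbk' : 255 / 256 < b k := by nlinarith [ha k, hb k]
  have h4 : ∀ u : ℝ, 255 / 256 < u → 1 - 1 / 64 ≤ u ^ 4 := by
    intro u hu
    have : (255 / 256 : ℝ) ^ 4 ≤ u ^ 4 := by gcongr
    refine le_trans ?_ this; norm_num
  have hma : ∑ i ∈ I.erase k, a i ^ 4 = 1 - a k ^ 4 := by
    rw [← ha1, ← Finset.add_sum_erase I _ hk]; ring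
  have hmb : ∑ i ∈ I.erase k, b i ^ 4 = 1 - b k ^ 4 := by
    rw [← hb1, ← Finset.add_sum_erase I _ hk]; ring
  set m := max (1 - a k ^ 4) (1 - b k ^ 4) with hm
  have hma' : 1 - a k ^ 4 ≤ m := le_max_left _ _
  have hmb' : 1 - b k ^ 4 ≤ m := le_max_right _ _
  have hm64 : m ≤ 1 / 64 := max_le (by linarith [h4 _ hak']) (by linarith [h4 _ hbk'])
  have hm0 : 0 ≤ m := le_trans (by nlinarith [pow_le_one₀ (n := 4) (ha k) hak]) hma'
  -- squares of the deviating parts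
  have hsix : ∀ {f : ℕ → ℝ} {M : ℝ}, (∀ i, 0 ≤ f i) → ∑ i ∈ I.erase k, f i ^ 4 ≤ M → 0 ≤ M →
      ∑ i ∈ I.erase k, (f i ^ 3) ^ 2 ≤ M * Real.sqrt M := by
    intro f M hf hfm hM
    calc ∑ i ∈ I.erase k, (f i ^ 3) ^ 2 ≤ ∑ i ∈ I.erase k, f i ^ 4 * Real.sqrt M := by
          refine Finset.sum_le_sum fun i hi => ?_
          have h1 : f i ^ 4 ≤ M :=
            (Finset.single_le_sum (f := fun i => f i ^ 4) (fun i _ => by positivity) hi).trans hfm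
          have h2 : f i ^ 2 ≤ Real.sqrt M := Real.le_sqrt_of_sq_le (by rw [← pow_mul]; exact h1)
          calc (f i ^ 3) ^ 2 = f i ^ 4 * f i ^ 2 := by ring
            _ ≤ _ := by gcongr
      _ = (∑ i ∈ I.erase k, f i ^ 4) * Real.sqrt M := by rw [Finset.sum_mul]
      _ ≤ _ := by gcongr
  have hdoff : ∀ M : ℝ, 0 ≤ M → m ≤ M →
      ∑ i ∈ I.erase k, ∑ j ∈ I.erase k, expKernel r i j * (a i ^ 3 * b j ^ 3) ≤
      2 * M * Real.sqrt M := by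
    intro M hM hmM
    have := schur_bound (K := expKernel r) (expKernel_nonneg hr) (expKernel_comm r) (R := 2)
      (I := I.erase k) (fun i => (expKernel_row_le hr hr1' _ i).trans (by linarith))
      (fun i => a i ^ 3) (fun i => b i ^ 3)
    have e1 := hsix ha (by linarith : ∑ i ∈ I.erase k, a i ^ 4 ≤ M) hM
    have e2 := hsix hb (by linarith : ∑ i ∈ I.erase k, b i ^ 4 ≤ M) hM
    linarith
  refine ⟨k, hk, hdoff _ (by positivity) ?_⟩
  have hcross : ∀ {f : ℕ → ℝ}, (∀ i, 0 ≤ f i) → ∑ i ∈ I.erase k, f i ^ 4 ≤ m →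
      ∑ j ∈ I.erase k, expKernel r k j * f j ^ 3 ≤ m / 8 + 32768 / p := by
    intro f hf hfm
    have hr4 : r ^ 4 = 1 / p := by field_simp; linarith
    have hr41 : r ^ 4 ≤ 1 / 2 := by
      calc r ^ 4 ≤ (1/1025) ^ 4 := by gcongr
        _ ≤ _ := by norm_num
    have hg := sum_pow_dist_le (r := r ^ 4) (by positivity) (by linarith) I k
    have hg' : r ^ 4 / (1 - r ^ 4) ≤ 2 / p := by
      rw [div_le_iff₀ (by linarith), ← mul_one_div, ← hr4]
      nlinarith [pow_nonneg hr 4]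
    calc ∑ j ∈ I.erase k, expKernel r k j * f j ^ 3
        ≤ ∑ j ∈ I.erase k, (2 * (f j ^ 4 / 16) + 8192 * (r ^ 4) ^ ((k - j) + (j - k))) := by
          refine Finset.sum_le_sum fun j hj => ?_
          have hne : k ≠ j := (Finset.ne_of_mem_erase hj).symm
          have := cube_mul_le (hf j) (r := r ^ ((k - j) + (j - k))) (by positivity)
          rw [← pow_mul, mul_comm _ 4, pow_mul] at this
          simp only [expKernel, hne, if_false]
          linarith
      _ = (∑ j ∈ I.erase k, f j ^ 4) / 8 + 8192 * ∑ j ∈ I.erase k, (r ^ 4) ^ ((k - j) + (j - k)) := by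
          rw [Finset.sum_add_distrib, Finset.mul_sum, Finset.sum_div]
          congr 1
          exact Finset.sum_congr rfl fun _ _ => by ring
      _ ≤ m / 8 + 8192 * (2 * (2 / p)) := by
          have := hg.trans (mul_le_mul_of_nonneg_left hg' (by norm_num)); gcongr
      _ = _ := by ring
  have hca := hcross ha (by linarith)
  have hcb := hcross hb (by linarith)
  have hdec : ∑ i ∈ I, ∑ j ∈ I, expKernel r i j * (a i ^ 3 * b j ^ 3) =
      a k ^ 3 * b k ^ 3 + a k ^ 3 * ∑ j ∈ I.erase k, expKernel r k j * b j ^ 3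
       + b k ^ 3 * ∑ j ∈ I.erase k, expKernel r k j * a j ^ 3 +
       ∑ i ∈ I.erase k, ∑ j ∈ I.erase k, expKernel r i j * (a i ^ 3 * b j ^ 3) := by
    have hin : ∀ i, ∑ j ∈ I, expKernel r i j * (a i ^ 3 * b j ^ 3) =
        expKernel r i k * (a i ^ 3 * b k ^ 3) +
          ∑ j ∈ I.erase k, expKernel r i j * (a i ^ 3 * b j ^ 3) := fun i =>
      (Finset.add_sum_erase I _ hk).symm
    rw [← Finset.add_sum_erase I _ hk, hin k]
    simp only [hin, Finset.sum_add_distrib]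
    have e0 : expKernel r k k = 1 := by simp [expKernel]
    rw [e0, Finset.mul_sum, Finset.mul_sum]
    have e1 : ∑ j ∈ I.erase k, expKernel r k j * (a k ^ 3 * b j ^ 3) =
        ∑ j ∈ I.erase k, a k ^ 3 * (expKernel r k j * b j ^ 3) :=
      Finset.sum_congr rfl fun _ _ => by ring
    have e2 : ∑ j ∈ I.erase k, expKernel r j k * (a j ^ 3 * b k ^ 3) =
        ∑ j ∈ I.erase k, b k ^ 3 * (expKernel r k j * a j ^ 3) :=
      Finset.sum_congr rfl fun j _ => by rw [expKernel_comm r j k]; ring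
    rw [e1, e2]; ring
  have hdd : ∑ i ∈ I.erase k, ∑ j ∈ I.erase k, expKernel r i j * (a i ^ 3 * b j ^ 3) ≤ m / 4 := by
    refine (hdoff m hm0 le_rfl).trans ?_
    have : Real.sqrt m ≤ 1 / 8 := by
      rw [Real.sqrt_le_left (by norm_num)]; linarith
    nlinarith
  have hcube : ∀ u : ℝ, 0 ≤ u → u ^ 3 ≤ 1 / 4 + 3 / 4 * u ^ 4 := by
    intro u hu
    nlinarith [mul_nonneg (sq_nonneg (u - 1)) (by positivity : 0 ≤ 3 * u ^ 2 + 2 * u + 1)]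
  have hxy : a k ^ 3 * b k ^ 3 ≤ 1 - 3 / 4 * m := by
    have h1 : a k ^ 3 ≤ 1 := pow_le_one₀ (ha k) hak
    have h2 : b k ^ 3 ≤ 1 := pow_le_one₀ (hb k) hbk
    have h3 : 0 ≤ a k ^ 3 := pow_nonneg (ha k) 3
    have h3' : 0 ≤ b k ^ 3 := pow_nonneg (hb k) 3
    have ca := hcube _ (ha k)
    have cb := hcube _ (hb k)
    have ea : a k ^ 3 * b k ^ 3 ≤ a k ^ 3 := mul_le_of_le_one_right h3 h2
    have eb : a k ^ 3 * b k ^ 3 ≤ b k ^ 3 := mul_le_of_le_one_left h3' h1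
    rcases max_choice (1 - a k ^ 4) (1 - b k ^ 4) with h | h
    · rw [hm, h]; linarith
    · rw [hm, h]; linarith
  have hpos : ∀ {f : ℕ → ℝ}, (∀ i, 0 ≤ f i) → 0 ≤ ∑ j ∈ I.erase k, expKernel r k j * f j ^ 3 :=
    fun hf => Finset.sum_nonneg fun j _ => mul_nonneg (expKernel_nonneg hr _ _) (pow_nonneg (hf j) 3)
  have c1 : a k ^ 3 * ∑ j ∈ I.erase k, expKernel r k j * b j ^ 3 ≤ m / 8 + 32768 / p :=
    (mul_le_of_le_one_left (hpos hb) (pow_le_one₀ (ha k) hak)).trans hcb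
  have c2 : b k ^ 3 * ∑ j ∈ I.erase k, expKernel r k j * a j ^ 3 ≤ m / 8 + 32768 / p :=
    (mul_le_of_le_one_left (hpos ha) (pow_le_one₀ (hb k) hbk)).trans hca
  have : m / 4 ≤ 65536 / p := by
    have : (65536 : ℝ) / p = 32768 / p + 32768 / p := by ring
    linarith
  calc m ≤ 4 * (65536 / p) := by linarith
    _ = _ := by ring

/-- Density of integers with exponent `i` at `p`, relative to a reference exponent `k`. -/
def localWeight (p k i : ℕ) : ℝ := (if i = 0 then 1 else 1 - 1 / (p : ℝ)) / (p : ℝ) ^ (k - i)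

lemma localWeight_nonneg {p : ℕ} (hp : 1 ≤ p) (k i : ℕ) : 0 ≤ localWeight p k i := by
  have : (1:ℝ) / p ≤ 1 := by
    rw [div_le_one (by positivity)]; exact_mod_cast hp
  unfold localWeight; split_ifs
  · positivity
  · apply div_nonneg (by linarith) (by positivity)

lemma localWeight_le_one {p : ℕ} (hp : 1 ≤ p) (k i : ℕ) : localWeight p k i ≤ 1 := by
  have h1 : (1:ℝ) ≤ p := by exact_mod_cast hp
  have : (0:ℝ) ≤ 1 / p := by positivity
  unfold localWeight
  rw [div_le_one (by positivity)]
  refine le_trans ?_ (one_le_pow₀ h1)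
  split_ifs <;> linarith

lemma sum_localWeight {p : ℕ} (hp : 1 ≤ p) (k : ℕ) :
    ∑ i ∈ Finset.range (k + 1), localWeight p k i = 1 := by
  have hp0 : (p:ℝ) ≠ 0 := by positivity
  induction k with
  | zero => simp [localWeight]
  | succ k ih =>
    rw [Finset.sum_range_succ]
    have : ∀ i ∈ Finset.range (k + 1), localWeight p (k + 1) i = localWeight p k i / p := by
      intro i hi
      have hi' : i ≤ k := by simpa [Nat.lt_succ_iff] using hi
      unfold localWeight
      rw [Nat.succ_sub hi', pow_succ]; field_simp
    rw [Finset.sum_congr rfl this, ← Finset.sum_div, ih]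
    simp [localWeight]

lemma sum_localWeight_mul_le {p : ℕ} (hp : 1 ≤ p) (k : ℕ) {h : ℝ} (hh : 1 ≤ h) :
    ∑ i ∈ Finset.range (k + 1), localWeight p k i * (if i = k then 1 else h) ≤
      1 + (h - 1) / p := by
  have hs := sum_localWeight hp k
  have hk : 1 - 1 / (p : ℝ) ≤ localWeight p k k := by
    unfold localWeight
    have : (0:ℝ) ≤ 1 / p := by positivity
    split_ifs <;> simp
  rw [Finset.sum_range_succ] at hs ⊢
  have : ∀ i ∈ Finset.range k, localWeight p k i * (if i = k then 1 else h) =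
      localWeight p k i * h := fun i hi => by
    simp [(Finset.mem_range.mp hi).ne]
  rw [Finset.sum_congr rfl this, ← Finset.sum_mul]
  have e : ∑ i ∈ Finset.range k, localWeight p k i = 1 - localWeight p k k := by linarith
  rw [e]
  simp only [if_true]
  have : (h - 1) * (1 - localWeight p k k) ≤ (h - 1) * (1 / p) := by
    apply mul_le_mul_of_nonneg_left <;> linarith
  rw [div_eq_mul_one_div (h - 1)]
  linarith

/-- The part of `∏ p ^ x p` exceeding the reference exponents `k`. -/
def excess (P : Finset ℕ) (k x : ℕ → ℕ) : ℕ := ∏ p ∈ P, p ^ (x p - k p)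

lemma excess_pos {P : Finset ℕ} (hP : ∀ p ∈ P, p.Prime) (k x : ℕ → ℕ) : 0 < excess P k x :=
  Finset.prod_pos fun p hp => pow_pos (hP p hp).pos _

lemma factorization_excess {P : Finset ℕ} (hP : ∀ p ∈ P, p.Prime) (k x : ℕ → ℕ) {p : ℕ}
    (hp : p ∈ P) : (excess P k x).factorization p = x p - k p := by
  unfold excess
  rw [Nat.factorization_prod fun q hq => (pow_pos (hP q hq).pos _).ne', Finsupp.finsetSum_apply,
    Finset.sum_eq_single p]
  · rw [(hP p hp).factorization_pow]; simp
  · intro q hq hne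
    rw [(hP q hq).factorization_pow]; simp [hne]
  · exact fun h => absurd hp h

lemma sum_prod_dvd_le {P : Finset ℕ} (hP : ∀ p ∈ P, p.Prime) {h : ℕ → ℝ} (hh : ∀ p, 1 ≤ h p)
    (A : ℕ) : ∑ a ∈ Finset.Icc 1 A, ∏ p ∈ P, (if p ∣ a then h p else 1) ≤
      A * ∏ p ∈ P, (1 + (h p - 1) / p) := by
  have e1 : ∀ a : ℕ, ∏ p ∈ P, (if p ∣ a then h p else 1) =
      ∑ S ∈ P.powerset, (∏ p ∈ S, (h p - 1)) * (if (∏ p ∈ S, p) ∣ a then 1 else 0) := by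
    intro a
    have : ∀ p ∈ P, (if p ∣ a then h p else 1) = 1 + (h p - 1) * (if p ∣ a then 1 else 0) := by
      intro p _; split_ifs <;> ring
    rw [Finset.prod_congr rfl this, Finset.prod_one_add]
    refine Finset.sum_congr rfl fun S hS => ?_
    rw [Finset.prod_mul_distrib]
    congr 1
    have hS' := Finset.mem_powerset.mp hS
    rw [Finset.prod_ite_zero]
    simp only [Finset.prod_const_one]
    congr 1
    refine propext ⟨fun hd => Finset.prod_primes_dvd a (fun p hp => (hP p (hS' hp)).prime) hd,
      fun hd p hp => (Finset.dvd_prod_of_mem _ hp).trans hd⟩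
  simp only [e1]
  rw [Finset.sum_comm, Finset.prod_one_add, Finset.mul_sum]
  refine Finset.sum_le_sum fun S hS => ?_
  rw [← Finset.mul_sum, Finset.prod_div_distrib]
  have hS' := Finset.mem_powerset.mp hS
  have h0 : 0 ≤ ∏ p ∈ S, (h p - 1) := Finset.prod_nonneg fun p _ => by linarith [hh p]
  have hc : ∑ a ∈ Finset.Icc 1 A, (if (∏ p ∈ S, p) ∣ a then (1:ℝ) else 0) ≤ A / ∏ p ∈ S, (p:ℝ) := by
    rw [Finset.sum_boole]
    have : ((Finset.Icc 1 A).filter fun a => (∏ p ∈ S, p) ∣ a).card = A / ∏ p ∈ S, p := by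
      rw [← Nat.Ioc_filter_dvd_card_eq_div]; rfl
    rw [this]
    refine Nat.cast_div_le.trans ?_
    push_cast; exact le_rfl
  calc _ ≤ (∏ p ∈ S, (h p - 1)) * (A / ∏ p ∈ S, (p:ℝ)) := by gcongr
    _ = _ := by ring

lemma sum_localWeight_excess_le {ι : Type*} {P : Finset ℕ} (hP : ∀ p ∈ P, p.Prime) (k : ℕ → ℕ)
    (e : ι → ℕ → ℕ) {V : Finset ι}
    (hinj : ∀ v ∈ V, ∀ v' ∈ V, (∀ p ∈ P, e v p = e v' p) → v = v')
    {h : ℕ → ℝ} (hh : ∀ p, 1 ≤ h p) {A : ℕ} (hA : ∀ v ∈ V, excess P k (e v) ≤ A) :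
    ∑ v ∈ V, ∏ p ∈ P, (localWeight p (k p) (e v p) * (if e v p = k p then 1 else h p)) ≤
      A * (∏ p ∈ P, (1 + (h p - 1) / p)) ^ 2 := by
  classical
  set F : ℕ → ℕ → ℝ := fun p i => localWeight p (k p) i * (if i = k p then 1 else h p) with hF
  have hF0 : ∀ p ∈ P, ∀ i, 0 ≤ F p i := fun p hp i =>
    mul_nonneg (localWeight_nonneg (hP p hp).one_le _ _) (by split_ifs <;> linarith [hh p])
  have hR : ∀ p, 0 ≤ (h p - 1) / p := fun p => div_nonneg (by linarith [hh p]) (by positivity)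
  rw [← Finset.sum_fiberwise_of_maps_to (s := V) (t := Finset.Icc 1 A) (g := fun v => excess P k (e v))
    (fun v hv => Finset.mem_Icc.mpr ⟨excess_pos hP k _, hA v hv⟩)]
  have hfib : ∀ a ∈ Finset.Icc 1 A, ∑ v ∈ V.filter (fun v => excess P k (e v) = a),
      ∏ p ∈ P, F p (e v p) ≤ (∏ p ∈ P, (if p ∣ a then h p else 1)) * ∏ p ∈ P, (1 + (h p - 1) / p) := by
    intro a ha
    have ha0 : a ≠ 0 := by have := (Finset.mem_Icc.mp ha).1; omega
    set S : ℕ → Finset ℕ := fun p => if p ∣ a then {k p + a.factorization p} else Finset.range (k p + 1)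
      with hS
    calc ∑ v ∈ V.filter (fun v => excess P k (e v) = a), ∏ p ∈ P, F p (e v p)
        = ∑ x ∈ (V.filter (fun v => excess P k (e v) = a)).image
            (fun v => (fun p (_ : p ∈ P) => e v p)), ∏ p ∈ P.attach, F p.1 (x p.1 p.2) := by
          rw [Finset.sum_image]
          · refine Finset.sum_congr rfl fun v _ => ?_
            rw [Finset.prod_attach P (fun p => F p (e v p))]
          · intro v hv v' hv' hvv
            simp only [Finset.coe_filter, Set.mem_ofPred_eq] at hv hv'
            exact hinj v hv.1 v' hv'.1 fun p hp => congrFun (congrFun hvv p) hp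
      _ ≤ ∑ x ∈ P.pi S, ∏ p ∈ P.attach, F p.1 (x p.1 p.2) := by
          refine Finset.sum_le_sum_of_subset_of_nonneg ?_ fun x _ _ =>
            Finset.prod_nonneg fun p _ => hF0 p.1 p.2 _
          intro x hx
          obtain ⟨v, hv, rfl⟩ := Finset.mem_image.mp hx
          have hva := (Finset.mem_filter.mp hv).2
          refine Finset.mem_pi.mpr fun p hp => ?_
          have hfac := factorization_excess hP k (e v) hp
          rw [hva] at hfac
          simp only [hS]
          split_ifs with hd
          · have : 0 < a.factorization p := (hP p hp).factorization_pos_of_dvd ha0 hd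
            simp only [Finset.mem_singleton]; omega
          · rw [Nat.factorization_eq_zero_of_not_dvd hd] at hfac
            simp only [Finset.mem_range]; omega
      _ = ∏ p ∈ P, ∑ i ∈ S p, F p i := (Finset.prod_sum P S F).symm
      _ ≤ ∏ p ∈ P, ((if p ∣ a then h p else 1) * (1 + (h p - 1) / p)) := by
          refine Finset.prod_le_prod (fun p hp => Finset.sum_nonneg fun i _ => hF0 p hp i)
            fun p hp => ?_
          have h1 := hh p
          have h2 := hR p
          simp only [hS]
          split_ifs with hd
          · rw [Finset.sum_singleton]
            have l0 := localWeight_nonneg (hP p hp).one_le (k p) (k p + a.factorization p)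
            have l1 := localWeight_le_one (hP p hp).one_le (k p) (k p + a.factorization p)
            calc F p (k p + a.factorization p) ≤ 1 * h p := by
                  simp only [hF]
                  refine mul_le_mul l1 ?_ (by split_ifs <;> linarith) zero_le_one
                  split_ifs <;> linarith
              _ ≤ h p * (1 + (h p - 1) / p) := by nlinarith
          · rw [one_mul]
            exact sum_localWeight_mul_le (hP p hp).one_le _ h1
      _ = _ := Finset.prod_mul_distrib
  refine (Finset.sum_le_sum hfib).trans ?_
  rw [← Finset.sum_mul, sq, ← mul_assoc]
  refine mul_le_mul_of_nonneg_right (sum_prod_dvd_le hP hh A) ?_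
  exact Finset.prod_nonneg fun p _ => by linarith [hR p]

/-- Exponential tilt at the primes `p ≥ t`. -/
def tilt (t p : ℕ) : ℝ := if t ≤ p then Real.exp (t / p) else 1

lemma one_le_tilt (t p : ℕ) : 1 ≤ tilt t p := by
  unfold tilt; split_ifs
  · exact Real.one_le_exp (by positivity)
  · exact le_rfl

lemma prod_tilt_le {P : Finset ℕ} {t : ℕ} (ht : 1 ≤ t) :
    ∏ p ∈ P, (1 + (tilt t p - 1) / p) ≤ Real.exp 4 := by
  have h1 : ∀ p ∈ P, 1 + (tilt t p - 1) / p ≤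
      Real.exp (if t ≤ p then 2 * t * ((p:ℝ) ^ 2)⁻¹ else 0) := by
    intro p _
    unfold tilt; split_ifs with h
    · have hp : (0:ℝ) < p := by exact_mod_cast (lt_of_lt_of_le ht h)
      have hx : |(t:ℝ) / p| ≤ 1 := by
        rw [abs_of_nonneg (by positivity), div_le_one hp]; exact_mod_cast h
      have := (le_abs_self _).trans (Real.abs_exp_sub_one_le hx)
      rw [abs_of_nonneg (by positivity)] at this
      have h2 : (Real.exp (t / p) - 1) / p ≤ 2 * t * ((p:ℝ) ^ 2)⁻¹ := by
        calc (Real.exp (t / p) - 1) / p ≤ (2 * (t / p)) / p := by gcongr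
          _ = _ := by field_simp
      linarith [Real.add_one_le_exp (2 * t * ((p:ℝ) ^ 2)⁻¹)]
    · simp
  have h0 : ∀ p ∈ P, 0 ≤ 1 + (tilt t p - 1) / p := fun p _ => by
    have := div_nonneg (sub_nonneg.mpr (one_le_tilt t p)) (Nat.cast_nonneg (α := ℝ) p); linarith
  refine (Finset.prod_le_prod h0 h1).trans ?_
  rw [← Real.exp_sum, Real.exp_le_exp, ← Finset.sum_filter, ← Finset.mul_sum]
  obtain ⟨n, hn⟩ : ∃ n, ∀ p ∈ P, p < n :=
    ⟨P.sup id + 1, fun p hp => Nat.lt_succ_of_le (Finset.le_sup (f := id) hp)⟩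
  have h2 : ∑ p ∈ P.filter (fun p => t ≤ p), ((p:ℝ) ^ 2)⁻¹ ≤ 2 / t := by
    have := sum_Ioo_inv_sq_le (α := ℝ) (t - 1) n
    have ht' : ((t - 1 : ℕ) : ℝ) + 1 = t := by exact_mod_cast Nat.sub_add_cancel ht
    rw [ht'] at this
    refine le_trans (Finset.sum_le_sum_of_subset_of_nonneg ?_ fun _ _ _ => by positivity) this
    intro p hp
    obtain ⟨hp1, hp2⟩ := Finset.mem_filter.mp hp
    exact Finset.mem_Ioo.mpr ⟨by omega, hn p hp1⟩
  have ht0 : (0:ℝ) < t := by exact_mod_cast ht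
  calc 2 * t * ∑ p ∈ P.filter (fun p => t ≤ p), ((p:ℝ) ^ 2)⁻¹ ≤ 2 * t * (2 / t) := by gcongr
    _ = 4 := by field_simp; norm_num

def totientProd (P : Finset ℕ) (x : ℕ → ℕ) : ℝ := ∏ p ∈ P, (Nat.totient (p ^ x p) : ℝ)

def lcmProd (P : Finset ℕ) (x y : ℕ → ℕ) : ℝ := ∏ p ∈ P, (p : ℝ) ^ (max (x p) (y p))

lemma lcmProd_comm (P : Finset ℕ) (x y : ℕ → ℕ) : lcmProd P x y = lcmProd P y x := by
  simp only [lcmProd, max_comm]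

lemma lcmProd_pos {P : Finset ℕ} (hP : ∀ p ∈ P, p.Prime) (x y : ℕ → ℕ) : 0 < lcmProd P x y :=
  Finset.prod_pos fun p hp => pow_pos (by exact_mod_cast (hP p hp).pos) _

lemma totient_pow_mul_eq {p k i j : ℕ} (hp : p.Prime) (h : i = k ∨ j = k) :
    (Nat.totient (p ^ j) : ℝ) * (p : ℝ) ^ (i - k) = localWeight p k j * (p : ℝ) ^ (max i j) := by
  have hp0 : (p : ℝ) ≠ 0 := by exact_mod_cast hp.ne_zero
  have htot : (Nat.totient (p ^ j) : ℝ) = (if j = 0 then 1 else 1 - 1 / (p : ℝ)) * (p:ℝ) ^ j := by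
    split_ifs with hj
    · simp [hj]
    · obtain ⟨m, rfl⟩ : ∃ m, j = m + 1 := ⟨j - 1, by omega⟩
      rw [Nat.totient_prime_pow_succ hp, Nat.cast_mul, Nat.cast_pow, Nat.cast_sub hp.one_le]
      field_simp
      push_cast
      ring
  rw [htot, localWeight, div_mul_eq_mul_div, eq_div_iff (by positivity), mul_assoc, mul_assoc,
    ← pow_add, ← pow_add]
  congr 2
  omega

lemma mul_excess_le {P : Finset ℕ} (hP : ∀ p ∈ P, p.Prime) {k x y : ℕ → ℕ}
    (h : ∀ p ∈ P, x p = k p ∨ y p = k p) {m T : ℝ}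
    (hm : m * lcmProd P x y ≤ T * totientProd P y) :
    m * excess P k x ≤ T * ∏ p ∈ P, localWeight p (k p) (y p) := by
  have hpos := lcmProd_pos hP x y
  have key : totientProd P y * excess P k x =
      (∏ p ∈ P, localWeight p (k p) (y p)) * lcmProd P x y := by
    unfold totientProd excess lcmProd
    push_cast
    rw [← Finset.prod_mul_distrib, ← Finset.prod_mul_distrib]
    exact Finset.prod_congr rfl fun p hp => totient_pow_mul_eq (hP p hp) (h p hp)
  have he : (0:ℝ) ≤ excess P k x := by positivity
  refine le_of_mul_le_mul_right ?_ hpos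
  calc m * excess P k x * lcmProd P x y = m * lcmProd P x y * excess P k x := by ring
    _ ≤ T * totientProd P y * excess P k x := by gcongr
    _ = _ := by rw [mul_assoc, key]; ring

lemma rpow_sub_add_le {M x : ℝ} (hM : 0 < M) (hx : x ≤ M) :
    (M - x) ^ (3/4 : ℝ) + 3/4 * M ^ (-(1/4) : ℝ) * x ≤ M ^ (3/4 : ℝ) := by
  have h1 : (M - x) ^ (3/4 : ℝ) = M ^ (3/4:ℝ) * (1 + (-(x / M))) ^ (3/4:ℝ) := by
    rw [← Real.mul_rpow hM.le]
    · congr 1; field_simp; ring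
    · have : x / M ≤ 1 := by rw [div_le_one hM]; exact hx
      linarith
  have h2 : (1 + (-(x / M))) ^ (3/4:ℝ) ≤ 1 + 3/4 * (-(x/M)) :=
    rpow_one_add_le_one_add_mul_self
      (by have : x / M ≤ 1 := by rw [div_le_one hM]; exact hx
          linarith) (by norm_num) (by norm_num)
  have h3 : M ^ (-(1/4) : ℝ) = M ^ (3/4:ℝ) / M := by
    rw [← Real.rpow_sub_one hM.ne']; norm_num
  rw [h1, h3]
  have : 0 ≤ M ^ (3/4:ℝ) := by positivity
  calc _ ≤ M ^ (3/4:ℝ) * (1 + 3/4 * (-(x/M))) + 3/4 * (M ^ (3/4:ℝ) / M) * x := by gcongr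
    _ = _ := by ring

lemma sum_neighbors_le {ι : Type*} {P : Finset ℕ} (hP : ∀ p ∈ P, p.Prime) {k : ℕ → ℕ}
    {e : ι → ℕ → ℕ} {S : Finset ι}
    (hinj : ∀ v ∈ S, ∀ v' ∈ S, (∀ p ∈ P, e v p = e v' p) → v = v')
    {ν : ι → ℝ} {T s : ℝ} (hT : 0 ≤ T) {t A : ℕ} (ht : 1 ≤ t) (x : ℕ → ℕ)
    (hA : ∀ v ∈ S, excess P k (e v) ≤ A)
    (hk : ∀ v ∈ S, ∀ p ∈ P, x p = k p ∨ e v p = k p)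
    (hν : ∀ v ∈ S, ν v * lcmProd P x (e v) ≤ T * totientProd P (e v))
    (hs : ∀ v ∈ S, s ≤ ∑ l ∈ P with t ≤ l ∧ e v l ≠ k l, (1 : ℝ) / l) :
    (∑ v ∈ S, ν v) * excess P k x ≤ T * (A * Real.exp (8 - t * s)) := by
  have htilt : ∀ v ∈ S, Real.exp (t * s) ≤
      ∏ p ∈ P, (if e v p = k p then 1 else tilt t p) := by
    intro v hv
    have : ∏ p ∈ P, (if e v p = k p then 1 else tilt t p) =
        Real.exp (t * ∑ l ∈ P with t ≤ l ∧ e v l ≠ k l, (1 : ℝ) / l) := by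
      rw [Finset.mul_sum, Real.exp_sum, Finset.prod_filter]
      refine Finset.prod_congr rfl fun p _ => ?_
      by_cases h1 : e v p = k p <;> by_cases h2 : t ≤ p <;>
        simp [h1, h2, tilt, div_eq_mul_inv]
    rw [this]
    gcongr
    exact hs v hv
  calc (∑ v ∈ S, ν v) * excess P k x = ∑ v ∈ S, ν v * excess P k x := by rw [Finset.sum_mul]
    _ ≤ ∑ v ∈ S, T * (Real.exp (-(t * s)) * ∏ p ∈ P, (localWeight p (k p) (e v p) *
          (if e v p = k p then 1 else tilt t p))) := by
        refine Finset.sum_le_sum fun v hv => (mul_excess_le hP (hk v hv) (hν v hv)).trans ?_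
        have h0 : 0 ≤ ∏ p ∈ P, localWeight p (k p) (e v p) :=
          Finset.prod_nonneg fun p hp => localWeight_nonneg (hP p hp).one_le _ _
        have h1 : 1 ≤ Real.exp (-(t * s)) * ∏ p ∈ P, (if e v p = k p then 1 else tilt t p) := by
          calc (1:ℝ) = Real.exp (-(t * s)) * Real.exp (t * s) := by rw [← Real.exp_add]; simp
            _ ≤ _ := by gcongr; exact htilt v hv
        rw [Finset.prod_mul_distrib]
        gcongr
        nlinarith
    _ = T * (Real.exp (-(t * s)) * ∑ v ∈ S, ∏ p ∈ P, (localWeight p (k p) (e v p) *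
          (if e v p = k p then 1 else tilt t p))) := by rw [Finset.mul_sum, Finset.mul_sum]
    _ ≤ T * (Real.exp (-(t * s)) * (A * (Real.exp 4) ^ 2)) := by
        gcongr
        refine (sum_localWeight_excess_le hP k e hinj (one_le_tilt t) hA).trans ?_
        gcongr
        · exact Finset.prod_nonneg fun p _ => by
            have := one_le_tilt t p
            have : 0 ≤ (tilt t p - 1) / p := div_nonneg (by linarith) (by positivity)
            linarith
        · exact prod_tilt_le ht
    _ = _ := by
        have : Real.exp (8 - t * s) = Real.exp (-(t * s)) * Real.exp 4 ^ 2 := by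
          rw [← Real.exp_nat_mul, ← Real.exp_add]; congr 1; push_cast; ring
        rw [this]; ring

lemma sum_edges_le {ι : Type*} [DecidableEq ι] {μ ν : ι → ℝ} (hμ : ∀ v, 0 ≤ μ v)
    (hν : ∀ v, 0 ≤ ν v) {V W : Finset ι} {E : Finset (ι × ι)}
    (hE : ∀ x ∈ E, x.1 ∈ V ∧ x.2 ∈ W) :
    ∑ x ∈ E, μ x.1 * ν x.2 ≤ (∑ v ∈ V, μ v) * ∑ w ∈ W, ν w := by
  rw [Finset.sum_mul_sum, ← Finset.sum_product']
  refine Finset.sum_le_sum_of_subset_of_nonneg (fun x hx => ?_)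
    fun x _ _ => mul_nonneg (hμ _) (hν _)
  exact Finset.mem_product.2 (hE x hx)


lemma sum_edges_erase_le {ι : Type*} [DecidableEq ι] {μ ν : ι → ℝ} (hμ : ∀ v, 0 ≤ μ v)
    (hν : ∀ v, 0 ≤ ν v) {V W : Finset ι} {E : Finset (ι × ι)} {K : ℝ} (hK : 0 ≤ K) {v : ι}
    (hv : v ∈ V)
    (hsmall : μ v * ∑ x ∈ E with x.1 = v, ν x.2 ≤ 3 / 4 * K * (∑ w ∈ W, ν w) ^ (3/4 : ℝ) *
      (∑ v ∈ V, μ v) ^ (-(1/4) : ℝ) * μ v)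
    (hM : 0 < ∑ v ∈ V, μ v)
    (ih : ∑ x ∈ E with x.1 ≠ v, μ x.1 * ν x.2 ≤
      K * ((∑ v ∈ V.erase v, μ v) * ∑ w ∈ W, ν w) ^ (3/4 : ℝ)) :
    ∑ x ∈ E, μ x.1 * ν x.2 ≤ K * ((∑ v ∈ V, μ v) * ∑ w ∈ W, ν w) ^ (3/4 : ℝ) := by
  have hN : 0 ≤ ∑ w ∈ W, ν w := Finset.sum_nonneg fun _ _ => hν _
  have hM' : 0 ≤ ∑ v ∈ V.erase v, μ v := Finset.sum_nonneg fun _ _ => hμ _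
  have hMe : ∑ v ∈ V.erase v, μ v = ∑ v ∈ V, μ v - μ v := by
    rw [← Finset.add_sum_erase V μ hv]; ring
  have hx : μ v ≤ ∑ v ∈ V, μ v := Finset.single_le_sum (fun v _ => hμ v) hv
  have hsplit : ∑ x ∈ E, μ x.1 * ν x.2 = μ v * ∑ x ∈ E with x.1 = v, ν x.2 +
      ∑ x ∈ E with x.1 ≠ v, μ x.1 * ν x.2 := by
    rw [← Finset.sum_filter_add_sum_filter_not E (fun x => x.1 = v), Finset.mul_sum]
    congr 1
    refine Finset.sum_congr rfl fun x hx => ?_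
    rw [(Finset.mem_filter.1 hx).2]
  rw [Real.mul_rpow hM' hN, hMe] at ih
  rw [hsplit, Real.mul_rpow hM.le hN]
  have h := rpow_sub_add_le hM hx
  have hN' : 0 ≤ K * (∑ w ∈ W, ν w) ^ (3/4 : ℝ) := by positivity
  nlinarith [mul_le_mul_of_nonneg_left h hN']

lemma sum_map_swap {ι : Type*} [DecidableEq ι] {μ ν : ι → ℝ} (E : Finset (ι × ι))
    (q : ι × ι → Prop) [DecidablePred q] [DecidablePred fun x : ι × ι => q x.swap] :
    ∑ x ∈ E.image Prod.swap with q x, μ x.1 * ν x.2 =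
      ∑ x ∈ E with q x.swap, ν x.1 * μ x.2 := by
  rw [Finset.filter_image, Finset.sum_image (fun x _ y _ h => Prod.swap_injective h)]
  exact Finset.sum_congr (by ext; simp) fun x _ => mul_comm _ _

lemma sum_edges_erase_right_le {ι : Type*} [DecidableEq ι] {μ ν : ι → ℝ} (hμ : ∀ v, 0 ≤ μ v)
    (hν : ∀ v, 0 ≤ ν v) {V W : Finset ι} {E : Finset (ι × ι)} {K : ℝ} (hK : 0 ≤ K) {w : ι}
    (hw : w ∈ W)
    (hsmall : ν w * ∑ x ∈ E with x.2 = w, μ x.1 ≤ 3 / 4 * K * (∑ v ∈ V, μ v) ^ (3/4 : ℝ) *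
      (∑ w ∈ W, ν w) ^ (-(1/4) : ℝ) * ν w)
    (hN : 0 < ∑ w ∈ W, ν w)
    (ih : ∑ x ∈ E with x.2 ≠ w, μ x.1 * ν x.2 ≤
      K * ((∑ v ∈ V, μ v) * ∑ w ∈ W.erase w, ν w) ^ (3/4 : ℝ)) :
    ∑ x ∈ E, μ x.1 * ν x.2 ≤ K * ((∑ v ∈ V, μ v) * ∑ w ∈ W, ν w) ^ (3/4 : ℝ) := by
  have h := sum_edges_erase_le (E := E.image Prod.swap) hν hμ hK hw (W := V) (by
      rw [Finset.filter_image, Finset.sum_image (fun x _ y _ h => Prod.swap_injective h)]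
      simpa using hsmall) hN (by
      rw [sum_map_swap, mul_comm (∑ w ∈ W.erase w, ν w)]
      simpa using ih)
  rw [mul_comm (∑ v ∈ V, μ v)]
  refine le_trans (le_of_eq ?_) h
  rw [Finset.sum_image (fun x _ y _ h => Prod.swap_injective h)]
  exact Finset.sum_congr rfl fun x _ => mul_comm _ _

theorem sum_edges_le_of_common_exponents {ι : Type*} [DecidableEq ι] {P : Finset ℕ}
    (hP : ∀ p ∈ P, p.Prime) (k : ℕ → ℕ) (e : ι → ℕ → ℕ) {μ ν : ι → ℝ} (hμ : ∀ v, 0 ≤ μ v)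
    (hν : ∀ v, 0 ≤ ν v) {T₁ T₂ s K : ℝ} {t : ℕ} (ht : 1 ≤ t) (hT₁ : 0 ≤ T₁) (hT₂ : 0 ≤ T₂)
    (hK : 0 ≤ K) (hK4 : 16 * (T₁ * T₂) * Real.exp (16 - t * s) ≤ K ^ 4)
    (V W : Finset ι) (E : Finset (ι × ι))
    (hV : ∀ v ∈ V, ∀ v' ∈ V, (∀ p ∈ P, e v p = e v' p) → v = v')
    (hW : ∀ v ∈ W, ∀ v' ∈ W, (∀ p ∈ P, e v p = e v' p) → v = v')
    (hE : ∀ x ∈ E, x.1 ∈ V ∧ x.2 ∈ W)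
    (h₁ : ∀ x ∈ E, μ x.1 * lcmProd P (e x.1) (e x.2) ≤ T₁ * totientProd P (e x.1))
    (h₂ : ∀ x ∈ E, ν x.2 * lcmProd P (e x.1) (e x.2) ≤ T₂ * totientProd P (e x.2))
    (hk : ∀ x ∈ E, ∀ p ∈ P, e x.1 p = k p ∨ e x.2 p = k p)
    (hs : ∀ x ∈ E, s ≤ ∑ l ∈ P with t ≤ l ∧ e x.1 l ≠ k l, (1 : ℝ) / l) :
    ∑ x ∈ E, μ x.1 * ν x.2 ≤ K * ((∑ v ∈ V, μ v) * ∑ w ∈ W, ν w) ^ (3/4 : ℝ) := by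
  induction hn : V.card + W.card using Nat.strong_induction_on generalizing V W E with
  | _ n ih =>
  have hM0 : 0 ≤ ∑ v ∈ V, μ v := Finset.sum_nonneg fun _ _ => hμ _
  have hN0 : 0 ≤ ∑ w ∈ W, ν w := Finset.sum_nonneg fun _ _ => hν _
  rcases hM0.eq_or_lt with hM | hM
  · refine (sum_edges_le hμ hν hE).trans ?_
    rw [← hM, zero_mul]; positivity
  rcases hN0.eq_or_lt with hN | hN
  · refine (sum_edges_le hμ hν hE).trans ?_
    rw [← hN, mul_zero]; positivity
  set M := ∑ v ∈ V, μ v with hMdef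
  set N := ∑ w ∈ W, ν w with hNdef
  by_cases hv : ∃ v ∈ V, μ v * ∑ x ∈ E with x.1 = v, ν x.2 ≤
      3 / 4 * K * N ^ (3/4 : ℝ) * M ^ (-(1/4) : ℝ) * μ v
  · obtain ⟨v, hvV, hv⟩ := hv
    refine sum_edges_erase_le hμ hν hK hvV hv hM ?_
    have hsub : E.filter (fun x => x.1 ≠ v) ⊆ E := Finset.filter_subset _ _
    refine ih _ ?_ (V.erase v) W _ (fun a ha b hb => hV a (Finset.mem_of_mem_erase ha) b
      (Finset.mem_of_mem_erase hb)) hW (fun x hx => ?_) (fun x hx => h₁ x (hsub hx))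
      (fun x hx => h₂ x (hsub hx)) (fun x hx => hk x (hsub hx)) (fun x hx => hs x (hsub hx)) rfl
    · have := Finset.card_erase_lt_of_mem hvV; omega
    · exact ⟨Finset.mem_erase.2 ⟨(Finset.mem_filter.1 hx).2, (hE x (hsub hx)).1⟩, (hE x (hsub hx)).2⟩
  by_cases hw : ∃ w ∈ W, ν w * ∑ x ∈ E with x.2 = w, μ x.1 ≤
      3 / 4 * K * M ^ (3/4 : ℝ) * N ^ (-(1/4) : ℝ) * ν w
  · obtain ⟨w, hwW, hw⟩ := hw
    refine sum_edges_erase_right_le hμ hν hK hwW hw hN ?_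
    have hsub : E.filter (fun x => x.2 ≠ w) ⊆ E := Finset.filter_subset _ _
    refine ih _ ?_ V (W.erase w) _ hV (fun a ha b hb => hW a (Finset.mem_of_mem_erase ha) b
      (Finset.mem_of_mem_erase hb)) (fun x hx => ?_) (fun x hx => h₁ x (hsub hx))
      (fun x hx => h₂ x (hsub hx)) (fun x hx => hk x (hsub hx)) (fun x hx => hs x (hsub hx)) rfl
    · have := Finset.card_erase_lt_of_mem hwW; omega
    · exact ⟨(hE x (hsub hx)).1, Finset.mem_erase.2 ⟨(Finset.mem_filter.1 hx).2, (hE x (hsub hx)).2⟩⟩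
  push Not at hv hw
  have hVne : V.Nonempty := Finset.nonempty_of_ne_empty fun h => by simp [hMdef, h] at hM
  have hWne : W.Nonempty := Finset.nonempty_of_ne_empty fun h => by simp [hNdef, h] at hN
  obtain ⟨v, hvV, hvmax⟩ := V.exists_max_image (fun v => excess P k (e v)) hVne
  obtain ⟨w, hwW, hwmax⟩ := W.exists_max_image (fun v => excess P k (e v)) hWne
  have hinj₁ : ∀ x ∈ E.filter (fun x => x.1 = v), ∀ y ∈ E.filter (fun x => x.1 = v),
      (∀ p ∈ P, e x.2 p = e y.2 p) → x = y := by
    intro x hx y hy hxy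
    rw [Finset.mem_filter] at hx hy
    exact Prod.ext (hx.2.trans hy.2.symm) (hW _ (hE x hx.1).2 _ (hE y hy.1).2 hxy)
  have hinj₂ : ∀ x ∈ E.filter (fun x => x.2 = w), ∀ y ∈ E.filter (fun x => x.2 = w),
      (∀ p ∈ P, e x.1 p = e y.1 p) → x = y := by
    intro x hx y hy hxy
    rw [Finset.mem_filter] at hx hy
    exact Prod.ext (hV _ (hE x hx.1).1 _ (hE y hy.1).1 hxy) (hx.2.trans hy.2.symm)
  have hdv := sum_neighbors_le hP (k := k) (e := fun x : ι × ι => e x.2) hinj₁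
    (ν := fun x => ν x.2) (s := 0) hT₂ ht (e v) (A := excess P k (e w))
    (fun x hx => hwmax _ (hE x (Finset.mem_filter.1 hx).1).2)
    (fun x hx p hp => by
      have h := Finset.mem_filter.1 hx
      have := hk x h.1 p hp; rwa [h.2] at this)
    (fun x hx => by
      have h := Finset.mem_filter.1 hx
      have := h₂ x h.1; rwa [h.2] at this)
    (fun x _ => Finset.sum_nonneg fun _ _ => by positivity)
  have hdw := sum_neighbors_le hP (k := k) (e := fun x : ι × ι => e x.1) hinj₂
    (ν := fun x => μ x.1) (s := s) hT₁ ht (e w) (A := excess P k (e v))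
    (fun x hx => hvmax _ (hE x (Finset.mem_filter.1 hx).1).1)
    (fun x hx p hp => by
      have h := Finset.mem_filter.1 hx
      have := hk x h.1 p hp; rw [h.2] at this; exact this.symm)
    (fun x hx => by
      have h := Finset.mem_filter.1 hx
      have := h₁ x h.1; rwa [h.2, lcmProd_comm] at this)
    (fun x hx => hs x (Finset.mem_filter.1 hx).1)
  by_cases hKMN : (M * N) ^ (1/4 : ℝ) ≤ K
  · refine (sum_edges_le hμ hν hE).trans ?_
    calc M * N = (M * N) ^ (1/4 : ℝ) * (M * N) ^ (3/4:ℝ) := by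
          rw [← Real.rpow_add (by positivity)]; norm_num
      _ ≤ _ := by gcongr
  exfalso
  push Not at hKMN
  have hvpos : 0 < μ v := by
    refine (hμ v).lt_of_ne fun h => ?_
    have := hv v hvV; simp [← h] at this
  have hwpos : 0 < ν w := by
    refine (hν w).lt_of_ne fun h => ?_
    have := hw w hwW; simp [← h] at this
  have hv1 : 3 / 4 * K * N ^ (3/4 : ℝ) * M ^ (-(1/4) : ℝ) < ∑ x ∈ E with x.1 = v, ν x.2 := by
    have := hv v hvV; rw [mul_comm (μ v)] at this
    exact lt_of_mul_lt_mul_right this hvpos.le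
  have hw1 : 3 / 4 * K * M ^ (3/4 : ℝ) * N ^ (-(1/4) : ℝ) < ∑ x ∈ E with x.2 = w, μ x.1 := by
    have := hw w hwW; rw [mul_comm (ν w)] at this
    exact lt_of_mul_lt_mul_right this hwpos.le
  set d₁ := ∑ x ∈ E with x.1 = v, ν x.2
  set d₂ := ∑ x ∈ E with x.2 = w, μ x.1
  have hA1 : (0:ℝ) < excess P k (e v) := by exact_mod_cast excess_pos hP k (e v)
  have hA2 : (0:ℝ) < excess P k (e w) := by exact_mod_cast excess_pos hP k (e w)
  have hd₂ : 0 ≤ d₂ := Finset.sum_nonneg fun _ _ => hμ _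
  have hprod : d₁ * d₂ ≤ T₁ * T₂ * Real.exp (16 - t * s) := by
    have := mul_le_mul hdv hdw (by positivity) (by positivity)
    have hexp : Real.exp (16 - t * s) = Real.exp (8 - t * 0) * Real.exp (8 - t * s) := by
      rw [← Real.exp_add]; congr 1; ring
    rw [hexp]
    refine le_of_mul_le_mul_right ?_ (mul_pos hA1 hA2)
    linarith
  have hlow : 9 / 16 * K ^ 2 * (M * N) ^ (1/2 : ℝ) ≤ d₁ * d₂ := by
    have := mul_le_mul hv1.le hw1.le (by positivity) (by
      exact le_trans (by positivity) hv1.le)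
    refine le_trans (le_of_eq ?_) this
    have e1 : M ^ (-(1/4) : ℝ) * M ^ (3/4 : ℝ) = M ^ (1/2:ℝ) := by
      rw [← Real.rpow_add hM]; norm_num
    have e2 : N ^ (-(1/4) : ℝ) * N ^ (3/4 : ℝ) = N ^ (1/2:ℝ) := by
      rw [← Real.rpow_add hN]; norm_num
    rw [Real.mul_rpow hM.le hN.le, ← e1, ← e2]; ring
  have hsq : (M * N) ^ (1/2 : ℝ) = ((M * N) ^ (1/4 : ℝ)) ^ 2 := by
    rw [← Real.rpow_natCast, ← Real.rpow_mul (by positivity)]; norm_num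
  have hq : 0 < (M * N) ^ (1/4 : ℝ) := by positivity
  rw [hsq] at hlow
  set q := (M * N) ^ (1/4 : ℝ)
  have hK2 : K ^ 2 < q ^ 2 := by gcongr
  have hpos : 0 < d₁ * d₂ := mul_pos (lt_of_le_of_lt (by positivity) hv1)
    (lt_of_le_of_lt (by positivity) hw1)
  nlinarith [sq_nonneg K]

lemma sum_edges_le_of_common_exponents_right {ι : Type*} [DecidableEq ι] {P : Finset ℕ}
    (hP : ∀ p ∈ P, p.Prime) (k : ℕ → ℕ) (e : ι → ℕ → ℕ) {μ ν : ι → ℝ} (hμ : ∀ v, 0 ≤ μ v)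
    (hν : ∀ v, 0 ≤ ν v) {T₁ T₂ s K : ℝ} {t : ℕ} (ht : 1 ≤ t) (hT₁ : 0 ≤ T₁) (hT₂ : 0 ≤ T₂)
    (hK : 0 ≤ K) (hK4 : 16 * (T₁ * T₂) * Real.exp (16 - t * s) ≤ K ^ 4)
    (V W : Finset ι) (E : Finset (ι × ι))
    (hV : ∀ v ∈ V, ∀ v' ∈ V, (∀ p ∈ P, e v p = e v' p) → v = v')
    (hW : ∀ v ∈ W, ∀ v' ∈ W, (∀ p ∈ P, e v p = e v' p) → v = v')
    (hE : ∀ x ∈ E, x.1 ∈ V ∧ x.2 ∈ W)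
    (h₁ : ∀ x ∈ E, μ x.1 * lcmProd P (e x.1) (e x.2) ≤ T₁ * totientProd P (e x.1))
    (h₂ : ∀ x ∈ E, ν x.2 * lcmProd P (e x.1) (e x.2) ≤ T₂ * totientProd P (e x.2))
    (hk : ∀ x ∈ E, ∀ p ∈ P, e x.1 p = k p ∨ e x.2 p = k p)
    (hs : ∀ x ∈ E, s ≤ ∑ l ∈ P with t ≤ l ∧ e x.2 l ≠ k l, (1 : ℝ) / l) :
    ∑ x ∈ E, μ x.1 * ν x.2 ≤ K * ((∑ v ∈ V, μ v) * ∑ w ∈ W, ν w) ^ (3/4 : ℝ) := by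
  have hsw : ∀ {q : ι × ι → Prop}, (∀ x ∈ E, q x.swap) → ∀ x ∈ E.image Prod.swap, q x := by
    intro q h x hx
    obtain ⟨y, hy, rfl⟩ := Finset.mem_image.1 hx
    exact h y hy
  have h := sum_edges_le_of_common_exponents hP k e hν hμ ht hT₂ hT₁ hK
    (by rwa [mul_comm T₂]) W V (E.image Prod.swap) hW hV (hsw fun x hx => (hE x hx).symm)
    (hsw fun x hx => by rw [lcmProd_comm]; exact h₂ x hx)
    (hsw fun x hx => by rw [lcmProd_comm]; exact h₁ x hx)
    (hsw fun x hx p hp => (hk x hx p hp).symm) (hsw hs)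
  rw [mul_comm (∑ v ∈ V, μ v)]
  refine le_trans (le_of_eq ?_) h
  rw [Finset.sum_image (fun x _ y _ h => Prod.swap_injective h)]
  exact Finset.sum_congr rfl fun x _ => mul_comm _ _

/-- The bilinear estimate with constant `B` for edge sets whose exponents are recorded on the
primes in `P`. -/
def BilinearBound {ι : Type*} (t : ℕ) (e : ι → ℕ → ℕ) (μ ν : ι → ℝ) (P : Finset ℕ)
    (B : ℝ) : Prop :=
  ∀ (V W : Finset ι) (E : Finset (ι × ι)) (T₁ T₂ L : ℝ), 0 ≤ T₁ → 0 ≤ T₂ →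
    (∀ v ∈ V, ∀ v' ∈ V, (∀ p ∈ P, e v p = e v' p) → v = v') →
    (∀ v ∈ W, ∀ v' ∈ W, (∀ p ∈ P, e v p = e v' p) → v = v') →
    (∀ x ∈ E, x.1 ∈ V ∧ x.2 ∈ W) →
    (∀ x ∈ E, μ x.1 * lcmProd P (e x.1) (e x.2) ≤ T₁ * totientProd P (e x.1)) →
    (∀ x ∈ E, ν x.2 * lcmProd P (e x.1) (e x.2) ≤ T₂ * totientProd P (e x.2)) →
    (∀ x ∈ E, L ≤ ∑ l ∈ P with t ≤ l ∧ e x.1 l ≠ e x.2 l, (1 : ℝ) / l) →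
    ∑ x ∈ E, μ x.1 * ν x.2 ≤ B * (T₁ * T₂) ^ (1/4 : ℝ) * Real.exp (-(t * L / 8)) *
      ((∑ v ∈ V, μ v) * ∑ w ∈ W, ν w) ^ (3/4 : ℝ)

lemma exp_one_div_eight_le : Real.exp (1 / 8) ≤ 2 := by
  have h := Real.exp_one_lt_d9
  calc Real.exp (1/8) ≤ Real.exp 1 ^ (1/2:ℝ) := by
        rw [← Real.exp_mul]; gcongr; norm_num
    _ ≤ 4 ^ (1/2:ℝ) := by gcongr; linarith
    _ = 2 := by
        rw [show (4:ℝ) = 2 ^ (2:ℝ) by norm_num, ← Real.rpow_mul (by norm_num)]; norm_num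

/-- Loss factor at one prime in the bilinear estimate. -/
lemma split_factor_le {p t i j : ℕ} (hp : p.Prime) {T₁ T₂ L : ℝ} (hT₁ : 0 ≤ T₁) (hT₂ : 0 ≤ T₂) :
    (T₁ * (Nat.totient (p ^ i) : ℝ) / (p : ℝ) ^ max i j *
      (T₂ * (Nat.totient (p ^ j) : ℝ) / (p : ℝ) ^ max i j)) ^ (1/4 : ℝ) *
      Real.exp (-(t * (L - if t ≤ p ∧ i ≠ j then 1 / (p : ℝ) else 0) / 8)) ≤
    (T₁ * T₂) ^ (1/4 : ℝ) * Real.exp (-(t * L / 8)) * expKernel ((p : ℝ) ^ (-(1/4) : ℝ)) i j := by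
  have hp0 : (0:ℝ) < p := by exact_mod_cast hp.pos
  have hi : (Nat.totient (p ^ i) : ℝ) ≤ (p:ℝ) ^ i := by exact_mod_cast Nat.totient_le _
  have hj : (Nat.totient (p ^ j) : ℝ) ≤ (p:ℝ) ^ j := by exact_mod_cast Nat.totient_le _
  have h1 : (T₁ * (Nat.totient (p ^ i) : ℝ) / (p : ℝ) ^ max i j *
      (T₂ * (Nat.totient (p ^ j) : ℝ) / (p : ℝ) ^ max i j)) ≤
      (T₁ * T₂) * (((p : ℝ) ^ ((i - j) + (j - i)))⁻¹) := by
    calc _ ≤ T₁ * (p:ℝ) ^ i / (p : ℝ) ^ max i j * (T₂ * (p:ℝ) ^ j / (p : ℝ) ^ max i j) := by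
          gcongr
      _ = (T₁ * T₂) * ((p:ℝ) ^ (i + j) / (p : ℝ) ^ (max i j + max i j)) := by
          rw [pow_add, pow_add]; field_simp
      _ = _ := by
          congr 1
          rw [div_eq_iff (by positivity), eq_comm, inv_mul_eq_iff_eq_mul₀ (by positivity),
            ← pow_add]
          congr 1; omega
  have h2 : (T₁ * (Nat.totient (p ^ i) : ℝ) / (p : ℝ) ^ max i j *
      (T₂ * (Nat.totient (p ^ j) : ℝ) / (p : ℝ) ^ max i j)) ^ (1/4 : ℝ) ≤
      (T₁ * T₂) ^ (1/4 : ℝ) * ((p : ℝ) ^ (-(1/4) : ℝ)) ^ ((i - j) + (j - i)) := by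
    refine (Real.rpow_le_rpow (by positivity) h1 (by norm_num)).trans (le_of_eq ?_)
    rw [Real.mul_rpow (by positivity) (by positivity), Real.rpow_neg hp0.le, inv_pow,
      Real.inv_rpow (by positivity), ← Real.rpow_natCast, ← Real.rpow_natCast,
      ← Real.rpow_mul hp0.le, ← Real.rpow_mul hp0.le, mul_comm (1/4:ℝ)]
  have h3 : Real.exp (-(t * (L - if t ≤ p ∧ i ≠ j then 1 / (p : ℝ) else 0) / 8)) ≤
      Real.exp (-(t * L / 8)) * (if i = j then 1 else 2) := by
    by_cases hij : i = j
    · simp [hij]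
    · by_cases htp : t ≤ p
      · have ht : (t:ℝ) / p ≤ 1 := by rw [div_le_one hp0]; exact_mod_cast htp
        calc _ = Real.exp (-(t * L / 8)) * Real.exp (t / p / 8) := by
              rw [← Real.exp_add]; congr 1; simp [hij, htp]; ring
          _ ≤ Real.exp (-(t * L / 8)) * Real.exp (1 / 8) := by gcongr
          _ ≤ _ := by simp only [hij, if_false]; gcongr; exact exp_one_div_eight_le
      · simp [hij, htp]
        have := Real.exp_pos (-(t * L / 8)); linarith
  refine (mul_le_mul h2 h3 (Real.exp_pos _).le (by positivity)).trans (le_of_eq ?_)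
  unfold expKernel
  split_ifs with hij
  · simp [hij]
  · ring

lemma BilinearBound.split {ι : Type*} [DecidableEq ι] {t : ℕ} {e : ι → ℕ → ℕ} {μ ν : ι → ℝ}
    {P : Finset ℕ} {B : ℝ} {p : ℕ} (hpP : p ∈ P) (hp : p.Prime) (hB0 : 0 ≤ B)
    (hB : BilinearBound t e μ ν (P.erase p) B) (hμ : ∀ v, 0 ≤ μ v)
    (hν : ∀ v, 0 ≤ ν v) {V W : Finset ι} {E : Finset (ι × ι)} {T₁ T₂ L : ℝ} (hT₁ : 0 ≤ T₁)
    (hT₂ : 0 ≤ T₂)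
    (hV : ∀ v ∈ V, ∀ v' ∈ V, (∀ p ∈ P, e v p = e v' p) → v = v')
    (hW : ∀ v ∈ W, ∀ v' ∈ W, (∀ p ∈ P, e v p = e v' p) → v = v')
    (hE : ∀ x ∈ E, x.1 ∈ V ∧ x.2 ∈ W)
    (h₁ : ∀ x ∈ E, μ x.1 * lcmProd P (e x.1) (e x.2) ≤ T₁ * totientProd P (e x.1))
    (h₂ : ∀ x ∈ E, ν x.2 * lcmProd P (e x.1) (e x.2) ≤ T₂ * totientProd P (e x.2))
    (hL : ∀ x ∈ E, L ≤ ∑ l ∈ P with t ≤ l ∧ e x.1 l ≠ e x.2 l, (1 : ℝ) / l) (i j : ℕ) :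
    ∑ x ∈ E with e x.1 p = i ∧ e x.2 p = j, μ x.1 * ν x.2 ≤
      B * (T₁ * T₂) ^ (1/4 : ℝ) * Real.exp (-(t * L / 8)) *
      (expKernel ((p : ℝ) ^ (-(1/4) : ℝ)) i j *
      ((∑ v ∈ V with e v p = i, μ v) * ∑ w ∈ W with e w p = j, ν w) ^ (3/4 : ℝ)) := by
  have hp0 : (0:ℝ) < p := by exact_mod_cast hp.pos
  have hinj : ∀ {U : Finset ι} {i : ℕ}, (∀ v ∈ U, ∀ v' ∈ U, (∀ p ∈ P, e v p = e v' p) → v = v') →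
      ∀ v ∈ U.filter (fun v => e v p = i), ∀ v' ∈ U.filter (fun v => e v p = i),
      (∀ q ∈ P.erase p, e v q = e v' q) → v = v' := by
    intro U i hU v hv v' hv' h
    rw [Finset.mem_filter] at hv hv'
    refine hU v hv.1 v' hv'.1 fun q hq => ?_
    by_cases hqp : q = p
    · rw [hqp, hv.2, hv'.2]
    · exact h q (Finset.mem_erase.2 ⟨hqp, hq⟩)
  have hlcm : ∀ x y : ℕ → ℕ, lcmProd P x y = (p:ℝ) ^ max (x p) (y p) * lcmProd (P.erase p) x y :=
    fun x y => (Finset.mul_prod_erase P (fun p => (p : ℝ) ^ (max (x p) (y p))) hpP).symm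
  have htot : ∀ x : ℕ → ℕ, totientProd P x = (Nat.totient (p ^ x p) : ℝ) *
      totientProd (P.erase p) x :=
    fun x => (Finset.mul_prod_erase P (fun p => (Nat.totient (p ^ x p) : ℝ)) hpP).symm
  have h := hB (V.filter fun v => e v p = i) (W.filter fun w => e w p = j)
    (E.filter fun x => e x.1 p = i ∧ e x.2 p = j)
    (T₁ * (Nat.totient (p ^ i) : ℝ) / (p : ℝ) ^ max i j)
    (T₂ * (Nat.totient (p ^ j) : ℝ) / (p : ℝ) ^ max i j)
    (L - if t ≤ p ∧ i ≠ j then 1 / (p : ℝ) else 0) (by positivity) (by positivity)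
    (hinj hV) (hinj hW) (fun x hx => by
      rw [Finset.mem_filter] at hx
      exact ⟨Finset.mem_filter.2 ⟨(hE x hx.1).1, hx.2.1⟩,
        Finset.mem_filter.2 ⟨(hE x hx.1).2, hx.2.2⟩⟩)
    (fun x hx => by
      rw [Finset.mem_filter] at hx
      have := h₁ x hx.1
      rw [hlcm, htot, hx.2.1, hx.2.2] at this
      rw [div_mul_eq_mul_div, le_div_iff₀ (by positivity)]
      linarith)
    (fun x hx => by
      rw [Finset.mem_filter] at hx
      have := h₂ x hx.1
      rw [hlcm, htot, hx.2.1, hx.2.2] at this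
      rw [div_mul_eq_mul_div, le_div_iff₀ (by positivity)]
      linarith)
    (fun x hx => by
      rw [Finset.mem_filter] at hx
      have := hL x hx.1
      rw [Finset.sum_filter, ← Finset.add_sum_erase P _ hpP, hx.2.1, hx.2.2,
        ← Finset.sum_filter] at this
      linarith)
  refine h.trans ?_
  have hs := split_factor_le (t := t) (i := i) (j := j) hp hT₁ hT₂ (L := L)
  have h0 : 0 ≤ ((∑ v ∈ V with e v p = i, μ v) * ∑ w ∈ W with e w p = j, ν w) ^ (3/4 : ℝ) := by
    have : 0 ≤ ∑ v ∈ V with e v p = i, μ v := Finset.sum_nonneg fun _ _ => hμ _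
    have : 0 ≤ ∑ w ∈ W with e w p = j, ν w := Finset.sum_nonneg fun _ _ => hν _
    positivity
  have := mul_le_mul_of_nonneg_right (mul_le_mul_of_nonneg_left hs hB0) h0
  refine le_trans (le_of_eq ?_) (this.trans (le_of_eq ?_)) <;> ring

lemma exists_normalized {ι : Type*} {V : Finset ι} {μ : ι → ℝ} (hμ : ∀ v, 0 ≤ μ v)
    (hM : 0 < ∑ v ∈ V, μ v) (f : ι → ℕ) {I : Finset ℕ} (hI : ∀ v ∈ V, f v ∈ I) :
    ∃ a : ℕ → ℝ, (∀ i, 0 ≤ a i) ∧ ∑ i ∈ I, a i ^ 4 = 1 ∧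
      ∀ i, (∑ v ∈ V with f v = i, μ v) ^ (3/4 : ℝ) = (∑ v ∈ V, μ v) ^ (3/4 : ℝ) * a i ^ 3 := by
  have h0 : ∀ i, 0 ≤ ∑ v ∈ V with f v = i, μ v := fun i => Finset.sum_nonneg fun _ _ => hμ _
  refine ⟨fun i => ((∑ v ∈ V with f v = i, μ v) / ∑ v ∈ V, μ v) ^ (1/4 : ℝ), fun i => ?_, ?_,
    fun i => ?_⟩
  · have := h0 i; positivity
  · have : ∀ i ∈ I, (((∑ v ∈ V with f v = i, μ v) / ∑ v ∈ V, μ v) ^ (1/4 : ℝ)) ^ 4 =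
        (∑ v ∈ V with f v = i, μ v) / ∑ v ∈ V, μ v := by
      intro i _
      have := h0 i
      rw [← Real.rpow_natCast, ← Real.rpow_mul (by positivity)]; norm_num
    rw [Finset.sum_congr rfl this, ← Finset.sum_div, Finset.sum_fiberwise_of_maps_to hI,
      div_self hM.ne']
  · have h := h0 i
    rw [← Real.rpow_natCast, ← Real.rpow_mul (by positivity)]
    rw [show (1/4:ℝ) * (3:ℕ) = 3/4 by norm_num, ← Real.mul_rpow hM.le (by positivity),
      mul_div_cancel₀ _ hM.ne']

lemma sum_edges_fiberwise_le {ι : Type*} [DecidableEq ι] {μ ν : ι → ℝ} (hμ : ∀ v, 0 ≤ μ v)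
    (hν : ∀ v, 0 ≤ ν v) {E E' : Finset (ι × ι)} (hsub : E' ⊆ E) (f : ι → ℕ) {J : Finset ℕ}
    (hJ : ∀ x ∈ E', f x.1 ∈ J ∧ f x.2 ∈ J) {F : ℝ} {g : ℕ → ℕ → ℝ}
    (h : ∀ i j, ∑ x ∈ E with f x.1 = i ∧ f x.2 = j, μ x.1 * ν x.2 ≤ F * g i j) :
    ∑ x ∈ E', μ x.1 * ν x.2 ≤ F * ∑ i ∈ J, ∑ j ∈ J, g i j := by
  have hm : ∀ x ∈ E', (fun x : ι × ι => (f x.1, f x.2)) x ∈ J ×ˢ J := fun x hx =>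
    Finset.mem_product.2 (hJ x hx)
  rw [← Finset.sum_fiberwise_of_maps_to hm, ← Finset.sum_product', Finset.mul_sum]
  refine Finset.sum_le_sum fun ij _ => le_trans ?_ (h ij.1 ij.2)
  refine Finset.sum_le_sum_of_subset_of_nonneg (fun x hx => ?_)
    fun x _ _ => mul_nonneg (hμ _) (hν _)
  rw [Finset.mem_filter] at hx ⊢
  exact ⟨hsub hx.1, congrArg Prod.fst hx.2, congrArg Prod.snd hx.2⟩

lemma BilinearBound.exists_split {ι : Type*} [DecidableEq ι] {t : ℕ} {e : ι → ℕ → ℕ}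
    {μ ν : ι → ℝ} {P : Finset ℕ} {B : ℝ} {p : ℕ} (hpP : p ∈ P) (hp : p.Prime) (hB0 : 0 ≤ B)
    (hB : BilinearBound t e μ ν (P.erase p) B) (hμ : ∀ v, 0 ≤ μ v)
    (hν : ∀ v, 0 ≤ ν v) {V W : Finset ι} {E : Finset (ι × ι)} {T₁ T₂ L : ℝ} (hT₁ : 0 ≤ T₁)
    (hT₂ : 0 ≤ T₂)
    (hV : ∀ v ∈ V, ∀ v' ∈ V, (∀ p ∈ P, e v p = e v' p) → v = v')
    (hW : ∀ v ∈ W, ∀ v' ∈ W, (∀ p ∈ P, e v p = e v' p) → v = v')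
    (hE : ∀ x ∈ E, x.1 ∈ V ∧ x.2 ∈ W)
    (h₁ : ∀ x ∈ E, μ x.1 * lcmProd P (e x.1) (e x.2) ≤ T₁ * totientProd P (e x.1))
    (h₂ : ∀ x ∈ E, ν x.2 * lcmProd P (e x.1) (e x.2) ≤ T₂ * totientProd P (e x.2))
    (hL : ∀ x ∈ E, L ≤ ∑ l ∈ P with t ≤ l ∧ e x.1 l ≠ e x.2 l, (1 : ℝ) / l)
    (hM : 0 < ∑ v ∈ V, μ v) (hN : 0 < ∑ w ∈ W, ν w) :
    ∃ (I : Finset ℕ) (a b : ℕ → ℝ), (∀ i, 0 ≤ a i) ∧ (∀ i, 0 ≤ b i) ∧ ∑ i ∈ I, a i ^ 4 = 1 ∧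
      ∑ i ∈ I, b i ^ 4 = 1 ∧ (∀ x ∈ E, e x.1 p ∈ I ∧ e x.2 p ∈ I) ∧
      ∀ E' ⊆ E, ∀ J, (∀ x ∈ E', e x.1 p ∈ J ∧ e x.2 p ∈ J) →
        ∑ x ∈ E', μ x.1 * ν x.2 ≤ B * (T₁ * T₂) ^ (1/4 : ℝ) * Real.exp (-(t * L / 8)) *
          ((∑ v ∈ V, μ v) * ∑ w ∈ W, ν w) ^ (3/4 : ℝ) *
          ∑ i ∈ J, ∑ j ∈ J, expKernel ((p : ℝ) ^ (-(1/4) : ℝ)) i j * (a i ^ 3 * b j ^ 3) := by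
  obtain ⟨a, ha0, ha1, ha⟩ := exists_normalized hμ hM (fun v => e v p)
    (I := (V ∪ W).image fun v => e v p) (fun v hv => Finset.mem_image_of_mem (fun v => e v p)
      (Finset.mem_union_left _ hv))
  obtain ⟨b, hb0, hb1, hb⟩ := exists_normalized hν hN (fun v => e v p)
    (I := (V ∪ W).image fun v => e v p) (fun v hv => Finset.mem_image_of_mem (fun v => e v p)
      (Finset.mem_union_right _ hv))
  refine ⟨(V ∪ W).image fun v => e v p, a, b, ha0, hb0, ha1, hb1, fun x hx =>
    ⟨Finset.mem_image_of_mem (fun v => e v p) (Finset.mem_union_left _ (hE x hx).1),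
     Finset.mem_image_of_mem (fun v => e v p) (Finset.mem_union_right _ (hE x hx).2)⟩, ?_⟩
  intro E' hE' J hJ
  refine sum_edges_fiberwise_le hμ hν hE' (fun v => e v p) hJ fun i j => ?_
  refine (hB.split hpP hp hB0 hμ hν hT₁ hT₂ hV hW hE h₁ h₂ hL i j).trans (le_of_eq ?_)
  rw [Real.mul_rpow (Finset.sum_nonneg fun _ _ => hμ _) (Finset.sum_nonneg fun _ _ => hν _),
    ha, hb, Real.mul_rpow hM.le hN.le]
  ring

lemma expKernel_sum_le {r R : ℝ} (hr : 0 ≤ r) (hR : 0 ≤ R) {I : Finset ℕ}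
    (hrow : ∀ i, ∑ j ∈ I, expKernel r i j ≤ R) {a b : ℕ → ℝ}
    (ha : ∀ i, 0 ≤ a i) (hb : ∀ i, 0 ≤ b i) (ha1 : ∑ i ∈ I, a i ^ 4 = 1)
    (hb1 : ∑ i ∈ I, b i ^ 4 = 1) :
    ∑ i ∈ I, ∑ j ∈ I, expKernel r i j * (a i ^ 3 * b j ^ 3) ≤ R := by
  have h6 : ∀ {a : ℕ → ℝ}, (∀ i, 0 ≤ a i) → ∑ i ∈ I, a i ^ 4 = 1 → ∑ i ∈ I, (a i ^ 3) ^ 2 ≤ 1 := by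
    intro a ha ha1
    rw [← ha1]
    refine Finset.sum_le_sum fun i hi => ?_
    have h1 : a i ≤ 1 := by
      have := Finset.single_le_sum (f := fun i => a i ^ 4) (fun i _ => by positivity) hi
      rw [ha1] at this
      exact (pow_le_one_iff_of_nonneg (ha i) (by norm_num)).1 this
    rw [← pow_mul]
    exact pow_le_pow_of_le_one (ha i) h1 (by norm_num)
  refine (schur_bound (expKernel_nonneg hr) (expKernel_comm r) hrow _ _).trans ?_
  nlinarith [h6 ha ha1, h6 hb hb1]

def smallPrimeLoss : ℝ := 1 + 4 * ((2:ℝ) ^ (-(1/4) : ℝ) / (1 - (2:ℝ) ^ (-(1/4) : ℝ)))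

lemma two_rpow_lt : (2:ℝ) ^ (-(1/4) : ℝ) < 1 := Real.rpow_lt_one_of_one_lt_of_neg (by norm_num) (by norm_num)

lemma one_le_smallPrimeLoss : 1 ≤ smallPrimeLoss := by
  have := two_rpow_lt
  have h : 0 ≤ (2:ℝ) ^ (-(1/4) : ℝ) / (1 - (2:ℝ) ^ (-(1/4) : ℝ)) :=
    div_nonneg (by positivity) (by linarith)
  unfold smallPrimeLoss; linarith

lemma expKernel_row_le_smallPrimeLoss {p : ℕ} (hp : 2 ≤ p) (I : Finset ℕ) (i : ℕ) :
    ∑ j ∈ I, expKernel ((p : ℝ) ^ (-(1/4) : ℝ)) i j ≤ smallPrimeLoss := by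
  have h2 := two_rpow_lt
  have hp2 : (2:ℝ) ≤ p := by exact_mod_cast hp
  have h : (p : ℝ) ^ (-(1/4) : ℝ) ≤ (2:ℝ) ^ (-(1/4) : ℝ) :=
    Real.rpow_le_rpow_of_nonpos (by norm_num) hp2 (by norm_num)
  refine (expKernel_row_le (by positivity) (h.trans_lt h2) I i).trans ?_
  unfold smallPrimeLoss
  gcongr

def concentrationLoss (p : ℕ) : ℝ := 2 * (2 ^ 18 / p) * Real.sqrt (2 ^ 18 / p)

lemma summable_concentrationLoss : Summable concentrationLoss := by
  have : concentrationLoss = fun p : ℕ => (2 * 2 ^ 18 * Real.sqrt (2 ^ 18)) *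
      (1 / (p : ℝ) ^ (3/2 : ℝ)) := by
    funext p
    unfold concentrationLoss
    rw [Real.sqrt_div (by positivity), Real.sqrt_eq_rpow (p:ℝ)]
    rcases Nat.eq_zero_or_pos p with rfl | hp
    · simp
    have hp : (0:ℝ) < p := by exact_mod_cast hp
    rw [show (3/2:ℝ) = 1 + 1/2 by norm_num, Real.rpow_add hp, Real.rpow_one]
    field_simp
  rw [this]
  exact (Real.summable_one_div_nat_rpow.2 (by norm_num)).mul_left _

lemma exists_concentrationLoss_threshold : ∃ p₀ : ℕ, 1025 ^ 4 ≤ p₀ ∧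
    ∀ P : Finset ℕ, (∀ p ∈ P, p₀ ≤ p) → ∑ p ∈ P, concentrationLoss p ≤ 1 / 2 := by
  obtain ⟨s, hs⟩ := summable_iff_vanishing.1 summable_concentrationLoss (Set.Iio (1/2))
    (Iio_mem_nhds (by norm_num))
  refine ⟨max (1025 ^ 4) (s.sup id + 1), le_max_left _ _, fun P hP => ?_⟩
  refine (Set.mem_Iio.1 (hs P ?_)).le
  rw [Finset.disjoint_left]
  intro p hp hps
  have h1 := hP p hp
  have h2 : p ≤ s.sup id := Finset.le_sup (f := id) hps
  have := le_max_right (1025 ^ 4) (s.sup id + 1)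
  omega

def bilinearThreshold : ℕ := exists_concentrationLoss_threshold.choose

theorem bilinearBound_insert_small {ι : Type*} [DecidableEq ι] {t : ℕ} {e : ι → ℕ → ℕ}
    {μ ν : ι → ℝ} (hμ : ∀ v, 0 ≤ μ v) (hν : ∀ v, 0 ≤ ν v) {P : Finset ℕ} {B : ℝ} {p : ℕ}
    (hpP : p ∈ P) (hp : p.Prime) (hB0 : 0 ≤ B) (hB : BilinearBound t e μ ν (P.erase p) B) :
    BilinearBound t e μ ν P (B * smallPrimeLoss) := by
  intro V W E T₁ T₂ L hT₁ hT₂ hV hW hE h₁ h₂ hL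
  have hD := one_le_smallPrimeLoss
  rcases (Finset.sum_nonneg fun v _ => hμ v : 0 ≤ ∑ v ∈ V, μ v).eq_or_lt with hM | hM
  · refine (sum_edges_le hμ hν hE).trans ?_
    rw [← hM, zero_mul]; positivity
  rcases (Finset.sum_nonneg fun v _ => hν v : 0 ≤ ∑ v ∈ W, ν v).eq_or_lt with hN | hN
  · refine (sum_edges_le hμ hν hE).trans ?_
    rw [← hN, mul_zero]; positivity
  obtain ⟨I, a, b, ha, hb, ha1, hb1, hI, h⟩ :=
    hB.exists_split hpP hp hB0 hμ hν hT₁ hT₂ hV hW hE h₁ h₂ hL hM hN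
  refine (h E subset_rfl I hI).trans ?_
  have := expKernel_sum_le (by positivity) (by linarith)
    (expKernel_row_le_smallPrimeLoss hp.two_le I) ha hb ha1 hb1
  calc _ ≤ B * (T₁ * T₂) ^ (1/4 : ℝ) * Real.exp (-(t * L / 8)) *
          ((∑ v ∈ V, μ v) * ∑ w ∈ W, ν w) ^ (3/4 : ℝ) * smallPrimeLoss := by gcongr
    _ = _ := by ring

/-- Either a large prime costs nothing in the bilinear estimate, or the edges avoiding a suitable
exponent carry little mass. -/
lemma BilinearBound.large_prime {ι : Type*} [DecidableEq ι] {t : ℕ} {e : ι → ℕ → ℕ}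
    {μ ν : ι → ℝ} {P : Finset ℕ} {B : ℝ} {p : ℕ} (hpP : p ∈ P) (hp : p.Prime)
    (hlarge : 1025 ^ 4 ≤ p) (hB0 : 0 ≤ B)
    (hB : BilinearBound t e μ ν (P.erase p) B) (hμ : ∀ v, 0 ≤ μ v)
    (hν : ∀ v, 0 ≤ ν v) {V W : Finset ι} {E : Finset (ι × ι)} {T₁ T₂ L : ℝ} (hT₁ : 0 ≤ T₁)
    (hT₂ : 0 ≤ T₂)
    (hV : ∀ v ∈ V, ∀ v' ∈ V, (∀ p ∈ P, e v p = e v' p) → v = v')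
    (hW : ∀ v ∈ W, ∀ v' ∈ W, (∀ p ∈ P, e v p = e v' p) → v = v')
    (hE : ∀ x ∈ E, x.1 ∈ V ∧ x.2 ∈ W)
    (h₁ : ∀ x ∈ E, μ x.1 * lcmProd P (e x.1) (e x.2) ≤ T₁ * totientProd P (e x.1))
    (h₂ : ∀ x ∈ E, ν x.2 * lcmProd P (e x.1) (e x.2) ≤ T₂ * totientProd P (e x.2))
    (hL : ∀ x ∈ E, L ≤ ∑ l ∈ P with t ≤ l ∧ e x.1 l ≠ e x.2 l, (1 : ℝ) / l)
    (hM : 0 < ∑ v ∈ V, μ v) (hN : 0 < ∑ w ∈ W, ν w)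
    (hbig : B * (T₁ * T₂) ^ (1/4 : ℝ) * Real.exp (-(t * L / 8)) *
          ((∑ v ∈ V, μ v) * ∑ w ∈ W, ν w) ^ (3/4 : ℝ) < ∑ x ∈ E, μ x.1 * ν x.2) :
    ∃ k : ℕ, ∑ x ∈ E with e x.1 p ≠ k ∧ e x.2 p ≠ k, μ x.1 * ν x.2 ≤
      concentrationLoss p * ∑ x ∈ E, μ x.1 * ν x.2 := by
  have hp0 : (0:ℝ) < p := by exact_mod_cast hp.pos
  obtain ⟨I, a, b, ha, hb, ha1, hb1, hI, h⟩ :=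
    hB.exists_split hpP hp hB0 hμ hν hT₁ hT₂ hV hW hE h₁ h₂ hL hM hN
  have hF : 0 ≤ B * (T₁ * T₂) ^ (1/4 : ℝ) * Real.exp (-(t * L / 8)) *
          ((∑ v ∈ V, μ v) * ∑ w ∈ W, ν w) ^ (3/4 : ℝ) := by positivity
  have hS : 1 < ∑ i ∈ I, ∑ j ∈ I, expKernel ((p : ℝ) ^ (-(1/4) : ℝ)) i j * (a i ^ 3 * b j ^ 3) := by
    by_contra hS
    push Not at hS
    exact absurd ((h E subset_rfl I hI).trans (mul_le_of_le_one_right hF hS)) (not_le.2 hbig)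
  obtain ⟨k, _, hkb⟩ := expKernel_concentration (p := p) (by exact_mod_cast hp.one_le)
    (by positivity) (by
      rw [← Real.rpow_natCast, ← Real.rpow_mul hp0.le]
      norm_num
      rw [Real.rpow_neg_one]; field_simp) (by
      have h1 : ((1025:ℝ) ^ (4:ℝ)) ≤ p := by
        have : ((1025 ^ 4 : ℕ) : ℝ) ≤ p := by exact_mod_cast hlarge
        refine le_trans (le_of_eq ?_) this
        norm_num
      calc (p:ℝ) ^ (-(1/4) : ℝ) ≤ ((1025:ℝ) ^ (4:ℝ)) ^ (-(1/4) : ℝ) :=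
            Real.rpow_le_rpow_of_nonpos (by positivity) h1 (by norm_num)
        _ = 1 / 1025 := by
          rw [← Real.rpow_mul (by norm_num)]; norm_num [Real.rpow_neg_one]) I a b ha hb ha1 hb1 hS
  refine ⟨k, (h _ (Finset.filter_subset _ _) (I.erase k) fun x hx => ?_).trans ?_⟩
  · rw [Finset.mem_filter] at hx
    exact ⟨Finset.mem_erase.2 ⟨hx.2.1, (hI x hx.1).1⟩, Finset.mem_erase.2 ⟨hx.2.2, (hI x hx.1).2⟩⟩
  · rw [mul_comm (concentrationLoss p)]
    have h0 : 0 ≤ concentrationLoss p := by unfold concentrationLoss; positivity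
    exact mul_le_mul hbig.le hkb (Finset.sum_nonneg fun i _ => Finset.sum_nonneg fun j _ => by
      have := expKernel_nonneg (r := (p : ℝ) ^ (-(1/4) : ℝ)) (by positivity) i j
      have := ha i; have := hb j; positivity) (hF.trans hbig.le)

lemma sum_biUnion_le_sum {α β : Type*} [DecidableEq β] {f : β → ℝ} (hf : ∀ x, 0 ≤ f x)
    (P : Finset α) (g : α → Finset β) : ∑ x ∈ P.biUnion g, f x ≤ ∑ p ∈ P, ∑ x ∈ g p, f x := by
  classical
  induction P using Finset.induction_on with
  | empty => simp
  | insert p P hp ih =>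
    rw [Finset.biUnion_insert, Finset.sum_insert hp]
    have := Finset.sum_union_inter (s₁ := g p) (s₂ := P.biUnion g) (f := f)
    have h0 : 0 ≤ ∑ x ∈ g p ∩ P.biUnion g, f x := Finset.sum_nonneg fun x _ => hf x
    linarith

def bilinearConst (P : Finset ℕ) : ℝ :=
  8 * Real.exp 4 * smallPrimeLoss ^ (P.filter (· < bilinearThreshold)).card

lemma leaf_const_pow {T s : ℝ} (hT : 0 ≤ T) :
    16 * T * Real.exp (16 - s) = (2 * Real.exp 4 * T ^ (1/4:ℝ) * Real.exp (-(s / 4))) ^ 4 := by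
  have h1 : (T ^ (1/4:ℝ)) ^ 4 = T := by
    rw [← Real.rpow_natCast, ← Real.rpow_mul hT]; norm_num
  have h2 : Real.exp (16 - s) = Real.exp 4 ^ 4 * Real.exp (-(s / 4)) ^ 4 := by
    rw [← Real.exp_nat_mul, ← Real.exp_nat_mul, ← Real.exp_add]; congr 1; push_cast; ring
  rw [mul_pow, mul_pow, mul_pow, h1, h2]; ring

theorem bilinearBound {ι : Type*} [DecidableEq ι] {t : ℕ} (ht : 1 ≤ t) (e : ι → ℕ → ℕ)
    {μ ν : ι → ℝ} (hμ : ∀ v, 0 ≤ μ v) (hν : ∀ v, 0 ≤ ν v) (P : Finset ℕ)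
    (hP : ∀ p ∈ P, p.Prime) : BilinearBound t e μ ν P (bilinearConst P) := by
  induction P using Finset.strongInduction with
  | H P ih =>
  have hD := one_le_smallPrimeLoss
  have hc0 : ∀ P, 0 ≤ bilinearConst P := fun P => by unfold bilinearConst; positivity
  have ih' : ∀ p ∈ P, BilinearBound t e μ ν (P.erase p) (bilinearConst (P.erase p)) := fun p hp =>
    ih _ (Finset.erase_ssubset hp) fun q hq => hP q (Finset.mem_of_mem_erase hq)
  by_cases hsmall : ∃ p ∈ P, p < bilinearThreshold
  · obtain ⟨p, hp, hpt⟩ := hsmall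
    have hcard : ((P.erase p).filter (· < bilinearThreshold)).card + 1 =
        (P.filter (· < bilinearThreshold)).card := by
      rw [Finset.filter_erase, Finset.card_erase_add_one]
      exact Finset.mem_filter.2 ⟨hp, hpt⟩
    have h := bilinearBound_insert_small hμ hν hp (hP p hp) (hc0 _) (ih' p hp)
    have hc : bilinearConst P = bilinearConst (P.erase p) * smallPrimeLoss := by
      unfold bilinearConst; rw [← hcard, pow_succ]; ring
    rwa [hc]
  push Not at hsmall
  have hceq : ∀ p ∈ P, bilinearConst (P.erase p) = bilinearConst P := by
    intro p _
    unfold bilinearConst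
    rw [Finset.filter_false_of_mem fun q hq => not_lt.2 (hsmall q hq),
      Finset.filter_false_of_mem fun q hq => not_lt.2 (hsmall q (Finset.mem_of_mem_erase hq))]
  intro V W E T₁ T₂ L hT₁ hT₂ hV hW hE h₁ h₂ hL
  by_contra hcon
  push Not at hcon
  rcases (Finset.sum_nonneg fun v _ => hμ v : 0 ≤ ∑ v ∈ V, μ v).eq_or_lt with hM | hM
  · refine absurd (sum_edges_le hμ hν hE) (not_le.2 (lt_of_le_of_lt ?_ hcon))
    have := hc0 P
    rw [← hM, zero_mul]; positivity
  rcases (Finset.sum_nonneg fun v _ => hν v : 0 ≤ ∑ v ∈ W, ν v).eq_or_lt with hN | hN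
  · refine absurd (sum_edges_le hμ hν hE) (not_le.2 (lt_of_le_of_lt ?_ hcon))
    have := hc0 P
    rw [← hN, mul_zero]; positivity
  obtain ⟨hthr, hloss⟩ := exists_concentrationLoss_threshold.choose_spec
  have hkex : ∀ p ∈ P, ∃ k : ℕ, ∑ x ∈ E with e x.1 p ≠ k ∧ e x.2 p ≠ k, μ x.1 * ν x.2 ≤
      concentrationLoss p * ∑ x ∈ E, μ x.1 * ν x.2 := fun p hp =>
    (ih' p hp).large_prime hp (hP p hp) (hthr.trans (hsmall p hp)) (hc0 _) hμ hν hT₁ hT₂ hV hW hE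
      h₁ h₂ hL hM hN (by rwa [hceq p hp])
  choose! k hk using hkex
  set Φ := ∑ x ∈ E, μ x.1 * ν x.2 with hΦ
  have hw : ∀ x : ι × ι, 0 ≤ μ x.1 * ν x.2 := fun x => mul_nonneg (hμ _) (hν _)
  have hΦ0 : 0 ≤ Φ := Finset.sum_nonneg fun x _ => hw x
  have hbad : ∑ x ∈ E with ¬ ∀ p ∈ P, e x.1 p = k p ∨ e x.2 p = k p, μ x.1 * ν x.2 ≤ Φ / 2 := by
    calc _ ≤ ∑ x ∈ P.biUnion fun p => E.filter fun x => e x.1 p ≠ k p ∧ e x.2 p ≠ k p,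
            μ x.1 * ν x.2 := by
          refine Finset.sum_le_sum_of_subset_of_nonneg (fun x hx => ?_) fun x _ _ => hw x
          rw [Finset.mem_filter] at hx
          obtain ⟨hxE, hx⟩ := hx
          push Not at hx
          obtain ⟨p, hp, hx⟩ := hx
          exact Finset.mem_biUnion.2 ⟨p, hp, Finset.mem_filter.2 ⟨hxE, hx⟩⟩
      _ ≤ ∑ p ∈ P, ∑ x ∈ E with e x.1 p ≠ k p ∧ e x.2 p ≠ k p, μ x.1 * ν x.2 := by
          exact sum_biUnion_le_sum hw _ _
      _ ≤ ∑ p ∈ P, concentrationLoss p * Φ := Finset.sum_le_sum hk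
      _ ≤ 1 / 2 * Φ := by
          rw [← Finset.sum_mul]
          have := hloss P hsmall
          gcongr
      _ = _ := by ring
  set K := 2 * Real.exp 4 * (T₁ * T₂) ^ (1/4 : ℝ) * Real.exp (-(t * (L / 2) / 4)) with hKdef
  have hK0 : 0 ≤ K := by positivity
  have hK4 : 16 * (T₁ * T₂) * Real.exp (16 - t * (L / 2)) ≤ K ^ 4 :=
    (leaf_const_pow (mul_nonneg hT₁ hT₂)).le
  set Eg := E.filter fun x => ∀ p ∈ P, e x.1 p = k p ∨ e x.2 p = k p with hEg
  have hEgE : Eg ⊆ E := Finset.filter_subset _ _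
  have hsplit : Φ = ∑ x ∈ Eg, μ x.1 * ν x.2 +
      ∑ x ∈ E with ¬ ∀ p ∈ P, e x.1 p = k p ∨ e x.2 p = k p, μ x.1 * ν x.2 :=
    (Finset.sum_filter_add_sum_filter_not _ _ _).symm
  have hsplit2 : ∑ x ∈ Eg, μ x.1 * ν x.2 =
      ∑ x ∈ Eg with L / 2 ≤ ∑ l ∈ P with t ≤ l ∧ e x.1 l ≠ k l, (1 : ℝ) / l, μ x.1 * ν x.2 +
      ∑ x ∈ Eg with ¬ L / 2 ≤ ∑ l ∈ P with t ≤ l ∧ e x.1 l ≠ k l, (1 : ℝ) / l, μ x.1 * ν x.2 :=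
    (Finset.sum_filter_add_sum_filter_not _ _ _).symm
  have hl₁ := sum_edges_le_of_common_exponents hP k e hμ hν ht hT₁ hT₂ hK0 hK4 V W
    (Eg.filter fun x => L / 2 ≤ ∑ l ∈ P with t ≤ l ∧ e x.1 l ≠ k l, (1 : ℝ) / l) hV hW
    (fun x hx => hE x (hEgE (Finset.mem_filter.1 hx).1))
    (fun x hx => h₁ x (hEgE (Finset.mem_filter.1 hx).1))
    (fun x hx => h₂ x (hEgE (Finset.mem_filter.1 hx).1))
    (fun x hx => (Finset.mem_filter.1 (Finset.mem_filter.1 hx).1).2)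
    (fun x hx => (Finset.mem_filter.1 hx).2)
  have hl₂ := sum_edges_le_of_common_exponents_right hP k e hμ hν ht hT₁ hT₂ hK0 hK4 V W
    (Eg.filter fun x => ¬ L / 2 ≤ ∑ l ∈ P with t ≤ l ∧ e x.1 l ≠ k l, (1 : ℝ) / l) hV hW
    (fun x hx => hE x (hEgE (Finset.mem_filter.1 hx).1))
    (fun x hx => h₁ x (hEgE (Finset.mem_filter.1 hx).1))
    (fun x hx => h₂ x (hEgE (Finset.mem_filter.1 hx).1))
    (fun x hx => (Finset.mem_filter.1 (Finset.mem_filter.1 hx).1).2)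
    (fun x hx => by
      rw [Finset.mem_filter] at hx
      have h1 := hL x (hEgE hx.1)
      have h2 := not_le.1 hx.2
      have h3 : ∑ l ∈ P with t ≤ l ∧ e x.1 l ≠ e x.2 l, (1 : ℝ) / l ≤
          ∑ l ∈ P with t ≤ l ∧ e x.1 l ≠ k l, (1 : ℝ) / l +
          ∑ l ∈ P with t ≤ l ∧ e x.2 l ≠ k l, (1 : ℝ) / l := by
        rw [Finset.sum_filter, Finset.sum_filter, Finset.sum_filter, ← Finset.sum_add_distrib]
        refine Finset.sum_le_sum fun l _ => ?_
        have : (0:ℝ) ≤ 1 / l := by positivity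
        by_cases hc1 : e x.1 l = k l <;> by_cases hc2 : e x.2 l = k l <;> by_cases hc3 : t ≤ l <;>
          simp [hc1, hc2, hc3] <;> split_ifs <;> simp
      linarith)
  have hfin : Φ ≤ 4 * K * ((∑ v ∈ V, μ v) * ∑ w ∈ W, ν w) ^ (3/4 : ℝ) := by linarith
  refine absurd hfin (not_le.2 (lt_of_le_of_lt (le_of_eq ?_) hcon))
  have : bilinearConst P = 8 * Real.exp 4 := by
    unfold bilinearConst
    rw [Finset.filter_false_of_mem fun q hq => not_lt.2 (hsmall q hq)]; simp
  rw [this, hKdef, show (t:ℝ) * (L / 2) / 4 = t * L / 8 by ring]; ring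

lemma sum_range_mul_of_periodic {F : ℕ → ℝ} {Q : ℕ} (hF : Function.Periodic F Q) (d : ℕ) :
    ∑ x ∈ Finset.range (d * Q), F x = d * ∑ x ∈ Finset.range Q, F x := by
  induction d with
  | zero => simp
  | succ d ih =>
    rw [Nat.succ_mul, Finset.sum_range_add, ih, Finset.sum_congr rfl fun x _ => show F (d * Q + x) = F x by
      rw [add_comm]; exact hF.nat_mul d x]
    push_cast; ring

lemma sum_range_mul_of_coprime {F G : ℕ → ℝ} {Q l : ℕ} (hQ : 0 < Q) (hl : 0 < l)
    (hF : Function.Periodic F Q) (hG : Function.Periodic G l) (h : Nat.Coprime Q l) :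
    ∑ x ∈ Finset.range (Q * l), F x * G x =
      (∑ x ∈ Finset.range Q, F x) * ∑ x ∈ Finset.range l, G x := by
  rw [Finset.sum_mul_sum, ← Finset.sum_product']
  refine Finset.sum_nbij (fun x => (x % Q, x % l)) (fun x _ => ?_) (fun x hx y hy hxy => ?_)
    (fun y hy => ?_) fun x _ => ?_
  · simp [Nat.mod_lt _ hQ, Nat.mod_lt _ hl]
  · simp only [Finset.coe_range, Set.mem_Iio, Prod.mk.injEq] at hx hy hxy
    have := (Nat.modEq_and_modEq_iff_modEq_mul h).1 hxy
    exact Nat.ModEq.eq_of_lt_of_lt this hx hy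
  · obtain ⟨y, z⟩ := y
    simp only [Finset.coe_product, Finset.coe_range, Set.mem_prod, Set.mem_Iio] at hy
    have hc := (Nat.chineseRemainder h y z).2
    refine ⟨Nat.chineseRemainder h y z, ?_, ?_⟩
    · simpa using Nat.chineseRemainder_lt_mul h y z hQ.ne' hl.ne'
    · exact Prod.ext (Eq.trans hc.1 (Nat.mod_eq_of_lt hy.1)) (Eq.trans hc.2 (Nat.mod_eq_of_lt hy.2))
  · simp only
    rw [hF.map_mod_nat, hG.map_mod_nat]

lemma periodic_prod {f : ℕ → ℕ → ℝ} {S : Finset ℕ} (hf : ∀ l ∈ S, Function.Periodic (f l) l) :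
    Function.Periodic (fun x => ∏ l ∈ S, f l x) (∏ l ∈ S, l) := by
  intro x
  refine Finset.prod_congr rfl fun l hl => ?_
  obtain ⟨d, hd⟩ := Finset.dvd_prod_of_mem (fun l => l) hl
  rw [hd, mul_comm]
  exact (hf l hl).nat_mul d x

lemma sum_range_prod_periodic {f : ℕ → ℕ → ℝ} {S : Finset ℕ} (hS : ∀ l ∈ S, l.Prime)
    (hf : ∀ l ∈ S, Function.Periodic (f l) l) {M : ℕ} (hM : (∏ l ∈ S, l) ∣ M) :
    ∑ x ∈ Finset.range M, ∏ l ∈ S, f l x =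
      M * ∏ l ∈ S, ((∑ y ∈ Finset.range l, f l y) / l) := by
  have key : ∀ S : Finset ℕ, (∀ l ∈ S, l.Prime) → (∀ l ∈ S, Function.Periodic (f l) l) →
      ∑ x ∈ Finset.range (∏ l ∈ S, l), ∏ l ∈ S, f l x = ∏ l ∈ S, ∑ y ∈ Finset.range l, f l y := by
    intro S
    induction S using Finset.induction_on with
    | empty => simp
    | insert l S hl ih =>
      intro hS hf
      rw [Finset.forall_mem_insert] at hS hf
      simp only [Finset.prod_insert hl]
      rw [sum_range_mul_of_coprime hS.1.pos (Finset.prod_pos fun q hq => (hS.2 q hq).pos) hf.1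
        (periodic_prod hf.2), ih hS.2 hf.2]
      exact Nat.Coprime.prod_right fun q hq =>
        (Nat.coprime_primes hS.1 (hS.2 q hq)).2 fun h => hl (h ▸ hq)
  obtain ⟨d, rfl⟩ := hM
  have h0 : (∏ l ∈ S, (l:ℝ)) ≠ 0 := Finset.prod_ne_zero_iff.2 fun l hl => by
    exact_mod_cast (hS l hl).ne_zero
  rw [mul_comm, sum_range_mul_of_periodic (periodic_prod hf), key S hS hf, Finset.prod_div_distrib]
  push_cast
  field_simp

/-- Local density of `j` with `r + j m'` and `b + j n'` both prime to `l`. -/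
lemma card_range_not_dvd_le {l m' : ℕ} (hl : l.Prime) (hm : ¬ l ∣ m') (r : ℤ) (q : ℕ → Prop)
    [DecidablePred q] (hq : ∀ y, q y → ¬ (l : ℤ) ∣ r + y * m') :
    ((Finset.range l).filter q).card ≤ l - 1 ∧
      ∃ y ∈ Finset.range l, (l : ℤ) ∣ r + y * m' := by
  have : Fact l.Prime := ⟨hl⟩
  have hex : ∃ y ∈ Finset.range l, (l : ℤ) ∣ r + y * m' := by
    have hm' : (m' : ZMod l) ≠ 0 := by rwa [Ne, ZMod.natCast_eq_zero_iff]
    refine ⟨(-(r : ZMod l) / m').val, Finset.mem_range.2 (ZMod.val_lt _), ?_⟩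
    rw [← ZMod.intCast_zmod_eq_zero_iff_dvd]
    push_cast
    rw [ZMod.natCast_zmod_val]
    field_simp
    ring
  refine ⟨?_, hex⟩
  obtain ⟨y, hy, hdvd⟩ := hex
  rw [← Finset.card_range l, ← Finset.card_erase_of_mem hy, Finset.card_range]
  refine Finset.card_le_card fun x hx => ?_
  rw [Finset.mem_filter] at hx
  exact Finset.mem_erase.2 ⟨fun h => hq x hx.2 (h ▸ hdvd), hx.1⟩

lemma card_range_not_dvd_two_le {l m' n' : ℕ} (hl : l.Prime) (hm : ¬ l ∣ m') (hn : ¬ l ∣ n')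
    (r b : ℤ) (hne : ¬ (l : ℤ) ∣ r * n' - b * m') (q : ℕ → Prop)
    [DecidablePred q] (hq : ∀ y, q y → ¬ (l : ℤ) ∣ r + y * m' ∧ ¬ (l : ℤ) ∣ b + y * n') :
    ((Finset.range l).filter q).card ≤ l - 2 := by
  obtain ⟨_, y, hy, hyd⟩ := card_range_not_dvd_le hl hm r q fun y h => (hq y h).1
  obtain ⟨_, z, hz, hzd⟩ := card_range_not_dvd_le hl hn b q fun y h => (hq y h).2
  have hyz : y ≠ z := by
    rintro rfl
    refine hne ?_
    have := dvd_sub (dvd_mul_of_dvd_left hyd (n' : ℤ)) (dvd_mul_of_dvd_left hzd (m' : ℤ))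
    rwa [show (r + y * m') * n' - (b + y * n') * m' = r * n' - b * (m' : ℤ) by ring] at this
  have hcard : (((Finset.range l).erase y).erase z).card = l - 2 := by
    rw [Finset.card_erase_of_mem (Finset.mem_erase.2 ⟨hyz.symm, hz⟩), Finset.card_erase_of_mem hy,
      Finset.card_range]; omega
  rw [← hcard]
  refine Finset.card_le_card fun x hx => ?_
  rw [Finset.mem_filter] at hx
  exact Finset.mem_erase.2 ⟨fun h => (hq x hx.2).2 (h ▸ hzd),
    Finset.mem_erase.2 ⟨fun h => (hq x hx.2).1 (h ▸ hyd), hx.1⟩⟩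

/-- Pairs of reduced residues `a < g m'`, `b < g n'` with `a n' - b m' = e`. -/
def fixedDiff (g m' n' : ℕ) (e : ℤ) : Finset (ℕ × ℕ) :=
  (Finset.range (g * m') ×ˢ Finset.range (g * n')).filter fun x =>
    Nat.Coprime x.1 (g * m') ∧ Nat.Coprime x.2 (g * n') ∧ (x.1 : ℤ) * n' - x.2 * m' = e

/-- Local factor at `l` in the bound for the number of pairs with a given difference. -/
def diffWeight (g D l c : ℕ) : ℝ :=
  (if l ∣ g then (if l ∣ D ∨ l ∣ c then 1 - 1 / (l : ℝ) else 1 - 2 / (l : ℝ)) else 1) *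
    (if l ∣ D ∧ l ∣ c then 0 else 1)

lemma diffWeight_nonneg {l : ℕ} (hl : 2 ≤ l) (g D c : ℕ) : 0 ≤ diffWeight g D l c := by
  have h2 : (2:ℝ) ≤ l := by exact_mod_cast hl
  have h1 : 0 ≤ 1 - 1 / (l:ℝ) := by
    rw [sub_nonneg, div_le_one (by linarith)]; linarith
  have h3 : 0 ≤ 1 - 2 / (l:ℝ) := by
    rw [sub_nonneg, div_le_one (by linarith)]; linarith
  unfold diffWeight
  refine mul_nonneg ?_ ?_ <;> split_ifs <;> first | assumption | norm_num

lemma not_dvd_of_mem_fixedDiff {g m' n' : ℕ} (hmn : Nat.Coprime m' n') {e : ℤ} {x : ℕ × ℕ}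
    (hx : x ∈ fixedDiff g m' n' e) {l : ℕ} (hl : l.Prime) (hD : l ∣ m' * n') : ¬ (l : ℤ) ∣ e := by
  obtain ⟨_, hx1, hx2, rfl⟩ := Finset.mem_filter.1 hx
  have hlZ : Prime (l : ℤ) := Nat.prime_iff_prime_int.1 hl
  intro h
  rcases (hl.dvd_mul).1 hD with hm | hn
  · have h1 : (l : ℤ) ∣ x.1 * n' := by
      have h2 : (l : ℤ) ∣ x.2 * m' := dvd_mul_of_dvd_right (Int.natCast_dvd_natCast.2 hm) _
      have := dvd_add h h2; simpa using this
    rcases hlZ.dvd_mul.1 h1 with h2 | h2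
    · exact Nat.not_coprime_of_dvd_of_dvd hl.one_lt (Int.natCast_dvd_natCast.1 h2)
        (dvd_mul_of_dvd_right hm g) hx1
    · exact Nat.not_coprime_of_dvd_of_dvd hl.one_lt hm (Int.natCast_dvd_natCast.1 h2) hmn
  · have h1 : (l : ℤ) ∣ x.2 * m' := by
      have h2 : (l : ℤ) ∣ x.1 * n' := dvd_mul_of_dvd_right (Int.natCast_dvd_natCast.2 hn) _
      have := dvd_sub h2 h; simpa using this
    rcases hlZ.dvd_mul.1 h1 with h2 | h2
    · exact Nat.not_coprime_of_dvd_of_dvd hl.one_lt (Int.natCast_dvd_natCast.1 h2)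
        (dvd_mul_of_dvd_right hn g) hx2
    · exact Nat.not_coprime_of_dvd_of_dvd hl.one_lt (Int.natCast_dvd_natCast.1 h2) hn hmn

lemma card_fixedDiff_le_sieve {g m' n' : ℕ} (hm : 0 < m') (hmn : Nat.Coprime m' n')
    {e : ℤ} (hne : (fixedDiff g m' n' e).Nonempty) : ∃ r B : ℤ, r * n' - B * m' = e ∧
    (fixedDiff g m' n' e).card ≤ ((Finset.range g).filter fun j : ℕ => ∀ l ∈ g.primeFactors,
      ¬ (l : ℤ) ∣ r + j * m' ∧ ¬ (l : ℤ) ∣ B + j * n').card := by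
  obtain ⟨⟨a₀, b₀⟩, h₀⟩ := hne
  obtain ⟨_, _, _, he₀⟩ := Finset.mem_filter.1 h₀
  simp only at he₀
  have hmZ : (m' : ℤ) ≠ 0 := by exact_mod_cast hm.ne'
  set r : ℤ := (a₀ : ℤ) - (a₀ / m' : ℕ) * m' with hr
  set B : ℤ := (b₀ : ℤ) - (a₀ / m' : ℕ) * n' with hB
  have key : ∀ x ∈ fixedDiff g m' n' e, (x.1 : ℤ) = r + (x.1 / m' : ℕ) * m' ∧
      (x.2 : ℤ) = B + (x.1 / m' : ℕ) * n' := by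
    intro x hx
    obtain ⟨_, _, _, he⟩ := Finset.mem_filter.1 hx
    have hdvd : (m' : ℤ) ∣ (x.1 - a₀) := by
      have : (m' : ℤ) ∣ (x.1 - a₀) * n' := ⟨x.2 - b₀, by linear_combination he - he₀⟩
      exact (Int.isCoprime_iff_gcd_eq_one.2 (by simpa using hmn)).dvd_of_dvd_mul_right this
    have hmod : x.1 % m' = a₀ % m' := by
      have : (a₀ : ℤ) ≡ x.1 [ZMOD m'] := Int.modEq_iff_dvd.2 hdvd
      exact ((Int.natCast_modEq_iff).1 this).symm
    have hx1 := Nat.div_add_mod x.1 m'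
    have ha1 := Nat.div_add_mod a₀ m'
    have h1 : (x.1 : ℤ) = r + (x.1 / m' : ℕ) * m' := by
      have e1 : (m' : ℤ) * (x.1 / m' : ℕ) + (x.1 % m' : ℕ) = x.1 := by exact_mod_cast hx1
      have e2 : (m' : ℤ) * (a₀ / m' : ℕ) + (x.1 % m' : ℕ) = a₀ := by
        rw [hmod]; exact_mod_cast ha1
      rw [hr]; linear_combination e2 - e1
    refine ⟨h1, mul_right_cancel₀ hmZ ?_⟩
    rw [hB]
    rw [hr] at h1
    linear_combination he₀ - he + n' * h1
  refine ⟨r, B, by rw [hr, hB]; linear_combination he₀, ?_⟩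
  refine Finset.card_le_card_of_injOn (fun x => x.1 / m') (fun x hx => ?_) fun x hx y hy hxy => ?_
  · obtain ⟨hk1, hk2⟩ := key x hx
    obtain ⟨hmem, hx1, hx2, he⟩ := Finset.mem_filter.1 hx
    have hr1 := Finset.mem_range.1 (Finset.mem_product.1 hmem).1
    rw [Finset.mem_coe, Finset.mem_filter, Finset.mem_range]
    refine ⟨(Nat.div_lt_iff_lt_mul hm).2 hr1, fun l hl => ?_⟩
    obtain ⟨hlp, hlg, _⟩ := Nat.mem_primeFactors.1 hl
    rw [← hk1, ← hk2, Int.natCast_dvd_natCast, Int.natCast_dvd_natCast]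
    exact ⟨fun h => Nat.not_coprime_of_dvd_of_dvd hlp.one_lt h (dvd_mul_of_dvd_left hlg _) hx1,
      fun h => Nat.not_coprime_of_dvd_of_dvd hlp.one_lt h (dvd_mul_of_dvd_left hlg _) hx2⟩
  · obtain ⟨h1, h2⟩ := key x hx
    obtain ⟨h3, h4⟩ := key y hy
    simp only at hxy
    rw [hxy] at h1 h2
    exact Prod.ext (by exact_mod_cast h1.trans h3.symm) (by exact_mod_cast h2.trans h4.symm)

lemma card_fixedDiff_le {g m' n' c q : ℕ} (hg : 0 < g) (hm : 0 < m') (hn : 0 < n')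
    (hmn : Nat.Coprime m' n') {e : ℤ} (he : e.natAbs = c * q)
    (hq : ∀ l, l.Prime → l ∣ g * (m' * n') → ¬ l ∣ q) :
    ((fixedDiff g m' n' e).card : ℝ) ≤
      g * ∏ l ∈ (g * (m' * n')).primeFactors, diffWeight g (m' * n') l c := by
  have hdvd : ∀ l ∈ (g * (m' * n')).primeFactors, ((l : ℤ) ∣ e ↔ l ∣ c) := by
    intro l hl
    obtain ⟨hlp, hld, _⟩ := Nat.mem_primeFactors.1 hl
    rw [← Int.natAbs_dvd_natAbs, he, Int.natAbs_natCast, hlp.dvd_mul]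
    exact or_iff_left (hq l hlp hld)
  have hw0 : ∀ l ∈ (g * (m' * n')).primeFactors, 0 ≤ diffWeight g (m' * n') l c := fun l hl =>
    diffWeight_nonneg (Nat.prime_of_mem_primeFactors hl).two_le _ _ _
  rcases (fixedDiff g m' n' e).eq_empty_or_nonempty with hemp | hne
  · rw [hemp]; simp only [Finset.card_empty, Nat.cast_zero]
    exact mul_nonneg (by positivity) (Finset.prod_nonneg hw0)
  obtain ⟨r, B, hrB, hcard⟩ := card_fixedDiff_le_sieve (g := g) hm hmn hne
  have hsub : g.primeFactors ⊆ (g * (m' * n')).primeFactors :=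
    Nat.primeFactors_mono (dvd_mul_right _ _) (by positivity)
  have hprod : ∏ l ∈ (g * (m' * n')).primeFactors, diffWeight g (m' * n') l c =
      ∏ l ∈ g.primeFactors,
        (if l ∣ m' * n' ∨ l ∣ c then 1 - 1 / (l : ℝ) else 1 - 2 / (l : ℝ)) := by
    rw [← Finset.prod_subset hsub]
    · refine Finset.prod_congr rfl fun l hl => ?_
      have hlg := Nat.dvd_of_mem_primeFactors hl
      have hlp := Nat.prime_of_mem_primeFactors hl
      have : ¬ (l ∣ m' * n' ∧ l ∣ c) := fun h =>
        not_dvd_of_mem_fixedDiff hmn hne.choose_spec hlp h.1 ((hdvd l (hsub hl)).2 h.2)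
      rw [diffWeight, if_pos hlg, if_neg this, mul_one]
    · intro l hl hlg
      have hlp := Nat.prime_of_mem_primeFactors hl
      have hlg : ¬ l ∣ g := fun h => hlg (Nat.mem_primeFactors.2 ⟨hlp, h, hg.ne'⟩)
      have : ¬ (l ∣ m' * n' ∧ l ∣ c) := fun h =>
        not_dvd_of_mem_fixedDiff hmn hne.choose_spec hlp h.1 ((hdvd l hl).2 h.2)
      rw [diffWeight, if_neg hlg, if_neg this, mul_one]
  rw [hprod]
  let f : ℕ → ℕ → ℝ := fun l j => if ¬ (l : ℤ) ∣ r + j * m' ∧ ¬ (l : ℤ) ∣ B + j * n' then 1 else 0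
  have hper : ∀ l ∈ g.primeFactors, Function.Periodic (f l) l := by
    intro l _ j
    simp only [f]
    have h1 : (l : ℤ) ∣ r + (j + l : ℕ) * m' ↔ (l : ℤ) ∣ r + j * m' := by
      rw [show r + (j + l : ℕ) * (m' : ℤ) = r + j * m' + l * m' by push_cast; ring]
      exact dvd_add_left (dvd_mul_right _ _)
    have h2 : (l : ℤ) ∣ B + (j + l : ℕ) * n' ↔ (l : ℤ) ∣ B + j * n' := by
      rw [show B + (j + l : ℕ) * (n' : ℤ) = B + j * n' + l * n' by push_cast; ring]
      exact dvd_add_left (dvd_mul_right _ _)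
    simp only [h1, h2]
  calc ((fixedDiff g m' n' e).card : ℝ) ≤ (((Finset.range g).filter fun j : ℕ =>
          ∀ l ∈ g.primeFactors, ¬ (l : ℤ) ∣ r + j * m' ∧ ¬ (l : ℤ) ∣ B + j * n').card : ℝ) := by
        exact_mod_cast hcard
    _ = ∑ j ∈ Finset.range g, ∏ l ∈ g.primeFactors, f l j := by
        rw [Finset.card_filter, Nat.cast_sum]
        refine Finset.sum_congr rfl fun j _ => ?_
        simp only [f]
        rw [Finset.prod_ite_zero, Finset.prod_const_one]
        split_ifs <;> simp
    _ = g * ∏ l ∈ g.primeFactors, ((∑ y ∈ Finset.range l, f l y) / l) :=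
        sum_range_prod_periodic (fun l hl => Nat.prime_of_mem_primeFactors hl) hper
          (Nat.prod_primeFactors_dvd g)
    _ ≤ _ := by
        refine mul_le_mul_of_nonneg_left (Finset.prod_le_prod (fun l _ => ?_) fun l hl => ?_)
          (by positivity)
        · exact div_nonneg (Finset.sum_nonneg fun y _ => by
            simp only [f]; split_ifs <;> simp) (by positivity)
        · have hlp := Nat.prime_of_mem_primeFactors hl
          have hl0 : (0:ℝ) < l := by exact_mod_cast hlp.pos
          have hcd : ∑ y ∈ Finset.range l, f l y = ((Finset.range l).filter fun y : ℕ =>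
              ¬ (l : ℤ) ∣ r + y * m' ∧ ¬ (l : ℤ) ∣ B + y * n').card := by
            simp only [f]; rw [Finset.card_filter, Nat.cast_sum]
            exact Finset.sum_congr rfl fun y _ => by split_ifs <;> simp
          have hndvd : l ∣ m' → ¬ l ∣ n' := fun h h' =>
            Nat.not_coprime_of_dvd_of_dvd hlp.one_lt h h' hmn
          rw [hcd, div_le_iff₀ hl0]
          split_ifs with hc
          · have h1 : ((Finset.range l).filter fun y : ℕ =>
              ¬ (l : ℤ) ∣ r + y * m' ∧ ¬ (l : ℤ) ∣ B + y * n').card ≤ l - 1 := by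
              by_cases hlm : l ∣ m'
              · exact (card_range_not_dvd_le hlp (hndvd hlm) B _ fun y h => h.2).1
              · exact (card_range_not_dvd_le hlp hlm r _ fun y h => h.1).1
            have h2 : (((Finset.range l).filter fun y : ℕ =>
              ¬ (l : ℤ) ∣ r + y * m' ∧ ¬ (l : ℤ) ∣ B + y * n').card : ℝ) ≤ (l - 1 : ℕ) := by
              exact_mod_cast h1
            rw [Nat.cast_sub hlp.one_le] at h2
            refine h2.trans (le_of_eq ?_)
            field_simp; simp
          · push Not at hc
            have hlm : ¬ l ∣ m' := fun h => hc.1 (dvd_mul_of_dvd_left h _)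
            have hln : ¬ l ∣ n' := fun h => hc.1 (dvd_mul_of_dvd_right h _)
            have h1 := card_range_not_dvd_two_le hlp hlm hln r B
              (by rw [hrB, hdvd l (hsub hl)]; exact hc.2) (fun y : ℕ =>
              ¬ (l : ℤ) ∣ r + y * m' ∧ ¬ (l : ℤ) ∣ B + y * n') (fun y h => h)
            have h2 : (((Finset.range l).filter fun y : ℕ =>
              ¬ (l : ℤ) ∣ r + y * m' ∧ ¬ (l : ℤ) ∣ B + y * n').card : ℝ) ≤ (l - 2 : ℕ) := by
              exact_mod_cast h1
            rw [Nat.cast_sub hlp.two_le] at h2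
            refine h2.trans (le_of_eq ?_)
            field_simp; simp

lemma inv_one_sub_le_exp {l : ℕ} (hl : 2 ≤ l) : (1 - 1 / (l : ℝ))⁻¹ ≤ Real.exp (2 / l) := by
  have h2 : (2:ℝ) ≤ l := by exact_mod_cast hl
  have h0 : 0 < 1 - 1 / (l:ℝ) := by
    rw [sub_pos, div_lt_one (by linarith)]; linarith
  refine le_trans ?_ (Real.add_one_le_exp _)
  rw [inv_le_iff_one_le_mul₀ h0]
  have h3 : 1 / (l:ℝ) ≤ 1 / 2 := by gcongr
  have h4 : 0 ≤ 1 / (l:ℝ) := by positivity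
  rw [show 2 / (l:ℝ) = 2 * (1 / l) by ring]
  nlinarith

lemma one_le_inv_one_sub {l : ℕ} (hl : 2 ≤ l) : 1 ≤ (1 - 1 / (l : ℝ))⁻¹ := by
  have h2 : (2:ℝ) ≤ l := by exact_mod_cast hl
  have h0 : 0 < 1 - 1 / (l:ℝ) := by
    rw [sub_pos, div_lt_one (by linarith)]; linarith
  have h4 : 0 ≤ 1 / (l:ℝ) := by positivity
  exact (one_le_inv₀ h0).2 (by linarith)

lemma prod_large_dvd_le {S : Finset ℕ} (hS : ∀ l ∈ S, l.Prime) {z c : ℕ}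
    (hz : ∀ l ∈ S, z < l) (hc0 : c ≠ 0) (hc : c < 4 ^ (z + 1)) :
    ∏ l ∈ S, (if l ∣ c then (1 - 1 / (l : ℝ))⁻¹ else 1) ≤ Real.exp 4 := by
  rw [← Finset.prod_filter]
  set U := S.filter fun l => l ∣ c
  have hU : ∀ l ∈ U, l ∈ S ∧ l ∣ c := fun l hl => Finset.mem_filter.1 hl
  have hcard : U.card ≤ 2 * (z + 1) := by
    have h1 : 2 ^ U.card ≤ ∏ l ∈ U, l :=
      Finset.pow_card_le_prod _ _ _ fun l hl => (hS l (hU l hl).1).two_le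
    have h2 : ∏ l ∈ U, l ≤ c := Nat.le_of_dvd (Nat.pos_of_ne_zero hc0)
      (Finset.prod_primes_dvd c (fun l hl => (hS l (hU l hl).1).prime) fun l hl => (hU l hl).2)
    have h3 : 2 ^ U.card < 2 ^ (2 * (z + 1)) := by
      rw [pow_mul]; exact lt_of_le_of_lt (h1.trans h2) hc
    exact ((Nat.pow_lt_pow_iff_right (by norm_num)).1 h3).le
  have hz0 : (0:ℝ) < z + 1 := by positivity
  calc ∏ l ∈ U, (1 - 1 / (l : ℝ))⁻¹ ≤ ∏ l ∈ U, Real.exp (2 / (z + 1)) := by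
        refine Finset.prod_le_prod (fun l hl => ?_) fun l hl => ?_
        · have := one_le_inv_one_sub (hS l (hU l hl).1).two_le; linarith
        · refine (inv_one_sub_le_exp (hS l (hU l hl).1).two_le).trans ?_
          have : ((z:ℝ) + 1) ≤ l := by exact_mod_cast hz l (hU l hl).1
          gcongr
    _ = Real.exp (U.card * (2 / (z + 1))) := by
        rw [Finset.prod_const, ← Real.exp_nat_mul]
    _ ≤ Real.exp 4 := by
        have : (U.card : ℝ) ≤ 2 * (z + 1) := by exact_mod_cast hcard
        gcongr
        rw [mul_div_assoc', div_le_iff₀ hz0]; linarith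

/-- Mean value of `diffWeight g D l` over residues modulo `l`. -/
def meanWeight (g l : ℕ) : ℝ := (1 - 1 / (l : ℝ)) * (if l ∣ g then 1 - 1 / (l : ℝ) else 1)

lemma sum_range_ite_dvd {l : ℕ} (hl : 0 < l) (A B : ℝ) :
    ∑ y ∈ Finset.range l, (if l ∣ y then A else B) = A + (l - 1) * B := by
  obtain ⟨k, rfl⟩ : ∃ k, l = k + 1 := ⟨l - 1, by omega⟩
  rw [Finset.sum_range_succ']
  have : ∀ y ∈ Finset.range k, (if (k + 1) ∣ (y + 1) then A else B) = B := by
    intro y hy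
    rw [if_neg]
    intro h
    have := Nat.le_of_dvd (by omega) h
    have := Finset.mem_range.1 hy
    omega
  rw [Finset.sum_congr rfl this]
  simp; ring

lemma mean_diffWeight {g D l : ℕ} (hl : l.Prime) (h : l ∣ g * D) :
    (∑ y ∈ Finset.range l, diffWeight g D l y) / l = meanWeight g l := by
  have hl0 : (l:ℝ) ≠ 0 := by exact_mod_cast hl.ne_zero
  unfold diffWeight meanWeight
  by_cases hD : l ∣ D
  · have : ∀ y, (if l ∣ g then (if l ∣ D ∨ l ∣ y then 1 - 1 / (l : ℝ) else 1 - 2 / (l : ℝ)) else 1) *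
        (if l ∣ D ∧ l ∣ y then 0 else 1) =
        if l ∣ y then 0 else (if l ∣ g then 1 - 1 / (l:ℝ) else 1) := by
      intro y; by_cases hy : l ∣ y <;> simp [hD, hy]
    simp only [this]
    rw [sum_range_ite_dvd hl.pos]
    field_simp
    ring
  · have hg : l ∣ g := (hl.dvd_mul.1 h).resolve_right hD
    have : ∀ y, (if l ∣ g then (if l ∣ D ∨ l ∣ y then 1 - 1 / (l : ℝ) else 1 - 2 / (l : ℝ)) else 1) *
        (if l ∣ D ∧ l ∣ y then 0 else 1) =
        if l ∣ y then 1 - 1 / (l:ℝ) else 1 - 2 / (l:ℝ) := by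
      intro y; by_cases hy : l ∣ y <;> simp [hD, hg, hy]
    simp only [this]
    rw [sum_range_ite_dvd hl.pos, if_pos hg]
    field_simp
    ring

lemma diffWeight_le {g D l : ℕ} (hl : l.Prime) (h : l ∣ g * D) (c : ℕ) :
    diffWeight g D l c ≤ meanWeight g l * ((if l ∣ D then (1 - 1 / (l : ℝ))⁻¹ else 1) *
      (if l ∣ c then (1 - 1 / (l : ℝ))⁻¹ else 1)) := by
  have h2 : (2:ℝ) ≤ l := by exact_mod_cast hl.two_le
  have h0 : 0 < 1 - 1 / (l:ℝ) := by
    rw [sub_pos, div_lt_one (by linarith)]; linarith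
  have hi := one_le_inv_one_sub hl.two_le
  unfold diffWeight meanWeight
  by_cases hD : l ∣ D
  · by_cases hc : l ∣ c
    · simp only [hD, hc, and_self, if_true, mul_zero]
      split_ifs <;> positivity
    · simp only [hD, hc, and_false, if_true, if_false, mul_one, true_or]
      rw [mul_right_comm, mul_inv_cancel₀ h0.ne', one_mul]
  · have hg : l ∣ g := (hl.dvd_mul.1 h).resolve_right hD
    by_cases hc : l ∣ c
    · simp only [hD, hc, hg, if_true, if_false, or_true, false_and, mul_one, one_mul]
      refine le_of_eq ?_
      field_simp
    · simp only [hD, hc, hg, if_true, if_false, false_or, false_and, mul_one]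
      have : 0 ≤ 1 / (l:ℝ) := by positivity
      rw [show 2 / (l:ℝ) = 2 * (1 / l) by ring]
      nlinarith

lemma meanWeight_nonneg {l : ℕ} (hl : 2 ≤ l) (g : ℕ) : 0 ≤ meanWeight g l := by
  have h2 : (2:ℝ) ≤ l := by exact_mod_cast hl
  have h0 : 0 < 1 - 1 / (l:ℝ) := by
    rw [sub_pos, div_lt_one (by linarith)]; linarith
  unfold meanWeight; split_ifs <;> positivity

lemma sum_small_diffWeight_le {g D X : ℕ} (hX : X ≠ 0) :
    ∑ c ∈ Finset.Icc 1 X, ∏ l ∈ (g * D).primeFactors with l ≤ Nat.log 4 X, diffWeight g D l c ≤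
      2 * X * ∏ l ∈ (g * D).primeFactors with l ≤ Nat.log 4 X, meanWeight g l := by
  set S := (g * D).primeFactors.filter (· ≤ Nat.log 4 X) with hS
  have hSp : ∀ l ∈ S, l.Prime := fun l hl => Nat.prime_of_mem_primeFactors (Finset.mem_filter.1 hl).1
  have hSd : ∀ l ∈ S, l ∣ g * D := fun l hl => Nat.dvd_of_mem_primeFactors (Finset.mem_filter.1 hl).1
  set Q := ∏ l ∈ S, l with hQ
  have hQ0 : 0 < Q := Finset.prod_pos fun l hl => (hSp l hl).pos
  have hQX : Q ≤ X := by
    have h1 : Q ≤ primorial (Nat.log 4 X) := by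
      refine Nat.le_of_dvd (primorial_pos _) (Finset.prod_dvd_prod_of_subset _ _ _ fun l hl => ?_)
      rw [Finset.mem_filter, Finset.mem_range]
      exact ⟨Nat.lt_succ_of_le (Finset.mem_filter.1 hl).2, hSp l hl⟩
    exact h1.trans ((primorial_le_four_pow _).trans (Nat.pow_log_le_self 4 hX))
  have hper : ∀ l ∈ S, Function.Periodic (fun c => diffWeight g D l c) l := by
    intro l _ c
    simp only [diffWeight, Nat.dvd_add_left (dvd_refl l)]
  have hsum := sum_range_prod_periodic (f := fun l c => diffWeight g D l c) hSp hper
    (M := Q * (X / Q + 1)) (dvd_mul_right _ _)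
  have hnn : ∀ c, 0 ≤ ∏ l ∈ S, diffWeight g D l c := fun c =>
    Finset.prod_nonneg fun l hl => diffWeight_nonneg (hSp l hl).two_le _ _ _
  have hm0 : 0 ≤ ∏ l ∈ S, meanWeight g l :=
    Finset.prod_nonneg fun l hl => meanWeight_nonneg (hSp l hl).two_le _
  calc ∑ c ∈ Finset.Icc 1 X, ∏ l ∈ S, diffWeight g D l c
      ≤ ∑ c ∈ Finset.range (Q * (X / Q + 1)), ∏ l ∈ S, diffWeight g D l c := by
        refine Finset.sum_le_sum_of_subset_of_nonneg (fun c hc => ?_) fun c _ _ => hnn c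
        rw [Finset.mem_range]
        exact lt_of_le_of_lt (Finset.mem_Icc.1 hc).2 (Nat.lt_mul_div_succ X hQ0)
    _ = (Q * (X / Q + 1) : ℕ) * ∏ l ∈ S, meanWeight g l := by
        rw [hsum]
        congr 1
        exact Finset.prod_congr rfl fun l hl => mean_diffWeight (hSp l hl) (hSd l hl)
    _ ≤ (2 * X : ℕ) * ∏ l ∈ S, meanWeight g l := by
        have : Q * (X / Q + 1) ≤ 2 * X := by
          have := Nat.mul_div_le X Q
          rw [mul_add]; omega
        gcongr
    _ = _ := by push_cast; ring

lemma sum_diffWeight_le {g D X : ℕ} (hX : X ≠ 0) :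
    ∑ c ∈ Finset.Icc 1 X, ∏ l ∈ (g * D).primeFactors, diffWeight g D l c ≤
      2 * X * Real.exp 4 * ((∏ l ∈ (g * D).primeFactors, meanWeight g l) *
        ∏ l ∈ (g * D).primeFactors with Nat.log 4 X < l,
          (if l ∣ D then (1 - 1 / (l : ℝ))⁻¹ else 1)) := by
  set S := (g * D).primeFactors
  have hSp : ∀ l ∈ S, l.Prime := fun l hl => Nat.prime_of_mem_primeFactors hl
  have hSd : ∀ l ∈ S, l ∣ g * D := fun l hl => Nat.dvd_of_mem_primeFactors hl
  set z := Nat.log 4 X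
  have hsp : ∀ f : ℕ → ℝ, ∏ l ∈ S, f l = (∏ l ∈ S with l ≤ z, f l) * ∏ l ∈ S with z < l, f l := by
    intro f
    rw [← Finset.prod_filter_mul_prod_filter_not S (· ≤ z)]
    simp only [not_le]
  have hT : ∀ l ∈ S.filter (z < ·), l ∈ S ∧ z < l := fun l hl => Finset.mem_filter.1 hl
  set Mw := ∏ l ∈ S with z < l, meanWeight g l
  set Dw := ∏ l ∈ S with z < l, (if l ∣ D then (1 - 1 / (l : ℝ))⁻¹ else 1)
  have hMw : 0 ≤ Mw := Finset.prod_nonneg fun l hl => meanWeight_nonneg (hSp l (hT l hl).1).two_le _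
  have hDw : 0 ≤ Dw := Finset.prod_nonneg fun l hl => by
    have := one_le_inv_one_sub (hSp l (hT l hl).1).two_le
    split_ifs <;> linarith
  have hlarge : ∀ c ∈ Finset.Icc 1 X, ∏ l ∈ S with z < l, diffWeight g D l c ≤
      Mw * Dw * Real.exp 4 := by
    intro c hc
    obtain ⟨hc1, hcX⟩ := Finset.mem_Icc.1 hc
    calc _ ≤ ∏ l ∈ S with z < l, (meanWeight g l * ((if l ∣ D then (1 - 1 / (l : ℝ))⁻¹ else 1) *
          (if l ∣ c then (1 - 1 / (l : ℝ))⁻¹ else 1))) :=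
        Finset.prod_le_prod (fun l hl => diffWeight_nonneg (hSp l (hT l hl).1).two_le _ _ _)
          fun l hl => diffWeight_le (hSp l (hT l hl).1) (hSd l (hT l hl).1) c
      _ = Mw * Dw * ∏ l ∈ S with z < l, (if l ∣ c then (1 - 1 / (l : ℝ))⁻¹ else 1) := by
        rw [Finset.prod_mul_distrib, Finset.prod_mul_distrib, mul_assoc]
      _ ≤ _ := by
        gcongr
        exact prod_large_dvd_le (fun l hl => hSp l (hT l hl).1) (fun l hl => (hT l hl).2)
          (by omega) (lt_of_le_of_lt hcX (Nat.lt_pow_succ_log_self (by norm_num) X))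
  calc _ ≤ ∑ c ∈ Finset.Icc 1 X, (∏ l ∈ S with l ≤ z, diffWeight g D l c) *
          (Mw * Dw * Real.exp 4) := by
        refine Finset.sum_le_sum fun c hc => ?_
        rw [hsp]
        refine mul_le_mul_of_nonneg_left (hlarge c hc) (Finset.prod_nonneg fun l hl =>
          diffWeight_nonneg (hSp l (Finset.mem_filter.1 hl).1).two_le _ _ _)
    _ ≤ (2 * X * ∏ l ∈ S with l ≤ z, meanWeight g l) * (Mw * Dw * Real.exp 4) := by
        rw [← Finset.sum_mul]
        have := sum_small_diffWeight_le (g := g) (D := D) hX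
        gcongr
    _ = _ := by rw [hsp (meanWeight g)]; ring

/-- Pairs of reduced numerators modulo `m` and `n` whose fractions are distinct but
congruent modulo `q`. -/
def overlap (q m n : ℕ) : Finset (ℕ × ℕ) :=
  (Finset.range m ×ˢ Finset.range n).filter fun x =>
    Nat.Coprime x.1 m ∧ Nat.Coprime x.2 n ∧ (x.1 : ℤ) * n - x.2 * m ≠ 0 ∧
      (q : ℤ) ∣ x.1 * n - x.2 * m

lemma overlap_subset {q g m' n' : ℕ} (hq : 0 < q) (hm : 0 < m') (hn : 0 < n')
    (hqg : Nat.Coprime q g) :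
    overlap q (g * m') (g * n') ⊆ (Finset.Icc 1 (g * (m' * n') / q)).biUnion fun c =>
      fixedDiff g m' n' ((c * q : ℕ) : ℤ) ∪ fixedDiff g m' n' (-((c * q : ℕ) : ℤ)) := by
  rintro ⟨a, b⟩ h
  obtain ⟨hab, hac, hbc, hne, hdvd⟩ := Finset.mem_filter.1 h
  obtain ⟨ha, hb⟩ := Finset.mem_product.1 hab
  simp only [Finset.mem_range] at ha hb hac hbc hne hdvd
  set e : ℤ := (a : ℤ) * n' - b * m' with he
  have hge : (a : ℤ) * (g * n' : ℕ) - b * (g * m' : ℕ) = g * e := by rw [he]; push_cast; ring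
  rw [hge] at hne hdvd
  have he0 : e ≠ 0 := fun h0 => hne (by rw [h0, mul_zero])
  have hqe : (q : ℤ) ∣ e :=
    IsCoprime.dvd_of_dvd_mul_left (Nat.isCoprime_iff_coprime.2 hqg) hdvd
  have hqn : q ∣ e.natAbs := Int.natCast_dvd.1 hqe
  obtain ⟨c, hc⟩ := hqn
  have hlt : e.natAbs ≤ g * (m' * n') := by
    have h1 : (a : ℤ) * n' < g * (m' * n') := by
      have : a * n' < g * m' * n' := Nat.mul_lt_mul_of_pos_right ha hn
      rw [← mul_assoc]; exact_mod_cast this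
    have h2 : (b : ℤ) * m' < g * (m' * n') := by
      have : b * m' < g * n' * m' := Nat.mul_lt_mul_of_pos_right hb hm
      rw [mul_comm (m' : ℤ), ← mul_assoc]; exact_mod_cast this
    have h3 : (0:ℤ) ≤ a * n' := by positivity
    have h4 : (0:ℤ) ≤ b * m' := by positivity
    zify
    rw [abs_le]
    constructor <;> omega
  have hc1 : 1 ≤ c := by
    rcases Nat.eq_zero_or_pos c with h0 | h0
    · rw [h0, mul_zero, Int.natAbs_eq_zero] at hc; exact absurd hc he0
    · exact h0
  refine Finset.mem_biUnion.2 ⟨c, Finset.mem_Icc.2 ⟨hc1, ?_⟩, ?_⟩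
  · rw [Nat.le_div_iff_mul_le hq, mul_comm, ← hc]; exact hlt
  · rw [Finset.mem_union]
    rcases Int.natAbs_eq e with h | h
    · left
      refine Finset.mem_filter.2 ⟨hab, hac, hbc, ?_⟩
      rw [mul_comm c q, ← hc]; exact h
    · right
      refine Finset.mem_filter.2 ⟨hab, hac, hbc, ?_⟩
      rw [mul_comm c q, ← hc]; exact h

lemma totient_mul_totient_eq {g m' n' : ℕ} (hg : 0 < g) (hm : 0 < m') (hn : 0 < n')
    (hmn : Nat.Coprime m' n') :
    ((g * m').totient : ℝ) * (g * n').totient =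
      g * (g * (m' * n')) * ∏ l ∈ (g * (m' * n')).primeFactors, meanWeight g l := by
  have hgcd : Nat.gcd (g * m') (g * n') = g := by
    rw [Nat.gcd_mul_left, hmn.gcd_eq_one, mul_one]
  have h := Nat.totient_gcd_mul_totient_mul (g * m') (g * n')
  rw [hgcd] at h
  have hR : ((g.totient : ℝ) * ((g * m') * (g * n')).totient) =
      (g * m').totient * (g * n').totient * g := by exact_mod_cast h
  have htot : ∀ N : ℕ, (N.totient : ℝ) = N * ∏ l ∈ N.primeFactors, (1 - 1 / (l : ℝ)) := by
    intro N
    have := congrArg (Rat.cast : ℚ → ℝ) (Nat.totient_eq_mul_prod_factors N)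
    push_cast at this
    simpa [one_div] using this
  have hpf : ((g * m') * (g * n')).primeFactors = (g * (m' * n')).primeFactors := by
    rw [show (g * m') * (g * n') = g * (g * (m' * n')) by ring,
      Nat.primeFactors_mul hg.ne' (by positivity)]
    exact Finset.union_eq_right.2 (Nat.primeFactors_mono (dvd_mul_right _ _) (by positivity))
  have hgp : ∏ l ∈ g.primeFactors, (1 - 1 / (l : ℝ)) =
      ∏ l ∈ (g * (m' * n')).primeFactors, (if l ∣ g then 1 - 1 / (l : ℝ) else 1) := by
    rw [← Finset.prod_filter]
    refine Finset.prod_congr ?_ fun _ _ => rfl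
    ext l
    simp only [Nat.mem_primeFactors, Finset.mem_filter]
    constructor
    · rintro ⟨h1, h2, _⟩
      exact ⟨⟨h1, h2.mul_right _, by positivity⟩, h2⟩
    · rintro ⟨⟨h1, _, _⟩, h2⟩
      exact ⟨h1, h2, hg.ne'⟩
  rw [htot g, htot, hpf, hgp] at hR
  have hg0 : (g : ℝ) ≠ 0 := by exact_mod_cast hg.ne'
  simp only [meanWeight, Finset.prod_mul_distrib]
  apply mul_right_cancel₀ hg0
  rw [← hR]
  push_cast
  ring

lemma dvd_iff_factorization_ne {g m' n' l : ℕ} (hg : 0 < g) (hm : 0 < m') (hn : 0 < n')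
    (hmn : Nat.Coprime m' n') (hl : l.Prime) :
    l ∣ m' * n' ↔ (g * m').factorization l ≠ (g * n').factorization l := by
  rw [Nat.factorization_mul hg.ne' hm.ne', Nat.factorization_mul hg.ne' hn.ne', hl.dvd_mul]
  simp only [Finsupp.add_apply, ne_eq, Nat.add_left_cancel_iff]
  have h1 := hl.dvd_iff_one_le_factorization hm.ne'
  have h2 := hl.dvd_iff_one_le_factorization hn.ne'
  have h3 : ¬ (l ∣ m' ∧ l ∣ n') := fun h =>
    hl.one_lt.ne' (Nat.dvd_one.1 (hmn.gcd_eq_one ▸ Nat.dvd_gcd h.1 h.2))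
  omega

/-- The correction factor attached to the pair `(m, n)`: the product of `(1 - 1/l)⁻¹` over the
primes `l > z` at which `m` and `n` have different valuations. -/
def anatomyFactor (z m n : ℕ) : ℝ :=
  ∏ l ∈ (m * n).primeFactors with z < l,
    (if m.factorization l ≠ n.factorization l then (1 - 1 / (l : ℝ))⁻¹ else 1)

lemma card_overlap_mul_le {q g m' n' : ℕ} (hg : 0 < g) (hm : 0 < m') (hn : 0 < n')
    (hmn : Nat.Coprime m' n') (hq : 0 < q) (hqc : Nat.Coprime q (g * (m' * n'))) :
    ((overlap q (g * m') (g * n')).card : ℝ) * q ≤ 4 * Real.exp 4 *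
      (((g * m').totient * (g * n').totient) *
        anatomyFactor (Nat.log 4 (g * (m' * n') / q)) (g * m') (g * n')) := by
  set X := g * (m' * n') / q with hX
  have hanat : anatomyFactor (Nat.log 4 X) (g * m') (g * n') =
      ∏ l ∈ (g * (m' * n')).primeFactors with Nat.log 4 X < l,
          (if l ∣ m' * n' then (1 - 1 / (l : ℝ))⁻¹ else 1) := by
    unfold anatomyFactor
    have hpf : ((g * m') * (g * n')).primeFactors = (g * (m' * n')).primeFactors := by
      rw [show (g * m') * (g * n') = g * (g * (m' * n')) by ring,
        Nat.primeFactors_mul hg.ne' (by positivity)]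
      exact Finset.union_eq_right.2 (Nat.primeFactors_mono (dvd_mul_right _ _) (by positivity))
    rw [hpf]
    refine Finset.prod_congr rfl fun l hl => ?_
    have hlp := Nat.prime_of_mem_primeFactors (Finset.mem_filter.1 hl).1
    simp only [dvd_iff_factorization_ne hg hm hn hmn hlp]
  have hq' : ∀ l, l.Prime → l ∣ g * (m' * n') → ¬ l ∣ q := fun l hl h1 h2 =>
    hl.one_lt.ne' (Nat.dvd_one.1 (hqc.gcd_eq_one ▸ Nat.dvd_gcd h2 h1))
  have hcard : ((overlap q (g * m') (g * n')).card : ℝ) ≤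
      ∑ c ∈ Finset.Icc 1 X, 2 * (g * ∏ l ∈ (g * (m' * n')).primeFactors,
        diffWeight g (m' * n') l c) := by
    have h1 := Finset.card_le_card (overlap_subset hq hm hn (hqc.coprime_mul_right_right))
    refine (Nat.cast_le.2 (h1.trans Finset.card_biUnion_le)).trans ?_
    rw [Nat.cast_sum]
    refine Finset.sum_le_sum fun c _ => ?_
    refine (Nat.cast_le.2 (Finset.card_union_le _ _)).trans ?_
    rw [Nat.cast_add, two_mul]
    exact add_le_add (card_fixedDiff_le hg hm hn hmn (Int.natAbs_natCast _) hq')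
      (card_fixedDiff_le hg hm hn hmn (by rw [Int.natAbs_neg, Int.natAbs_natCast]) hq')
  rw [hanat, totient_mul_totient_eq hg hm hn hmn]
  rcases Nat.eq_zero_or_pos X with h0 | h0
  · rw [h0] at hcard
    simp only [Finset.Icc_eq_empty_of_lt zero_lt_one, Finset.sum_empty] at hcard
    refine (mul_nonpos_of_nonpos_of_nonneg hcard (by positivity)).trans ?_
    refine mul_nonneg (by positivity) (mul_nonneg (mul_nonneg (by positivity)
      (Finset.prod_nonneg fun l hl => meanWeight_nonneg
        (Nat.prime_of_mem_primeFactors hl).two_le _)) (Finset.prod_nonneg fun l hl => ?_))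
    have := one_le_inv_one_sub
      (Nat.prime_of_mem_primeFactors (Finset.mem_filter.1 hl).1).two_le
    split_ifs <;> linarith
  · have hsum := sum_diffWeight_le (g := g) (D := m' * n') h0.ne'
    rw [← Finset.mul_sum, ← Finset.mul_sum] at hcard
    have hXq : (X : ℝ) * q ≤ g * (m' * n') := by
      exact_mod_cast Nat.div_mul_le_self _ _
    set A := ∏ l ∈ (g * (m' * n')).primeFactors, meanWeight g l
    set B := ∏ l ∈ (g * (m' * n')).primeFactors with Nat.log 4 X < l,
          (if l ∣ m' * n' then (1 - 1 / (l : ℝ))⁻¹ else 1)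
    have hA : 0 ≤ A := Finset.prod_nonneg fun l hl => meanWeight_nonneg
        (Nat.prime_of_mem_primeFactors hl).two_le _
    have hB : 0 ≤ B := Finset.prod_nonneg fun l hl => by
      have := one_le_inv_one_sub
        (Nat.prime_of_mem_primeFactors (Finset.mem_filter.1 hl).1).two_le
      split_ifs <;> linarith
    calc _ ≤ 2 * (g * (2 * X * Real.exp 4 * (A * B))) * q := by
          refine mul_le_mul_of_nonneg_right (hcard.trans ?_) (by positivity)
          gcongr
      _ = 4 * Real.exp 4 * (g * (X * q) * A * B) := by ring
      _ ≤ 4 * Real.exp 4 * (g * (g * (m' * n')) * A * B) := by gcongr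
      _ = _ := by ring

/-- Bound for the number of distinct pairs of reduced fractions congruent modulo `q`. -/
lemma card_overlap_le {q m n : ℕ} (hm : 0 < m) (hn : 0 < n) (hq : 0 < q)
    (hqm : Nat.Coprime q m) (hqn : Nat.Coprime q n) :
    ((overlap q m n).card : ℝ) * q ≤ 4 * Real.exp 4 *
      ((m.totient * n.totient) * anatomyFactor (Nat.log 4 (Nat.lcm m n / q)) m n) := by
  obtain ⟨g, m', n', hg, hmn, rfl, rfl⟩ := Nat.exists_coprime' (m := m) (n := n)
    (Nat.gcd_pos_of_pos_left _ hm)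
  rw [mul_comm m' g, mul_comm n' g] at *
  have hm' : 0 < m' := Nat.pos_of_mul_pos_left hm
  have hn' : 0 < n' := Nat.pos_of_mul_pos_left hn
  have := card_overlap_mul_le hg hm' hn' hmn hq
    (Nat.Coprime.mul_right (hqm.coprime_mul_right_right)
      (Nat.Coprime.mul_right hqm.coprime_mul_left_right hqn.coprime_mul_left_right))
  rwa [Nat.lcm_mul_left, hmn.lcm_eq_mul]

lemma lcmProd_factorization {P : Finset ℕ} {m n : ℕ} (hm : m ≠ 0) (hn : n ≠ 0)
    (h : (m * n).primeFactors ⊆ P) :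
    lcmProd P m.factorization n.factorization = Nat.lcm m n := by
  have hl : Nat.lcm m n ≠ 0 := Nat.lcm_ne_zero hm hn
  have hsub : (Nat.lcm m n).factorization.support ⊆ P := by
    rw [Nat.support_factorization]
    exact (Nat.primeFactors_mono (Nat.lcm_dvd_mul m n) (mul_ne_zero hm hn)).trans h
  conv_rhs => rw [← Nat.prod_factorization_pow_eq_self hl]
  rw [Finsupp.prod_of_support_subset _ hsub _ (fun _ _ => pow_zero _), lcmProd,
    Nat.factorization_lcm hm hn]
  push_cast
  rfl

lemma totientProd_factorization {P : Finset ℕ} {n : ℕ} (hn : n ≠ 0) (h : n.primeFactors ⊆ P) :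
    totientProd P n.factorization = n.totient := by
  rw [Nat.multiplicative_factorization Nat.totient
    (fun _ _ h => Nat.totient_mul h) Nat.totient_one hn,
    Finsupp.prod_of_support_subset _ (s := P) (by rwa [Nat.support_factorization]) _
      (fun _ _ => by rw [pow_zero, Nat.totient_one]), totientProd]
  push_cast
  rfl

/-- Sum of `1 / l` over the `l ∈ P` with `t ≤ l` at which `m` and `n` have different valuations. -/
def diffPrimeSum (P : Finset ℕ) (m n t : ℕ) : ℝ :=
  ∑ l ∈ P with t ≤ l ∧ m.factorization l ≠ n.factorization l, (1 : ℝ) / l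

lemma diffPrimeSum_le_succ (P : Finset ℕ) (m n t : ℕ) :
    diffPrimeSum P m n t ≤ diffPrimeSum P m n (t + 1) + 1 := by
  unfold diffPrimeSum
  have hsub : (P.filter fun l => t ≤ l ∧ m.factorization l ≠ n.factorization l) ⊆
      insert t (P.filter fun l => t + 1 ≤ l ∧ m.factorization l ≠ n.factorization l) := by
    intro l hl
    simp only [Finset.mem_insert, Finset.mem_filter] at hl ⊢
    by_cases h : l = t
    · exact Or.inl h
    · exact Or.inr ⟨hl.1, by omega, hl.2.2⟩
  refine (Finset.sum_le_sum_of_subset_of_nonneg hsub fun _ _ _ => by positivity).trans ?_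
  rw [Finset.sum_insert (by simp), add_comm]
  gcongr
  rcases Nat.eq_zero_or_pos t with rfl | ht
  · simp
  · rw [div_le_one (by positivity)]; exact_mod_cast ht

lemma anatomyFactor_le_exp {P : Finset ℕ} {m n : ℕ} (h : (m * n).primeFactors ⊆ P) (z : ℕ) :
    anatomyFactor z m n ≤ Real.exp (2 * diffPrimeSum P m n (z + 1)) := by
  unfold anatomyFactor
  calc _ ≤ ∏ l ∈ (m * n).primeFactors with z < l,
        Real.exp (if m.factorization l ≠ n.factorization l then 2 / (l : ℝ) else 0) := by
        refine Finset.prod_le_prod (fun l hl => ?_) fun l hl => ?_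
        · have := one_le_inv_one_sub
            (Nat.prime_of_mem_primeFactors (Finset.mem_filter.1 hl).1).two_le
          split_ifs <;> linarith
        · have := inv_one_sub_le_exp
            (Nat.prime_of_mem_primeFactors (Finset.mem_filter.1 hl).1).two_le
          split_ifs
          · exact this
          · rw [Real.exp_zero]
    _ ≤ _ := by
        rw [← Real.exp_sum, diffPrimeSum, ← Finset.sum_filter, Finset.filter_filter,
          Finset.mul_sum]
        refine Real.exp_le_exp.2 ?_
        have hsub : ((m * n).primeFactors.filter fun l => z < l ∧
            m.factorization l ≠ n.factorization l) ⊆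
            P.filter fun l => z + 1 ≤ l ∧ m.factorization l ≠ n.factorization l := by
          intro l hl
          rw [Finset.mem_filter] at hl ⊢
          exact ⟨h hl.1, hl.2.1, hl.2.2⟩
        refine (Finset.sum_le_sum_of_subset_of_nonneg hsub fun _ _ _ => by positivity).trans ?_
        exact le_of_eq (Finset.sum_congr rfl fun _ _ => by ring)

lemma exp_two_mul_le_sum {f : ℕ → ℝ} (hf : ∀ t, f t ≤ f (t + 1) + 1) {B : ℝ} {N : ℕ}
    (hN : ∀ t, N < t → f t < B) {t₀ : ℕ} (ht₀ : 1 ≤ t₀) :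
    Real.exp (2 * f t₀) ≤ Real.exp (2 * B) +
      ∑ t ∈ Finset.Icc 1 N, if t₀ ≤ t ∧ B ≤ f t then Real.exp (2 * B + 2 * t) else 0 := by
  have hnn : ∀ t ∈ Finset.Icc 1 N,
      0 ≤ if t₀ ≤ t ∧ B ≤ f t then Real.exp (2 * B + 2 * t) else 0 := fun t _ => by positivity
  by_cases h0 : f t₀ < B
  · exact (Real.exp_le_exp.2 (by linarith)).trans
      (le_add_of_nonneg_right (Finset.sum_nonneg hnn))
  rw [not_lt] at h0
  set U := (Finset.Icc 1 N).filter fun t => t₀ ≤ t ∧ B ≤ f t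
  have hle : t₀ ≤ N := by
    by_contra hc
    exact absurd (hN t₀ (not_le.1 hc)) (not_lt.2 h0)
  have hU : U.Nonempty := ⟨t₀, Finset.mem_filter.2 ⟨Finset.mem_Icc.2 ⟨ht₀, hle⟩, le_rfl, h0⟩⟩
  obtain ⟨hIcc, ht, hB⟩ := Finset.mem_filter.1 (U.max'_mem hU)
  set t := U.max' hU
  have hnext : f (t + 1) < B := by
    by_contra hc
    rw [not_lt] at hc
    have hlN : t + 1 ≤ N := by
      by_contra h
      exact absurd (hN (t + 1) (not_le.1 h)) (not_lt.2 hc)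
    have : t + 1 ≤ t := U.le_max' _ (Finset.mem_filter.2 ⟨Finset.mem_Icc.2 ⟨by omega, hlN⟩,
      by omega, hc⟩)
    omega
  have hsteps : ∀ j : ℕ, f t₀ ≤ f (t₀ + j) + j := by
    intro j
    induction j with
    | zero => simp
    | succ j ih =>
      have := hf (t₀ + j)
      push_cast
      rw [← add_assoc t₀ j 1]; linarith
  have h1 := hsteps (t - t₀)
  rw [Nat.add_sub_cancel' ht, Nat.cast_sub ht] at h1
  have h2 := hf t
  have h3 : (1:ℝ) ≤ t₀ := by exact_mod_cast ht₀
  calc Real.exp (2 * f t₀) ≤ Real.exp (2 * B + 2 * t) := Real.exp_le_exp.2 (by linarith)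
    _ = if t₀ ≤ t ∧ B ≤ f t then Real.exp (2 * B + 2 * t) else 0 := by rw [if_pos ⟨ht, hB⟩]
    _ ≤ ∑ t ∈ Finset.Icc 1 N, if t₀ ≤ t ∧ B ≤ f t then Real.exp (2 * B + 2 * t) else 0 :=
        Finset.single_le_sum hnn hIcc
    _ ≤ _ := le_add_of_nonneg_left (Real.exp_nonneg _)

/-- A bound for `bilinearConst P` that does not depend on `P`. -/
def bilinearConstBound : ℝ := 8 * Real.exp 4 * smallPrimeLoss ^ bilinearThreshold

lemma bilinearConst_le (P : Finset ℕ) : bilinearConst P ≤ bilinearConstBound := by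
  unfold bilinearConst bilinearConstBound
  refine mul_le_mul_of_nonneg_left (pow_le_pow_right₀ one_le_smallPrimeLoss ?_) (by positivity)
  have : P.filter (· < bilinearThreshold) ⊆ Finset.range bilinearThreshold := fun l hl =>
    Finset.mem_range.2 (Finset.mem_filter.1 hl).2
  simpa using Finset.card_le_card this

lemma bilinearConstBound_nonneg : 0 ≤ bilinearConstBound := by
  have := one_le_smallPrimeLoss
  unfold bilinearConstBound; positivity

/-- Constant in `sum_overlap_le`. -/
def overlapConst : ℝ := 4 * Real.exp 4 * (Real.exp 80 * (1 + 2 * bilinearConstBound))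

lemma overlapConst_nonneg : 0 ≤ overlapConst := by
  have := bilinearConstBound_nonneg
  unfold overlapConst; positivity

lemma two_mul_exp_neg_three_le : 2 * Real.exp (-3) ≤ 1 / 2 := by
  have h1 := Real.add_one_le_exp (3:ℝ)
  rw [Real.exp_neg, ← div_eq_mul_inv, div_le_iff₀ (Real.exp_pos _)]
  linarith

lemma bilinear_level_le {p : ℕ} (hp : p.Prime) {S : Finset ℕ} {k : ℕ → ℕ} (hS : ∀ n ∈ S, 0 < n)
    {P : Finset ℕ} (hP : ∀ l ∈ P, l.Prime) (hSP : ∀ n ∈ S, n.primeFactors ⊆ P)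
    {t : ℕ} (ht : 1 ≤ t) {E : Finset (ℕ × ℕ)} (hE : ∀ x ∈ E, x.1 ∈ S ∧ x.2 ∈ S)
    (hlcm : ∀ x ∈ E, Nat.lcm x.1 x.2 ≤ 4 ^ t * p ^ min (k x.1) (k x.2))
    (hdiff : ∀ x ∈ E, 40 ≤ diffPrimeSum P x.1 x.2 t) :
    Real.exp (2 * 40 + 2 * t) * ∑ x ∈ E, (x.1.totient / (p:ℝ) ^ k x.1) *
        (x.2.totient / (p:ℝ) ^ k x.2) ≤
      Real.exp 80 * bilinearConstBound * (∑ n ∈ S, n.totient / (p:ℝ) ^ k n) ^ (3/2 : ℝ) *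
        (1 / 2) ^ t := by
  have hp0 : (0:ℝ) < p := by exact_mod_cast hp.pos
  have hp1 : (1:ℝ) ≤ p := by exact_mod_cast hp.one_lt.le
  set w : ℕ → ℝ := fun n => n.totient / (p:ℝ) ^ k n with hw
  have hw0 : ∀ n, 0 ≤ w n := fun n => by positivity
  set M := ∑ n ∈ S, w n with hM
  have hM0 : 0 ≤ M := Finset.sum_nonneg fun n _ => hw0 n
  have hmulP : ∀ m ∈ S, ∀ n ∈ S, (m * n).primeFactors ⊆ P := fun m hm n hn => by
    rw [Nat.primeFactors_mul (hS m hm).ne' (hS n hn).ne']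
    exact Finset.union_subset (hSP m hm) (hSP n hn)
  have hinj : ∀ v ∈ S, ∀ v' ∈ S, (∀ l ∈ P, v.factorization l = v'.factorization l) → v = v' := by
    intro v hv v' hv' h
    refine Nat.eq_of_factorization_eq (hS v hv).ne' (hS v' hv').ne' fun l => ?_
    by_cases hl : l ∈ P
    · exact h l hl
    · rw [Finsupp.notMem_support_iff.1 (fun hc => hl (hSP v hv hc)),
        Finsupp.notMem_support_iff.1 (fun hc => hl (hSP v' hv' hc))]
  have hpow : ∀ a b : ℕ, min a b ≤ a → ∀ φ L : ℝ, 0 ≤ φ → L ≤ 4 ^ t * (p:ℝ) ^ min a b →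
      φ / (p:ℝ) ^ a * L ≤ 4 ^ t * φ := by
    intro a b hab φ L hφ hL
    have h1 : (p:ℝ) ^ min a b ≤ (p:ℝ) ^ a := pow_le_pow_right₀ hp1 hab
    rw [div_mul_eq_mul_div, div_le_iff₀ (by positivity)]
    calc φ * L ≤ φ * (4 ^ t * (p:ℝ) ^ a) := by
          gcongr; exact hL.trans (by gcongr)
      _ = _ := by ring
  have hlcmR : ∀ x ∈ E, (Nat.lcm x.1 x.2 : ℝ) ≤ 4 ^ t * (p:ℝ) ^ min (k x.1) (k x.2) :=
    fun x hx => by exact_mod_cast hlcm x hx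
  have key := bilinearBound ht (fun n => n.factorization) hw0 hw0 P hP S S E (4 ^ t) (4 ^ t) 40
    (by positivity) (by positivity) hinj hinj hE
    (fun x hx => by
      obtain ⟨h1, h2⟩ := hE x hx
      rw [lcmProd_factorization (hS _ h1).ne' (hS _ h2).ne' (hmulP _ h1 _ h2),
        totientProd_factorization (hS _ h1).ne' (hSP _ h1)]
      exact hpow _ _ (min_le_left _ _) _ _ (by positivity) (hlcmR x hx))
    (fun x hx => by
      obtain ⟨h1, h2⟩ := hE x hx
      rw [lcmProd_factorization (hS _ h1).ne' (hS _ h2).ne' (hmulP _ h1 _ h2),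
        totientProd_factorization (hS _ h2).ne' (hSP _ h2)]
      exact hpow _ (k x.1) (min_le_left _ _) _ _ (by positivity)
        (by rw [min_comm]; exact hlcmR x hx))
    hdiff
  have h4 : ((4:ℝ) ^ t * 4 ^ t) ^ (1/4 : ℝ) = 2 ^ t := by
    rw [← pow_add, ← Real.rpow_natCast, ← Real.rpow_natCast,
      show (4:ℝ) = 2 ^ (2:ℝ) by norm_num, ← Real.rpow_mul (by norm_num),
      ← Real.rpow_mul (by norm_num)]
    congr 1; push_cast; ring
  have h3 : (M * M) ^ (3/4 : ℝ) = M ^ (3/2 : ℝ) := by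
    rw [← sq, ← Real.rpow_natCast, ← Real.rpow_mul hM0]; norm_num
  rw [h4, h3] at key
  have hC : bilinearConst P ≤ bilinearConstBound := bilinearConst_le P
  have hM3 : 0 ≤ M ^ (3/2 : ℝ) := Real.rpow_nonneg hM0 _
  have hexp : Real.exp (2 * 40 + 2 * t) * (2 ^ t * Real.exp (-(t * 40 / 8))) ≤
      Real.exp 80 * (1 / 2) ^ t := by
    have h5 : Real.exp (2 * 40 + 2 * t) * (2 ^ t * Real.exp (-(t * 40 / 8))) =
        Real.exp 80 * (2 * Real.exp (-3)) ^ t := by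
      rw [mul_pow, ← Real.exp_nat_mul, show ∀ a b c : ℝ, a * (b * c) = b * (a * c) by
        intros; ring, ← Real.exp_add, show ∀ a b c : ℝ, a * (b * c) = b * (a * c) by
        intros; ring, ← Real.exp_add]
      congr 2; ring
    rw [h5]
    exact mul_le_mul_of_nonneg_left (pow_le_pow_left₀ (by positivity)
      two_mul_exp_neg_three_le _) (by positivity)
  calc _ ≤ Real.exp (2 * 40 + 2 * t) * (bilinearConstBound * 2 ^ t *
        Real.exp (-(t * 40 / 8)) * M ^ (3/2 : ℝ)) := by
        refine mul_le_mul_of_nonneg_left (key.trans ?_) (by positivity)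
        gcongr
    _ = (Real.exp (2 * 40 + 2 * t) * (2 ^ t * Real.exp (-(t * 40 / 8)))) *
        (bilinearConstBound * M ^ (3/2 : ℝ)) := by ring
    _ ≤ (Real.exp 80 * (1 / 2) ^ t) * (bilinearConstBound * M ^ (3/2 : ℝ)) :=
        mul_le_mul_of_nonneg_right hexp (mul_nonneg bilinearConstBound_nonneg hM3)
    _ = _ := by ring

lemma sum_overlap_le {p : ℕ} (hp : p.Prime) (S : Finset ℕ) (k : ℕ → ℕ)
    (hS : ∀ n ∈ S, 0 < n ∧ Nat.Coprime p n) :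
    ∑ x ∈ S ×ˢ S, ((overlap (p ^ min (k x.1) (k x.2)) x.1 x.2).card : ℝ) /
        (p:ℝ) ^ max (k x.1) (k x.2) ≤
      overlapConst * ((∑ n ∈ S, n.totient / (p:ℝ) ^ k n) ^ 2 +
        (∑ n ∈ S, n.totient / (p:ℝ) ^ k n) ^ (3/2 : ℝ)) := by
  have hp0 : (0:ℝ) < p := by exact_mod_cast hp.pos
  set w : ℕ → ℝ := fun n => n.totient / (p:ℝ) ^ k n with hw
  have hw0 : ∀ n, 0 ≤ w n := fun n => by positivity
  set M := ∑ n ∈ S, w n with hM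
  have hM0 : 0 ≤ M := Finset.sum_nonneg fun n _ => hw0 n
  have hM3 : 0 ≤ M ^ (3/2 : ℝ) := Real.rpow_nonneg hM0 _
  set P := S.biUnion Nat.primeFactors with hPdef
  have hP : ∀ l ∈ P, l.Prime := fun l hl => by
    obtain ⟨n, _, hn⟩ := Finset.mem_biUnion.1 hl
    exact Nat.prime_of_mem_primeFactors hn
  have hSP : ∀ n ∈ S, n.primeFactors ⊆ P := fun n hn => Finset.subset_biUnion_of_mem _ hn
  set N := P.sup id
  have hN : ∀ x : ℕ × ℕ, ∀ t, N < t → diffPrimeSum P x.1 x.2 t < 40 := by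
    intro x t ht
    rw [diffPrimeSum, Finset.filter_false_of_mem]
    · norm_num
    · rintro l hl ⟨h, _⟩
      have : l ≤ N := Finset.le_sup (f := id) hl
      omega
  set τ : ℕ × ℕ → ℕ := fun x =>
    Nat.log 4 (Nat.lcm x.1 x.2 / p ^ min (k x.1) (k x.2)) + 1 with hτ
  have hterm : ∀ x ∈ S ×ˢ S, ((overlap (p ^ min (k x.1) (k x.2)) x.1 x.2).card : ℝ) /
        (p:ℝ) ^ max (k x.1) (k x.2) ≤ 4 * Real.exp 4 * (w x.1 * w x.2 * (Real.exp (2 * 40) +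
          ∑ t ∈ Finset.Icc 1 N, if τ x ≤ t ∧ 40 ≤ diffPrimeSum P x.1 x.2 t
            then Real.exp (2 * 40 + 2 * t) else 0)) := by
    intro x hx
    obtain ⟨h1, h2⟩ := Finset.mem_product.1 hx
    have hc := card_overlap_le (hS _ h1).1 (hS _ h2).1
      (pow_pos hp.pos (min (k x.1) (k x.2))) ((hS _ h1).2.pow_left _) ((hS _ h2).2.pow_left _)
    have hmulP : (x.1 * x.2).primeFactors ⊆ P := by
      rw [Nat.primeFactors_mul (hS _ h1).1.ne' (hS _ h2).1.ne']
      exact Finset.union_subset (hSP _ h1) (hSP _ h2)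
    have ha := (anatomyFactor_le_exp hmulP
      (Nat.log 4 (Nat.lcm x.1 x.2 / p ^ min (k x.1) (k x.2)))).trans
      (exp_two_mul_le_sum (f := diffPrimeSum P x.1 x.2) (t₀ := τ x)
        (diffPrimeSum_le_succ P x.1 x.2) (hN x) (Nat.le_add_left _ _))
    set A := anatomyFactor (Nat.log 4 (Nat.lcm x.1 x.2 / p ^ min (k x.1) (k x.2))) x.1 x.2
    push_cast at hc
    have hmm : (p:ℝ) ^ min (k x.1) (k x.2) * (p:ℝ) ^ max (k x.1) (k x.2) =
        (p:ℝ) ^ k x.1 * (p:ℝ) ^ k x.2 := by rw [← pow_add, ← pow_add, min_add_max]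
    calc _ = ((overlap (p ^ min (k x.1) (k x.2)) x.1 x.2).card : ℝ) *
          (p:ℝ) ^ min (k x.1) (k x.2) / ((p:ℝ) ^ k x.1 * (p:ℝ) ^ k x.2) := by
          rw [← hmm]; field_simp
      _ ≤ 4 * Real.exp 4 * ((x.1.totient * x.2.totient) * A) /
          ((p:ℝ) ^ k x.1 * (p:ℝ) ^ k x.2) := by gcongr
      _ = 4 * Real.exp 4 * (w x.1 * w x.2 * A) := by rw [hw]; field_simp
      _ ≤ _ := by
        have := hw0 x.1
        have := hw0 x.2
        gcongr
  refine (Finset.sum_le_sum hterm).trans ?_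
  rw [← Finset.mul_sum]
  have hlevel : ∀ t ∈ Finset.Icc 1 N, (∑ x ∈ S ×ˢ S,
      if τ x ≤ t ∧ 40 ≤ diffPrimeSum P x.1 x.2 t
        then w x.1 * w x.2 * Real.exp (2 * 40 + 2 * t) else 0) ≤
      Real.exp 80 * bilinearConstBound * M ^ (3/2 : ℝ) * (1 / 2) ^ t := by
    intro t ht
    rw [← Finset.sum_filter, ← Finset.sum_mul, mul_comm]
    refine bilinear_level_le hp (fun n hn => (hS n hn).1) hP hSP (Finset.mem_Icc.1 ht).1
      (fun x hx => Finset.mem_product.1 (Finset.mem_filter.1 hx).1) (fun x hx => ?_)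
      (fun x hx => (Finset.mem_filter.1 hx).2.2)
    have h1 : Nat.lcm x.1 x.2 / p ^ min (k x.1) (k x.2) < 4 ^ t :=
      (Nat.lt_pow_succ_log_self (by norm_num) _).trans_le
        (Nat.pow_le_pow_right (by norm_num) (Finset.mem_filter.1 hx).2.1)
    exact ((Nat.div_lt_iff_lt_mul (pow_pos hp.pos _)).1 h1).le
  have hgeom : ∑ t ∈ Finset.Icc 1 N, (1 / 2 : ℝ) ^ t ≤ 2 :=
    (Finset.sum_le_sum_of_subset_of_nonneg (t := Finset.range (N + 1)) (fun t ht =>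
      Finset.mem_range.2 (Nat.lt_succ_of_le (Finset.mem_Icc.1 ht).2))
      fun _ _ _ => by positivity).trans (sum_geometric_two_le _)
  have hsum := Finset.sum_le_sum hlevel
  rw [← Finset.mul_sum] at hsum
  have hCb := bilinearConstBound_nonneg
  have hsum' := hsum.trans (mul_le_mul_of_nonneg_left hgeom (by positivity))
  have hsq : ∑ x ∈ S ×ˢ S, w x.1 * w x.2 * Real.exp (2 * 40) = M ^ 2 * Real.exp 80 := by
    rw [← Finset.sum_mul, Finset.sum_product, sq, hM, Finset.sum_mul_sum]; norm_num
  have hinner : ∑ x ∈ S ×ˢ S, w x.1 * w x.2 * (Real.exp (2 * 40) +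
      ∑ t ∈ Finset.Icc 1 N, if τ x ≤ t ∧ 40 ≤ diffPrimeSum P x.1 x.2 t
        then Real.exp (2 * 40 + 2 * t) else 0) ≤
      M ^ 2 * Real.exp 80 + Real.exp 80 * bilinearConstBound * M ^ (3/2 : ℝ) * 2 := by
    simp only [mul_add, Finset.sum_add_distrib, Finset.mul_sum _ _ (w _ * w _), mul_ite, mul_zero]
    rw [hsq, Finset.sum_comm]
    exact add_le_add_right hsum' _
  calc _ ≤ 4 * Real.exp 4 * (M ^ 2 * Real.exp 80 +
        Real.exp 80 * bilinearConstBound * M ^ (3/2 : ℝ) * 2) :=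
        mul_le_mul_of_nonneg_left hinner (by positivity)
    _ ≤ 4 * Real.exp 4 * (Real.exp 80 * (1 + 2 * bilinearConstBound) *
          (M ^ 2 + M ^ (3/2 : ℝ))) := by
        refine mul_le_mul_of_nonneg_left ?_ (by positivity)
        have h1 : 0 ≤ Real.exp 80 * bilinearConstBound * M ^ 2 := by positivity
        have h2 : 0 ≤ Real.exp 80 * M ^ (3/2 : ℝ) := by positivity
        linarith
    _ = _ := by unfold overlapConst; ring

section PadicMeasure

variable {p : ℕ} [Fact p.Prime]

lemma PadicInt.norm_le_inv_pow_iff (x : ℤ_[p]) (k : ℕ) :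
    ‖x‖ ≤ ((p : ℝ) ^ k)⁻¹ ↔ (p : ℤ_[p]) ^ k ∣ x := by
  rw [← Ideal.mem_span_singleton, ← PadicInt.norm_le_pow_iff_mem_span_pow, zpow_neg, zpow_natCast]

lemma PadicInt.mem_closedBall_inv_pow (x y : ℤ_[p]) (k : ℕ) :
    x ∈ Metric.closedBall y ((p : ℝ) ^ k)⁻¹ ↔ (p : ℤ_[p]) ^ k ∣ x - y := by
  rw [Metric.mem_closedBall, dist_eq_norm, PadicInt.norm_le_inv_pow_iff]

lemma natPrime_pos : (0 : ℝ) < p := by exact_mod_cast (Fact.out : p.Prime).pos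

lemma isOpenEmbedding_pow_mul (j : ℕ) :
    Topology.IsOpenEmbedding fun y : ℤ_[p] => (p : ℤ_[p]) ^ j * y := by
  have hp : (p : ℤ_[p]) ^ j ≠ 0 :=
    pow_ne_zero _ (Nat.cast_ne_zero.2 (Fact.out : p.Prime).ne_zero)
  refine ⟨((continuous_const.mul continuous_id).isClosedEmbedding
    (mul_right_injective₀ hp)).isEmbedding, ?_⟩
  have : Set.range (fun y : ℤ_[p] => (p : ℤ_[p]) ^ j * y) =
      Metric.closedBall 0 ((p : ℝ) ^ j)⁻¹ := by
    ext x
    rw [PadicInt.mem_closedBall_inv_pow, sub_zero]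
    exact ⟨fun ⟨y, hy⟩ => ⟨y, hy.symm⟩, fun ⟨y, hy⟩ => ⟨y, hy.symm⟩⟩
  rw [this]
  exact IsUltrametricDist.isOpen_closedBall _ (inv_ne_zero (pow_pos natPrime_pos j).ne')

variable [MeasurableSpace ℤ_[p]] [BorelSpace ℤ_[p]] (μ : Measure ℤ_[p]) [μ.IsAddHaarMeasure]

lemma measure_closedBall_eq (x y : ℤ_[p]) (r : ℝ) :
    μ (Metric.closedBall x r) = μ (Metric.closedBall y r) := by
  rw [← measure_preimage_add μ (x - y) (Metric.closedBall x r)]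
  congr 1
  ext z
  simp only [Set.mem_preimage, Metric.mem_closedBall, dist_eq_norm]
  rw [show x - y + z - x = z - y by ring]

variable [IsProbabilityMeasure μ]

lemma measure_closedBall_inv_pow (x : ℤ_[p]) (k : ℕ) :
    μ (Metric.closedBall x ((p : ℝ) ^ k)⁻¹) = ((p : ℝ≥0∞) ^ k)⁻¹ := by
  have hcover : (⋃ r ∈ Finset.range (p ^ k),
      Metric.closedBall ((r : ℕ) : ℤ_[p]) ((p : ℝ) ^ k)⁻¹) = Set.univ := by
    rw [Set.eq_univ_iff_forall]
    intro x
    rw [Set.mem_iUnion₂]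
    refine ⟨x.appr k, Finset.mem_range.2 (x.appr_lt k), ?_⟩
    rw [PadicInt.mem_closedBall_inv_pow, ← Ideal.mem_span_singleton]
    exact x.appr_spec k
  have hdisj : Set.PairwiseDisjoint (↑(Finset.range (p ^ k)))
      fun r : ℕ => Metric.closedBall (r : ℤ_[p]) ((p : ℝ) ^ k)⁻¹ := by
    intro r hr s hs hrs
    refine Set.disjoint_left.2 fun x hx hy => hrs ?_
    rw [PadicInt.mem_closedBall_inv_pow] at hx hy
    have h := dvd_sub hy hx
    rw [sub_sub_sub_cancel_left] at h
    have h2 : ((p:ℤ) ^ k) ∣ ((r : ℤ) - s) := by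
      rw [← PadicInt.pow_p_dvd_int_iff]; push_cast; exact h
    have hr' := Finset.mem_range.1 hr
    have hs' := Finset.mem_range.1 hs
    have h3 : (s : ℤ) ≡ r [ZMOD (p ^ k : ℕ)] := (Int.modEq_iff_dvd).2 (by push_cast; exact h2)
    exact (Nat.ModEq.eq_of_lt_of_lt (Int.natCast_modEq_iff.1 h3) hs' hr').symm
  have h := measure_biUnion_finset (μ := μ) hdisj fun r _ => Metric.isClosed_closedBall.measurableSet
  rw [hcover, measure_univ, Finset.sum_congr rfl
    (fun (r : ℕ) _ => measure_closedBall_eq μ (r : ℤ_[p]) x ((p : ℝ) ^ k)⁻¹), Finset.sum_const, Finset.card_range,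
    nsmul_eq_mul, Nat.cast_pow] at h
  exact ENNReal.eq_inv_of_mul_eq_one_left (by rw [mul_comm]; exact h.symm)

lemma measureReal_closedBall_inv_pow (x : ℤ_[p]) (k : ℕ) :
    μ.real (Metric.closedBall x ((p : ℝ) ^ k)⁻¹) = ((p : ℝ) ^ k)⁻¹ := by
  rw [measureReal_def, measure_closedBall_inv_pow]
  simp

lemma measure_preimage_pow_mul (j : ℕ) (A : Set ℤ_[p]) (hA : A ⊆ Metric.closedBall 0 ((p : ℝ) ^ j)⁻¹) :
    μ ((fun y => (p : ℤ_[p]) ^ j * y) ⁻¹' A) = (p : ℝ≥0∞) ^ j * μ A := by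
  set f : ℤ_[p] →+ ℤ_[p] := AddMonoidHom.mulLeft ((p : ℤ_[p]) ^ j)
  have hf : Topology.IsOpenEmbedding f := isOpenEmbedding_pow_mul j
  have hp0 : (p : ℝ≥0∞) ^ j ≠ 0 :=
    pow_ne_zero _ (Nat.cast_ne_zero.2 (Fact.out : p.Prime).ne_zero)
  have hpt : (p : ℝ≥0∞) ^ j ≠ ⊤ := ENNReal.pow_ne_top (ENNReal.natCast_ne_top p)
  have hcomap : ∀ B, μ.comap f B = μ (f '' B) := fun B =>
    hf.measurableEmbedding.comap_apply μ B
  have hH : (μ.comap f).IsAddHaarMeasure := Measure.IsAddHaarMeasure.comap (mH := inferInstance) μ hf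
  have hH' : ((p : ℝ≥0∞) ^ j • μ.comap f).IsAddHaarMeasure := hH.smul _ hp0 hpt
  have hrange : f '' Set.univ = Metric.closedBall 0 ((p : ℝ) ^ j)⁻¹ := by
    ext x
    rw [PadicInt.mem_closedBall_inv_pow, sub_zero, Set.image_univ]
    exact ⟨fun ⟨y, hy⟩ => ⟨y, hy.symm⟩, fun ⟨y, hy⟩ => ⟨y, hy.symm⟩⟩
  have hprob : IsProbabilityMeasure ((p : ℝ≥0∞) ^ j • μ.comap f) := ⟨by
    rw [Measure.smul_apply, hcomap, hrange, measure_closedBall_inv_pow, smul_eq_mul,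
      ENNReal.mul_inv_cancel hp0 hpt]⟩
  have heq := Measure.isAddHaarMeasure_eq_of_isProbabilityMeasure
    ((p : ℝ≥0∞) ^ j • μ.comap f) μ
  have h1 : f '' (f ⁻¹' A) = A :=
    Set.image_preimage_eq_of_subset (by rw [← Set.image_univ, hrange]; exact hA)
  change μ (f ⁻¹' A) = _
  conv_lhs => rw [← heq]
  rw [Measure.smul_apply, hcomap, h1, smul_eq_mul]

lemma measure_preimage_add_pow_mul (j : ℕ) (r : ℤ_[p]) (A : Set ℤ_[p]) :
    μ ((fun y => r + (p : ℤ_[p]) ^ j * y) ⁻¹' A) =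
      μ (A ∩ Metric.closedBall r ((p : ℝ) ^ j)⁻¹) / μ (Metric.closedBall r ((p : ℝ) ^ j)⁻¹) := by
  have h := measure_preimage_pow_mul μ j
    ((fun z => r + z) ⁻¹' (A ∩ Metric.closedBall r ((p : ℝ) ^ j)⁻¹)) (by
      intro z hz
      have := hz.2
      rw [PadicInt.mem_closedBall_inv_pow] at this ⊢
      simpa using this)
  rw [measure_preimage_add] at h
  rw [measure_closedBall_inv_pow, div_eq_mul_inv, inv_inv, mul_comm, ← h]
  congr 1
  ext y
  simp only [Set.mem_preimage, Set.mem_inter_iff, PadicInt.mem_closedBall_inv_pow]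
  simp

instance isUnifLocDoublingMeasure_padicInt : IsUnifLocDoublingMeasure μ := by
  refine ⟨⟨(p : NNReal) ^ 2, ?_⟩⟩
  have hp1 : (1:ℝ) < p := by exact_mod_cast (Fact.out : p.Prime).one_lt
  have hp2 : (2:ℝ) ≤ p := by exact_mod_cast (Fact.out : p.Prime).two_le
  have hp0 : (0:ℝ) < p := natPrime_pos
  filter_upwards [Ioo_mem_nhdsGT (show (0:ℝ) < (p:ℝ)⁻¹ by positivity)] with ε hε x
  obtain ⟨hε0, hε1⟩ := hε
  obtain ⟨n, hn1, hn2⟩ := exists_nat_pow_near (x := ε⁻¹) (y := (p:ℝ))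
    ((one_le_inv₀ hε0).2 (hε1.le.trans (inv_le_one_of_one_le₀ hp1.le))) hp1
  have hn : n ≠ 0 := by
    rintro rfl
    rw [zero_add, pow_one, inv_lt_comm₀ hε0 hp0] at hn2
    linarith
  obtain ⟨m, rfl⟩ := Nat.exists_eq_succ_of_ne_zero hn
  have hlow : ((p:ℝ) ^ (m + 1 + 1))⁻¹ ≤ ε := (inv_lt_of_inv_lt₀ hε0 hn2).le
  have hup : 2 * ε ≤ ((p:ℝ) ^ m)⁻¹ := by
    have h1 : ε ≤ ((p:ℝ) ^ (m + 1))⁻¹ := (le_inv_comm₀ (by positivity) hε0).1 hn1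
    calc 2 * ε ≤ p * ((p:ℝ) ^ (m + 1))⁻¹ := by gcongr
      _ = _ := by rw [pow_succ]; field_simp
  calc μ (Metric.closedBall x (2 * ε)) ≤ μ (Metric.closedBall x ((p:ℝ) ^ m)⁻¹) :=
        measure_mono (Metric.closedBall_subset_closedBall hup)
    _ = (p:ℝ≥0∞) ^ 2 * μ (Metric.closedBall x ((p:ℝ) ^ (m + 1 + 1))⁻¹) := by
        rw [measure_closedBall_inv_pow, measure_closedBall_inv_pow, add_assoc, pow_add,
          ENNReal.mul_inv (Or.inr (ENNReal.pow_ne_top (ENNReal.natCast_ne_top p)))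
            (Or.inl (ENNReal.pow_ne_top (ENNReal.natCast_ne_top p))),
          mul_left_comm, ENNReal.mul_inv_cancel (pow_ne_zero _
            (Nat.cast_ne_zero.2 (Fact.out : p.Prime).ne_zero))
            (ENNReal.pow_ne_top (ENNReal.natCast_ne_top p)), mul_one]
    _ ≤ (p:ℝ≥0∞) ^ 2 * μ (Metric.closedBall x ε) := by
        gcongr
    _ = _ := by push_cast; rfl

end PadicMeasure

/-- Chung–Erdős inequality. -/
lemma one_le_mul_measureReal_biUnion {Ω ι : Type*} [MeasurableSpace Ω] (μ : Measure Ω)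
    [IsProbabilityMeasure μ] (T : Finset ι) (A : ι → Set Ω) (hA : ∀ i ∈ T, MeasurableSet (A i))
    {D M : ℝ} (hM : 0 < M) (hD : 0 < D) (hsum : ∑ i ∈ T, μ.real (A i) = M)
    (h2 : ∑ i ∈ T, ∑ j ∈ T, μ.real (A i ∩ A j) ≤ D * M ^ 2) :
    1 ≤ D * μ.real (⋃ i ∈ T, A i) := by
  set U := ⋃ i ∈ T, A i
  have hU : MeasurableSet U := Finset.measurableSet_biUnion _ hA
  set f : Ω → ℝ := fun x => ∑ i ∈ T, (A i).indicator 1 x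
  have hint : ∀ B : Set Ω, MeasurableSet B → Integrable (B.indicator (1 : Ω → ℝ)) μ :=
    fun B hB => (integrable_const (1:ℝ)).indicator hB
  have hf : Integrable f μ := integrable_finsetSum _ fun i hi => hint _ (hA i hi)
  have hfI : ∫ x, f x ∂μ = M := by
    rw [integral_finsetSum _ fun i hi => hint _ (hA i hi), ← hsum]
    exact Finset.sum_congr rfl fun i hi => integral_indicator_one (hA i hi)
  have hf2 : ∀ x, f x ^ 2 = ∑ i ∈ T, ∑ j ∈ T, (A i ∩ A j).indicator (1 : Ω → ℝ) x := by
    intro x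
    rw [sq, Finset.sum_mul_sum]
    refine Finset.sum_congr rfl fun i _ => Finset.sum_congr rfl fun j _ => ?_
    rw [Set.inter_indicator_one]; rfl
  have hintf2 : Integrable (fun x => f x ^ 2) μ := by
    simp only [hf2]
    exact integrable_finsetSum _ fun i hi => integrable_finsetSum _ fun j hj =>
      hint _ ((hA i hi).inter (hA j hj))
  have hf2I : ∫ x, f x ^ 2 ∂μ ≤ D * M ^ 2 := by
    refine le_trans (le_of_eq ?_) h2
    simp only [hf2]
    rw [integral_finsetSum _ fun i hi => integrable_finsetSum _ fun j hj =>
      hint _ ((hA i hi).inter (hA j hj))]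
    refine Finset.sum_congr rfl fun i hi => ?_
    rw [integral_finsetSum _ fun j hj => hint _ ((hA i hi).inter (hA j hj))]
    exact Finset.sum_congr rfl fun j hj => integral_indicator_one ((hA i hi).inter (hA j hj))
  set s := D * M
  have hpt : ∀ x, 2 * s * f x ≤ f x ^ 2 + s ^ 2 * U.indicator 1 x := by
    intro x
    by_cases hx : x ∈ U
    · rw [Set.indicator_of_mem hx, Pi.one_apply]
      nlinarith [sq_nonneg (f x - s)]
    · have : f x = 0 := Finset.sum_eq_zero fun i hi =>
        Set.indicator_of_notMem (fun h => hx (Set.mem_biUnion hi h)) _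
      rw [Set.indicator_of_notMem hx, this]; simp
  have hI := integral_mono (hf.const_mul (2 * s)) (hintf2.add ((hint U hU).const_mul (s ^ 2))) hpt
  simp only [Pi.add_apply] at hI
  rw [integral_const_mul, integral_add hintf2 ((hint U hU).const_mul (s ^ 2)), integral_const_mul,
    integral_indicator_one hU, hfI] at hI
  have h3 : D * M ^ 2 * 1 ≤ D * M ^ 2 * (D * μ.real U) := by
    have : 2 * s * M ≤ D * M ^ 2 + s ^ 2 * μ.real U := hI.trans (by gcongr)
    simp only [s] at this
    nlinarith
  exact le_of_mul_le_mul_left h3 (by positivity)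

section PadicMeasure

variable {p : ℕ} [Fact p.Prime]

/-- The rational `a / n` as a `p`-adic integer, meaningful when `p` does not divide `n`. -/
def padicFrac (p : ℕ) [Fact p.Prime] (a : ℤ) (n : ℕ) : ℤ_[p] := a * Ring.inverse (n : ℤ_[p])

lemma isUnit_natCast_padicInt {n : ℕ} (hn : Nat.Coprime p n) : IsUnit (n : ℤ_[p]) := by
  rw [PadicInt.isUnit_iff, PadicInt.norm_natCast_eq_one_iff]
  exact hn

lemma natCast_mul_padicFrac {n : ℕ} (hn : Nat.Coprime p n) (a : ℤ) :
    (n : ℤ_[p]) * padicFrac p a n = a := by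
  rw [padicFrac, mul_left_comm, Ring.mul_inverse_cancel _ (isUnit_natCast_padicInt hn), mul_one]

lemma mem_closedBall_padicFrac {n : ℕ} (hn : Nat.Coprime p n) (a : ℤ) (x : ℤ_[p]) (r : ℝ) :
    x ∈ Metric.closedBall (padicFrac p a n) r ↔ ‖(n : ℤ_[p]) * x - a‖ ≤ r := by
  rw [Metric.mem_closedBall, dist_eq_norm, ← natCast_mul_padicFrac hn a, ← mul_sub, norm_mul,
    PadicInt.isUnit_iff.1 (isUnit_natCast_padicInt hn), one_mul]

variable [MeasurableSpace ℤ_[p]] [BorelSpace ℤ_[p]] (μ : Measure ℤ_[p]) [μ.IsAddHaarMeasure]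
  [IsProbabilityMeasure μ]

lemma measureReal_inter_closedBall_le {m n a b : ℕ} (hm : Nat.Coprime p m) (hn : Nat.Coprime p n)
    (ham : a ∈ (Finset.range m).filter (Nat.Coprime · m))
    (hbn : b ∈ (Finset.range n).filter (Nat.Coprime · n)) (k l : ℕ) :
    μ.real (Metric.closedBall (padicFrac p a m) ((p : ℝ) ^ k)⁻¹ ∩
        Metric.closedBall (padicFrac p b n) ((p : ℝ) ^ l)⁻¹) ≤
      (if (a, b) ∈ overlap (p ^ min k l) m n then ((p : ℝ) ^ max k l)⁻¹ else 0) +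
        if m = n then (if a = b then ((p : ℝ) ^ k)⁻¹ else 0) else 0 := by
  have hp0 : (0:ℝ) < p := natPrime_pos
  rw [Finset.mem_filter, Finset.mem_range] at ham hbn
  set A := Metric.closedBall (padicFrac p a m) ((p : ℝ) ^ k)⁻¹ with hA
  set B := Metric.closedBall (padicFrac p b n) ((p : ℝ) ^ l)⁻¹ with hB
  have hAm : μ.real A = ((p : ℝ) ^ k)⁻¹ := measureReal_closedBall_inv_pow μ _ _
  have hBm : μ.real B = ((p : ℝ) ^ l)⁻¹ := measureReal_closedBall_inv_pow μ _ _
  have hABA : μ.real (A ∩ B) ≤ ((p : ℝ) ^ k)⁻¹ := hAm ▸ measureReal_mono Set.inter_subset_left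
  have hABB : μ.real (A ∩ B) ≤ ((p : ℝ) ^ l)⁻¹ := hBm ▸ measureReal_mono Set.inter_subset_right
  have hABmax : μ.real (A ∩ B) ≤ ((p : ℝ) ^ max k l)⁻¹ := by
    rcases max_cases k l with h | h <;> rw [h.1] <;> assumption
  rcases Set.eq_empty_or_nonempty (A ∩ B) with he | ⟨x, hxA, hxB⟩
  · rw [he, measureReal_empty]; positivity
  by_cases hab : (a : ℤ) * n - b * m = 0
  · have h1 : a * n = b * m := by zify; linarith
    have hmn : m ∣ n := ham.2.symm.dvd_of_dvd_mul_left (h1 ▸ dvd_mul_left _ _)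
    have hnm : n ∣ m := hbn.2.symm.dvd_of_dvd_mul_left (h1 ▸ dvd_mul_left _ _)
    obtain rfl := Nat.dvd_antisymm hmn hnm
    obtain rfl : a = b := Nat.eq_of_mul_eq_mul_right (by omega) h1
    rw [if_pos rfl, if_pos rfl]
    have : 0 ≤ (if (a, a) ∈ overlap (p ^ min k l) m m then ((p : ℝ) ^ max k l)⁻¹ else 0) := by
      positivity
    linarith
  · rw [if_pos]
    · have : 0 ≤ if m = n then (if a = b then ((p : ℝ) ^ k)⁻¹ else 0) else 0 := by positivity
      linarith
    · refine Finset.mem_filter.2 ⟨Finset.mem_product.2 ⟨Finset.mem_range.2 ham.1,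
        Finset.mem_range.2 hbn.1⟩, ham.2, hbn.2, hab, ?_⟩
      rw [hA, mem_closedBall_padicFrac hm, PadicInt.norm_le_inv_pow_iff] at hxA
      rw [hB, mem_closedBall_padicFrac hn, PadicInt.norm_le_inv_pow_iff] at hxB
      have hA' := (pow_dvd_pow (p : ℤ_[p]) (min_le_left k l)).trans hxA
      have hB' := (pow_dvd_pow (p : ℤ_[p]) (min_le_right k l)).trans hxB
      have h := dvd_sub (hB'.mul_left (m : ℤ_[p])) (hA'.mul_left (n : ℤ_[p]))
      rw [show (m : ℤ_[p]) * (n * x - (b : ℤ)) - n * (m * x - (a : ℤ)) =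
        ((a * n - b * m : ℤ) : ℤ_[p]) by push_cast; ring, PadicInt.pow_p_dvd_int_iff] at h
      push_cast; exact h

/-- Constant in `one_le_measureReal_iUnion_ball`. -/
def measureConst : ℝ := 1 + 2 * overlapConst

lemma measureConst_pos : 0 < measureConst := by
  have := overlapConst_nonneg
  unfold measureConst; linarith

lemma one_le_measureReal_iUnion_ball (S : Finset ℕ) (k : ℕ → ℕ)
    (hS : ∀ n ∈ S, 0 < n ∧ Nat.Coprime p n)
    (hM : 1 ≤ ∑ n ∈ S, n.totient / (p:ℝ) ^ k n) :
    1 ≤ measureConst * μ.real (⋃ i ∈ S.sigma fun n => (Finset.range n).filter (Nat.Coprime · n),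
      Metric.closedBall (padicFrac p (i.2 : ℕ) i.1) ((p : ℝ) ^ k i.1)⁻¹) := by
  have hp : p.Prime := Fact.out
  set M := ∑ n ∈ S, n.totient / (p:ℝ) ^ k n with hMdef
  have hM0 : 0 < M := by linarith
  have hcard : ∀ n, ((Finset.range n).filter (Nat.Coprime · n)).card = n.totient := by
    intro n
    rw [Nat.totient_eq_card_coprime]
    congr 1
    ext a; simp [Nat.coprime_comm]
  have hsum1 : ∀ n ∈ S, ∑ _a ∈ (Finset.range n).filter (Nat.Coprime · n), ((p : ℝ) ^ k n)⁻¹ =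
      n.totient / (p:ℝ) ^ k n := fun n _ => by
    rw [Finset.sum_const, hcard, nsmul_eq_mul, div_eq_mul_inv]
  refine one_le_mul_measureReal_biUnion μ _ _
    (fun i _ => Metric.isClosed_closedBall.measurableSet) hM0 measureConst_pos ?_ ?_
  · simp only [measureReal_closedBall_inv_pow]
    rw [Finset.sum_sigma]
    exact Finset.sum_congr rfl hsum1
  · rw [Finset.sum_sigma]
    simp only [Finset.sum_sigma]
    have hle : ∑ m ∈ S, ∑ a ∈ (Finset.range m).filter (Nat.Coprime · m), ∑ n ∈ S,
        ∑ b ∈ (Finset.range n).filter (Nat.Coprime · n),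
          μ.real (Metric.closedBall (padicFrac p (a : ℕ) m) ((p : ℝ) ^ k m)⁻¹ ∩
            Metric.closedBall (padicFrac p (b : ℕ) n) ((p : ℝ) ^ k n)⁻¹) ≤
        ∑ m ∈ S, ∑ a ∈ (Finset.range m).filter (Nat.Coprime · m), ∑ n ∈ S,
          ∑ b ∈ (Finset.range n).filter (Nat.Coprime · n),
          ((if (a, b) ∈ overlap (p ^ min (k m) (k n)) m n
              then ((p : ℝ) ^ max (k m) (k n))⁻¹ else 0) +
            if m = n then (if a = b then ((p : ℝ) ^ k m)⁻¹ else 0) else 0) :=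
      Finset.sum_le_sum fun m hm => Finset.sum_le_sum fun a ha => Finset.sum_le_sum fun n hn =>
        Finset.sum_le_sum fun b hb => measureReal_inter_closedBall_le μ (hS m hm).2 (hS n hn).2
          ha hb _ _
    refine hle.trans ?_
    simp only [Finset.sum_add_distrib]
    have hdiag : ∑ m ∈ S, ∑ a ∈ (Finset.range m).filter (Nat.Coprime · m), ∑ n ∈ S,
        ∑ b ∈ (Finset.range n).filter (Nat.Coprime · n),
          (if m = n then (if a = b then ((p : ℝ) ^ k m)⁻¹ else 0) else 0) = M := by
      refine Finset.sum_congr rfl fun m hm => ?_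
      rw [← hsum1 m hm]
      refine Finset.sum_congr rfl fun a ha => ?_
      rw [Finset.sum_eq_single m (fun n _ hn => by
        simp only [if_neg (Ne.symm hn), Finset.sum_const_zero]) (fun h => absurd hm h)]
      simp only [if_true]
      rw [Finset.sum_ite_eq, if_pos ha]
    have hoff : ∑ m ∈ S, ∑ a ∈ (Finset.range m).filter (Nat.Coprime · m), ∑ n ∈ S,
        ∑ b ∈ (Finset.range n).filter (Nat.Coprime · n),
          (if (a, b) ∈ overlap (p ^ min (k m) (k n)) m n
              then ((p : ℝ) ^ max (k m) (k n))⁻¹ else 0) ≤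
        ∑ x ∈ S ×ˢ S, ((overlap (p ^ min (k x.1) (k x.2)) x.1 x.2).card : ℝ) /
          (p:ℝ) ^ max (k x.1) (k x.2) := by
      rw [Finset.sum_product]
      refine Finset.sum_le_sum fun m _ => ?_
      rw [Finset.sum_comm]
      refine Finset.sum_le_sum fun n _ => ?_
      rw [← Finset.sum_product', ← Finset.sum_filter, Finset.sum_const, nsmul_eq_mul,
        div_eq_mul_inv]
      refine mul_le_mul_of_nonneg_right ?_ (by positivity)
      exact_mod_cast Finset.card_le_card fun x hx => (Finset.mem_filter.1 hx).2
    have hov := sum_overlap_le hp S k hS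
    rw [← hMdef] at hov
    have h32 : M ^ (3/2 : ℝ) ≤ M ^ 2 := by
      rw [← Real.rpow_natCast]
      exact Real.rpow_le_rpow_of_exponent_le hM (by norm_num)
    have hM2 : M ≤ M ^ 2 := by nlinarith
    have hC := overlapConst_nonneg
    have h5 : overlapConst * (M ^ 2 + M ^ (3/2 : ℝ)) ≤ overlapConst * (M ^ 2 + M ^ 2) := by gcongr
    rw [hdiag]
    unfold measureConst
    linarith

end PadicMeasure

section ZeroOne

open scoped Topology

lemma Nat.le_totient_mul_prod_primeFactors (n : ℕ) :
    n ≤ n.totient * ∏ l ∈ n.primeFactors, l := by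
  rcases n.eq_zero_or_pos with rfl | hn
  · simp
  rw [Nat.totient_mul_prod_primeFactors]
  refine Nat.le_mul_of_pos_right _ (Finset.prod_pos fun l hl => ?_)
  have := (Nat.prime_of_mem_primeFactors hl).two_le
  omega

lemma Nat.tendsto_totient : Tendsto Nat.totient atTop atTop := by
  refine tendsto_atTop.2 fun K => ?_
  filter_upwards [eventually_gt_atTop (K * primorial (K + 1))] with n hn
  by_contra! hK
  have hn0 : n ≠ 0 := by omega
  have hpr : ∏ l ∈ n.primeFactors, l ≤ primorial (K + 1) := by
    refine Finset.prod_le_prod_of_subset_of_one_le' (fun l hl => ?_) fun l hl _ => ?_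
    · have hlp := Nat.prime_of_mem_primeFactors hl
      have h1 : l.totient ≤ n.totient :=
        Nat.le_of_dvd (Nat.totient_pos.2 (Nat.pos_of_ne_zero hn0))
          (Nat.totient_dvd_of_dvd (Nat.dvd_of_mem_primeFactors hl))
      rw [Nat.totient_prime hlp] at h1
      simp only [Finset.mem_filter, Finset.mem_range]
      exact ⟨by omega, hlp⟩
    · exact (Finset.mem_filter.1 hl).2.one_le
  have := Nat.le_totient_mul_prod_primeFactors n
  have h2 := Nat.mul_le_mul hK.le hpr
  omega

lemma mem_blimsup_atTop_iff {α : Type*} {s : ℕ → Set α} {P : ℕ → Prop} {x : α} :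
    x ∈ blimsup s atTop P ↔ ∃ᶠ n in atTop, x ∈ s n ∧ P n := by
  rw [← Nat.cofinite_eq_atTop, cofinite.blimsup_set_eq, frequently_cofinite_iff_infinite]
  simp only [Set.mem_ofPred_eq, and_comm]

variable {p : ℕ} [Fact p.Prime]

/-- The reduced fractions `a / n` with `|a| ≤ n`, as `p`-adic integers. -/
def padicFracs (p : ℕ) [Fact p.Prime] (n : ℕ) : Set ℤ_[p] :=
  (fun a : ℤ => padicFrac p a n) '' {a : ℤ | |a| ≤ (n : ℤ) ∧ Int.gcd a n = 1}

lemma finite_padicFracs (n : ℕ) : (padicFracs p n).Finite := by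
  refine Set.Finite.image _ ((Set.finite_Icc (-(n : ℤ)) n).subset fun a ha => ?_)
  exact abs_le.1 ha.1

lemma cthickening_padicFracs (n : ℕ) {r : ℝ} (hr : 0 ≤ r) :
    Metric.cthickening r (padicFracs p n) =
      ⋃ a ∈ {a : ℤ | |a| ≤ (n : ℤ) ∧ Int.gcd a n = 1}, Metric.closedBall (padicFrac p a n) r := by
  rw [(finite_padicFracs n).isCompact.cthickening_eq_biUnion_closedBall hr, padicFracs,
    Set.biUnion_image]

lemma mem_cthickening_padicFracs {n : ℕ} (hn : Nat.Coprime p n) {r : ℝ} (hr : 0 ≤ r)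
    (x : ℤ_[p]) : x ∈ Metric.cthickening r (padicFracs p n) ↔
      ∃ a : ℤ, (|a| ≤ (n : ℤ) ∧ Int.gcd a n = 1) ∧ ‖(n : ℤ_[p]) * x - a‖ ≤ r := by
  rw [cthickening_padicFracs n hr]
  simp only [Set.mem_iUnion, mem_closedBall_padicFrac hn, exists_prop]
  rfl

/-- If `r + p ^ j * y` is close to a reduced fraction with denominator `n`, then so is `y`. -/
lemma mem_cthickening_of_add_pow_mul_mem {n j k r : ℕ} (hn : Nat.Coprime p n) (hn0 : 0 < n)
    (hjk : j ≤ k) (hr : r < p ^ j) {y : ℤ_[p]}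
    (hy : (r : ℤ_[p]) + (p : ℤ_[p]) ^ j * y ∈
      Metric.cthickening ((p : ℝ) ^ k)⁻¹ (padicFracs p n)) :
    y ∈ Metric.cthickening ((p : ℝ) ^ j * ((p : ℝ) ^ k)⁻¹) (padicFracs p n) := by
  have hp : (0 : ℝ) < p := natPrime_pos
  rw [mem_cthickening_padicFracs hn (by positivity)] at hy
  rw [mem_cthickening_padicFracs hn (by positivity)]
  obtain ⟨a, ⟨ha, hgcd⟩, hd⟩ := hy
  rw [PadicInt.norm_le_inv_pow_iff] at hd
  have hdvd : (p : ℤ_[p]) ^ j ∣ ((a - n * r : ℤ) : ℤ_[p]) := by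
    have h1 := (pow_dvd_pow (p : ℤ_[p]) hjk).trans hd
    have h2 : ((a - n * r : ℤ) : ℤ_[p]) = (p : ℤ_[p]) ^ j * (n * y) -
        ((n : ℤ_[p]) * (r + (p : ℤ_[p]) ^ j * y) - a) := by push_cast; ring
    rw [h2]
    exact dvd_sub (dvd_mul_right _ _) h1
  have hdvd' : ((p : ℤ) ^ j) ∣ a - n * r := by
    rw [← PadicInt.norm_le_inv_pow_iff, ← zpow_natCast, ← zpow_neg, PadicInt.norm_int_le_pow_iff_dvd] at hdvd
    exact_mod_cast hdvd
  obtain ⟨b, hb⟩ := hdvd'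
  have hp0 : (0 : ℤ) < (p : ℤ) ^ j := pow_pos (by exact_mod_cast (Fact.out : p.Prime).pos) _
  refine ⟨b, ⟨?_, ?_⟩, ?_⟩
  · have hr' : (r : ℤ) ≤ (p : ℤ) ^ j - 1 := by
      have : (r : ℤ) < (p : ℤ) ^ j := by exact_mod_cast hr
      omega
    rw [abs_le] at ha ⊢
    have hn' : (0 : ℤ) < n := by exact_mod_cast hn0
    constructor
    · have h3 : (p : ℤ) ^ j * (-n) ≤ (p : ℤ) ^ j * b := by nlinarith [Int.natCast_nonneg r]
      exact le_of_mul_le_mul_left h3 hp0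
    · have h3 : (p : ℤ) ^ j * b ≤ (p : ℤ) ^ j * n := by
        nlinarith [mul_nonneg hn'.le (Int.natCast_nonneg r)]
      exact le_of_mul_le_mul_left h3 hp0
  · have hdvda : (Int.gcd b n : ℤ) ∣ a := by
      rw [show a = (p : ℤ) ^ j * b + n * r by linarith]
      exact dvd_add ((Int.gcd_dvd_left ..).mul_left _) ((Int.gcd_dvd_right ..).mul_right _)
    have := Int.dvd_coe_gcd hdvda (Int.gcd_dvd_right b n)
    rw [hgcd] at this
    exact Nat.dvd_one.1 (by exact_mod_cast this)
  · have h4 : (n : ℤ_[p]) * (r + (p : ℤ_[p]) ^ j * y) - a = (p : ℤ_[p]) ^ j * (n * y - b) := by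
      have : (a : ℤ_[p]) = (p : ℤ_[p]) ^ j * b + n * r := by
        rw [show a = (p : ℤ) ^ j * b + n * r by linarith]; push_cast; ring
      rw [this]; ring
    rw [← PadicInt.norm_le_inv_pow_iff, h4, norm_mul, norm_pow, PadicInt.norm_p] at hd
    have h5 := mul_le_mul_of_nonneg_left hd (pow_nonneg hp.le j)
    rwa [← mul_assoc, ← mul_pow, mul_inv_cancel₀ hp.ne', one_pow, one_mul] at h5

variable [MeasurableSpace ℤ_[p]] [BorelSpace ℤ_[p]] (μ : Measure ℤ_[p]) [μ.IsAddHaarMeasure]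
  [IsProbabilityMeasure μ]

/-- The zero-one law for limsup sets of reduced fractions. -/
lemma measure_blimsup_eq_one {P : ℕ → Prop} (hP : ∀ n, P n → 0 < n ∧ Nat.Coprime p n)
    {k : ℕ → ℕ} (hk : Tendsto k atTop atTop)
    (h0 : μ (blimsup (fun n => Metric.cthickening ((p : ℝ) ^ k n)⁻¹ (padicFracs p n)) atTop P)
      ≠ 0) :
    μ (blimsup (fun n => Metric.cthickening ((p : ℝ) ^ k n)⁻¹ (padicFracs p n)) atTop P) = 1 := by
  set W : Set ℤ_[p] :=
    blimsup (fun n => Metric.cthickening ((p : ℝ) ^ k n)⁻¹ (padicFracs p n)) atTop P with hW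
  have hp : (0 : ℝ) < p := natPrime_pos
  have hp1 : (1 : ℝ) < p := by exact_mod_cast (Fact.out : p.Prime).one_lt
  have hδ : Tendsto (fun j : ℕ => ((p : ℝ) ^ j)⁻¹) atTop (𝓝 0) :=
    tendsto_inv_atTop_zero.comp (tendsto_pow_atTop_atTop_of_one_lt hp1)
  have hδ' : Tendsto (fun j : ℕ => ((p : ℝ) ^ j)⁻¹) atTop (𝓝[>] 0) :=
    tendsto_nhdsWithin_iff.2 ⟨hδ, Eventually.of_forall fun j => by
      simp only [Set.mem_Ioi]; positivity⟩
  have hne : (ae (μ.restrict W)).NeBot := by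
    rw [ae_neBot]
    exact fun h => h0 (Measure.restrict_eq_zero.1 h)
  obtain ⟨x, hx⟩ := (IsUnifLocDoublingMeasure.ae_tendsto_measure_inter_div μ W 1).exists
  have hlim := hx (l := atTop) (fun j : ℕ => ((x.appr j : ℕ) : ℤ_[p])) (fun j => ((p : ℝ) ^ j)⁻¹) hδ'
    (Eventually.of_forall fun j => by
      rw [one_mul, PadicInt.mem_closedBall_inv_pow]
      exact Ideal.mem_span_singleton.1 (PadicInt.appr_spec j x))
  refine le_antisymm prob_le_one (le_of_tendsto' hlim fun j => ?_)
  rw [← measure_preimage_add_pow_mul]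
  have hWj := blimsup_cthickening_mul_ae_eq μ P (padicFracs p) (pow_pos hp j)
    (fun n => ((p : ℝ) ^ k n)⁻¹) (hδ.comp hk)
  rw [hW, ← measure_congr hWj]
  refine measure_mono fun y hy => ?_
  simp only [Set.mem_preimage, mem_blimsup_atTop_iff] at hy ⊢
  refine (Frequently.and_eventually hy (hk.eventually_ge_atTop j)).mono fun n hn => ⟨?_, hn.1.2⟩
  exact mem_cthickening_of_add_pow_mul_mem (hP n hn.1.2).2 (hP n hn.1.2).1 hn.2
    (x.appr_lt j) hn.1.1

end ZeroOne

section Positivity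

open scoped Topology

lemma exists_finset_one_le_sum {f : ℕ → ℝ} (hf : ∀ n, 0 ≤ f n) {P : ℕ → Prop}
    (h : ¬ Summable (fun n => Set.indicator {n | P n} f n)) (N : ℕ) :
    ∃ S : Finset ℕ, (∀ n ∈ S, N ≤ n ∧ P n) ∧ 1 ≤ ∑ n ∈ S, f n := by
  classical
  by_contra! hS
  refine h ((summable_nat_add_iff N).1 (summable_of_sum_range_le (c := 1)
    (fun n => Set.indicator_nonneg (fun n _ => hf n) _) fun m => ?_))
  refine le_trans (le_of_eq ?_)
    (hS (((Finset.range m).map (addRightEmbedding N)).filter P) fun n hn => ?_).le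
  · rw [Finset.sum_filter, Finset.sum_map]
    exact Finset.sum_congr rfl fun i _ => by simp [Set.indicator_apply]
  · obtain ⟨h1, h2⟩ := Finset.mem_filter.1 hn
    obtain ⟨i, -, rfl⟩ := Finset.mem_map.1 h1
    exact ⟨Nat.le_add_left _ _, h2⟩

variable {p : ℕ} [Fact p.Prime]
variable [MeasurableSpace ℤ_[p]] [BorelSpace ℤ_[p]] (μ : Measure ℤ_[p]) [μ.IsAddHaarMeasure]
  [IsProbabilityMeasure μ]

/-- The divergence case of the `p`-adic Duffin–Schaeffer problem: positive measure. -/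
lemma measure_blimsup_ne_zero {P : ℕ → Prop} (hP : ∀ n, P n → 0 < n ∧ Nat.Coprime p n)
    {k : ℕ → ℕ}
    (hdiv : ¬ Summable (fun n => Set.indicator {n | P n}
      (fun n => (n.totient : ℝ) / (p : ℝ) ^ k n) n)) :
    μ (blimsup (fun n => Metric.cthickening ((p : ℝ) ^ k n)⁻¹ (padicFracs p n)) atTop P) ≠ 0 := by
  rw [blimsup_eq_iInf_biSup_of_nat]
  simp only [Set.iSup_eq_iUnion, Set.iInf_eq_iInter]
  set U : ℕ → Set ℤ_[p] := fun i => ⋃ n, ⋃ (_ : P n ∧ i ≤ n),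
    Metric.cthickening ((p : ℝ) ^ k n)⁻¹ (padicFracs p n) with hU
  have hmeas : ∀ i, MeasurableSet (U i) := fun i =>
    .iUnion fun n => .iUnion fun _ => Metric.isClosed_cthickening.measurableSet
  have hanti : Antitone U := fun i j hij => by
    refine Set.iUnion_mono fun n => Set.iUnion_mono' fun h => ⟨⟨h.1, hij.trans h.2⟩, subset_rfl⟩
  have hlim := tendsto_measure_iInter_atTop (μ := μ) (fun i => (hmeas i).nullMeasurableSet) hanti
    ⟨0, measure_ne_top _ _⟩
  have hlow : ∀ i, ENNReal.ofReal measureConst⁻¹ ≤ μ (U i) := fun N => by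
    obtain ⟨S, hS, hsum⟩ := exists_finset_one_le_sum
      (f := fun n => (n.totient : ℝ) / (p : ℝ) ^ k n) (fun n => by positivity) hdiv N
    have h1 := one_le_measureReal_iUnion_ball μ S k (fun n hn => hP n (hS n hn).2) hsum
    rw [← ENNReal.ofReal_toReal (measure_ne_top μ (U N))]
    refine ENNReal.ofReal_le_ofReal ?_
    rw [inv_le_iff_one_le_mul₀' measureConst_pos]
    refine h1.trans (mul_le_mul_of_nonneg_left ?_ measureConst_pos.le)
    refine measureReal_mono (Set.iUnion₂_subset fun i hi => ?_) (measure_ne_top _ _)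
    rw [Finset.mem_sigma, Finset.mem_filter, Finset.mem_range] at hi
    refine subset_trans ?_ (Set.subset_iUnion₂ (s := fun n (_ : P n ∧ N ≤ n) =>
      Metric.cthickening ((p : ℝ) ^ k n)⁻¹ (padicFracs p n)) i.1
      ⟨(hS _ hi.1).2, (hS _ hi.1).1⟩)
    have hmem : padicFrac p (i.2 : ℕ) i.1 ∈ padicFracs p i.1 := by
      refine ⟨((i.2 : ℕ) : ℤ), ⟨?_, ?_⟩, rfl⟩
      · rw [abs_of_nonneg (by positivity)]; exact_mod_cast hi.2.1.le
      · exact_mod_cast hi.2.2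
    exact Metric.closedBall_subset_cthickening hmem _
  have := ge_of_tendsto' hlim hlow
  intro h
  rw [h] at this
  exact absurd this (by simpa using measureConst_pos)

end Positivity

section ApproximationSets

variable {p : ℕ} [Fact p.Prime]

lemma mem_padicE_iff {ψ : ℕ → ℝ} {n : ℕ} (hn : Nat.Coprime p n) (hn0 : 0 < n) (x : ℤ_[p]) :
    x ∈ padicE p ψ n ↔
      ∃ a : ℤ, (|a| ≤ (n : ℤ) ∧ Int.gcd a n = 1) ∧ ‖(n : ℤ_[p]) * x - a‖ ≤ ψ n := by
  have hn' : (n : ℚ_[p]) ≠ 0 := by exact_mod_cast hn0.ne'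
  have hnorm : ‖(n : ℚ_[p])‖ = 1 := by
    have := PadicInt.isUnit_iff.1 (isUnit_natCast_padicInt hn)
    simpa using this
  have key : ∀ a : ℤ, ‖(x : ℚ_[p]) - (a : ℚ_[p]) / (n : ℚ_[p])‖ = ‖(n : ℤ_[p]) * x - a‖ := by
    intro a
    rw [PadicInt.norm_def]
    push_cast
    rw [show (n : ℚ_[p]) * x - a = n * (x - a / n) by field_simp, norm_mul, hnorm, one_mul]
  simp only [padicE, Set.mem_ofPred_eq, key, and_assoc]

lemma padicE_eq_univ {ψ : ℕ → ℝ} {n : ℕ} (hn : p ∣ n) (hne : (padicE p ψ n).Nonempty) :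
    padicE p ψ n = Set.univ := by
  obtain ⟨x, a, ha, hg, hx⟩ := hne
  have hp : p.Prime := Fact.out
  have hn0 : n ≠ 0 := by
    rintro rfl
    have : a = 0 := by simpa using ha
    simp [this] at hg
  have hlt : 1 < ‖(a : ℚ_[p]) / n‖ := by
    have h1 : ‖(n : ℚ_[p])‖ < 1 := by
      have := (Padic.norm_intCast_lt_one_iff (p := p) (k := (n : ℤ))).2 (by exact_mod_cast hn)
      exact_mod_cast this
    have h2 : ‖(a : ℚ_[p])‖ = 1 := by
      refine le_antisymm (Padic.norm_int_le_one a) (not_lt.1 fun h => ?_)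
      rw [Padic.norm_intCast_lt_one_iff] at h
      have := Int.dvd_coe_gcd h (by exact_mod_cast hn : (p : ℤ) ∣ n)
      rw [hg] at this
      exact hp.one_lt.ne' (Nat.dvd_one.1 (by exact_mod_cast this))
    have h3 : 0 < ‖(n : ℚ_[p])‖ := norm_pos_iff.2 (by exact_mod_cast hn0)
    rw [norm_div, h2, one_lt_div h3]
    exact h1
  have key : ∀ y : ℤ_[p], ‖(y : ℚ_[p]) - (a : ℚ_[p]) / n‖ = ‖(a : ℚ_[p]) / n‖ := fun y => by
    have hy : ‖(y : ℚ_[p])‖ < ‖(a : ℚ_[p]) / n‖ := lt_of_le_of_lt y.norm_le_one hlt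
    rw [sub_eq_add_neg, Padic.add_eq_max_of_ne (by rw [norm_neg]; exact hy.ne), norm_neg,
      max_eq_right hy.le]
  refine Set.eq_univ_of_forall fun y => ⟨a, ha, hg, ?_⟩
  rw [key] at hx ⊢
  exact hx

variable [MeasurableSpace ℤ_[p]] [BorelSpace ℤ_[p]] (μ : Measure ℤ_[p]) [μ.IsAddHaarMeasure]
  [IsProbabilityMeasure μ]

lemma measureReal_padicE_le {ψ : ℕ → ℝ} {n : ℕ} (hn : Nat.Coprime p n) (hn0 : 0 < n) {k : ℕ}
    (hk : ψ n ≤ ((p : ℝ) ^ k)⁻¹) :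
    μ.real (padicE p ψ n) ≤ 3 * n.totient * ((p : ℝ) ^ k)⁻¹ := by
  set T : Finset (ℕ × ℤ) :=
    ((Finset.range n).filter (Nat.Coprime n ·)) ×ˢ Finset.Icc (-1 : ℤ) 1 with hT
  have hsub : padicE p ψ n ⊆ ⋃ i ∈ T,
      Metric.closedBall (padicFrac p (i.1 + n * i.2) n) ((p : ℝ) ^ k)⁻¹ := by
    intro x hx
    obtain ⟨a, ⟨ha, hg⟩, hd⟩ := (mem_padicE_iff hn hn0 x).1 hx
    have hnz : (0 : ℤ) < n := by exact_mod_cast hn0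
    have hmod : ((a % n).toNat : ℤ) = a % n := Int.toNat_of_nonneg (Int.emod_nonneg _ hnz.ne')
    have ha' := abs_le.1 ha
    refine Set.mem_iUnion₂.2 ⟨((a % n).toNat, a / n), ?_, ?_⟩
    · rw [hT, Finset.mem_product, Finset.mem_filter, Finset.mem_range, Finset.mem_Icc]
      refine ⟨⟨?_, ?_⟩, ?_, ?_⟩
      · have := Int.emod_lt_of_pos a hnz
        simp only
        omega
      · rw [Nat.coprime_comm, Nat.Coprime, ← Int.gcd_natCast_natCast, hmod, Int.gcd_emod]
        exact hg
      · exact (Int.le_ediv_iff_mul_le hnz).2 (by linarith)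
      · have : a / n < 2 := (Int.ediv_lt_iff_lt_mul hnz).2 (by linarith)
        simp only
        omega
    · rw [mem_closedBall_padicFrac hn]
      simp only [hmod, Int.emod_add_mul_ediv]
      exact hd.trans hk
  have hcard : (T.card : ℝ) = 3 * n.totient := by
    rw [hT, Finset.card_product, ← Nat.totient_eq_card_coprime]
    simp [mul_comm]
  calc μ.real (padicE p ψ n) ≤ _ := measureReal_mono hsub (measure_ne_top _ _)
    _ ≤ _ := measureReal_biUnion_finset_le _ _
    _ = _ := by
      simp only [measureReal_closedBall_inv_pow, Finset.sum_const, nsmul_eq_mul, hcard]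

lemma measureReal_padicE_eq_zero {ψ : ℕ → ℝ} {n : ℕ} (hn : Nat.Coprime p n) (hn0 : 0 < n)
    (hψ : ψ n = 0) : μ.real (padicE p ψ n) = 0 := by
  have hp1 : (1 : ℝ) < p := by exact_mod_cast (Fact.out : p.Prime).one_lt
  have hlim : Tendsto (fun k : ℕ => 3 * (n.totient : ℝ) * ((p : ℝ) ^ k)⁻¹) atTop (nhds 0) := by
    simpa using (tendsto_inv_atTop_zero.comp
      (tendsto_pow_atTop_atTop_of_one_lt hp1)).const_mul (3 * (n.totient : ℝ))
  exact le_antisymm (ge_of_tendsto' hlim fun k =>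
    measureReal_padicE_le μ hn hn0 (hψ ▸ by positivity)) measureReal_nonneg

/-- A positive radius can be shrunk to a power of `p` that is at most `1 / φ n`, at the cost of a
constant factor in the measure bound. -/
lemma exists_pow_radius {ψ : ℕ → ℝ} {n : ℕ} (hn : Nat.Coprime p n) (hn0 : 0 < n)
    (hψ : 0 < ψ n) : ∃ k : ℕ, n.totient ≤ p ^ k ∧ ((p : ℝ) ^ k)⁻¹ ≤ ψ n ∧
      μ.real (padicE p ψ n) ≤ 3 * p * (n.totient / (p : ℝ) ^ k) := by
  classical
  have hp : (0 : ℝ) < p := natPrime_pos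
  have hp1 : (1 : ℝ) < p := by exact_mod_cast (Fact.out : p.Prime).one_lt
  have hφ : (1 : ℝ) ≤ n.totient := by exact_mod_cast Nat.totient_pos.2 hn0
  have hex : ∃ k : ℕ, n.totient ≤ p ^ k ∧ ((p : ℝ) ^ k)⁻¹ ≤ ψ n := by
    have h1 := tendsto_inv_atTop_zero.comp (tendsto_pow_atTop_atTop_of_one_lt hp1)
    obtain ⟨k, hk, hk'⟩ := ((h1.eventually (ge_mem_nhds hψ)).and
      (eventually_ge_atTop n.totient)).exists
    exact ⟨k, hk'.trans (Nat.lt_pow_self (Fact.out : p.Prime).one_lt).le, hk⟩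
  refine ⟨Nat.find hex, (Nat.find_spec hex).1, (Nat.find_spec hex).2, ?_⟩
  rcases hf : Nat.find hex with _ | m
  · have : μ.real (padicE p ψ n) ≤ 1 := measureReal_le_one
    rw [pow_zero, div_one]
    nlinarith
  · have hm := Nat.find_min hex (m := m) (by omega)
    have hpm : (0 : ℝ) < (p : ℝ) ^ m := by positivity
    have heq : 3 * p * (n.totient / (p : ℝ) ^ (m + 1)) = 3 * n.totient * ((p : ℝ) ^ m)⁻¹ := by
      rw [pow_succ]; field_simp
    rw [heq]
    rcases not_and_or.1 hm with h | h
    · have h2 : (p : ℝ) ^ m ≤ n.totient := by exact_mod_cast (not_le.1 h).le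
      have h3 : 1 ≤ n.totient * ((p : ℝ) ^ m)⁻¹ := by
        rwa [← div_eq_mul_inv, one_le_div hpm]
      have : μ.real (padicE p ψ n) ≤ 1 := measureReal_le_one
      linarith
    · exact measureReal_padicE_le μ hn hn0 (not_le.1 h).le

end ApproximationSets

/-- **Theorem 4(v) (Haynes).** Let `p` be prime and `ψ` non-negative with
`Σ μ_p(E_n(ψ)) = ∞`.  If for some `ε > 0` the series `Σ φ(n)·ψ(n)^(1+ε)` diverges,
then `μ_p(W_p(ψ)) = 1`. -/
theorem stmt7 (p : ℕ) [Fact p.Prime] [MeasurableSpace ℤ_[p]] [BorelSpace ℤ_[p]]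
    (μ : Measure ℤ_[p]) [μ.IsAddHaarMeasure] [IsProbabilityMeasure μ]
    (ψ : ℕ → ℝ) (hψ : ∀ n, 0 ≤ ψ n)
    (hdiv : ∑' n : ℕ, μ (padicE p ψ n) = ⊤)
    (heps : ∃ ε : ℝ, 0 < ε ∧
      ∑' n : ℕ, (Nat.totient n : ℝ≥0∞) * ENNReal.ofReal (ψ n ^ (1 + ε)) = ⊤) :
    μ (padicW p ψ) = 1 := by
  have hprime : p.Prime := Fact.out
  by_cases hbad : {n | p ∣ n ∧ (padicE p ψ n).Nonempty}.Infinite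
  · have : padicW p ψ = Set.univ := Set.eq_univ_of_forall fun x =>
      hbad.mono fun n hn => by
        change x ∈ padicE p ψ n
        rw [padicE_eq_univ hn.1 hn.2]
        trivial
    rw [this, measure_univ]
  rw [Set.not_infinite] at hbad
  set P : ℕ → Prop := fun n => 0 < n ∧ Nat.Coprime p n ∧ 0 < ψ n with hPdef
  have hP : ∀ n, P n → 0 < n ∧ Nat.Coprime p n := fun n h => ⟨h.1, h.2.1⟩
  have hex : ∀ n, ∃ k : ℕ, n.totient ≤ p ^ k ∧ (P n → ((p : ℝ) ^ k)⁻¹ ≤ ψ n ∧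
      μ.real (padicE p ψ n) ≤ 3 * p * (n.totient / (p : ℝ) ^ k)) := fun n => by
    by_cases h : P n
    · obtain ⟨k, h1, h2⟩ := exists_pow_radius μ h.2.1 h.1 h.2.2
      exact ⟨k, h1, fun _ => h2⟩
    · exact ⟨n.totient, (Nat.lt_pow_self hprime.one_lt).le, fun h' => absurd h' h⟩
  choose k hkφ hk using hex
  have hktend : Tendsto k atTop atTop := by
    refine tendsto_atTop.2 fun K => ?_
    filter_upwards [Nat.tendsto_totient.eventually_gt_atTop (p ^ K)] with n hn
    exact ((Nat.pow_lt_pow_iff_right hprime.one_lt).1 (hn.trans_le (hkφ n))).le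
  have hns : ¬ Summable (fun n => Set.indicator {n | P n}
      (fun n => (n.totient : ℝ) / (p : ℝ) ^ k n) n) := fun hs => by
    have hsum : Summable (fun n => μ.real (padicE p ψ n)) := by
      refine Summable.of_norm_bounded_eventually (hs.mul_left (3 * (p : ℝ))) ?_
      filter_upwards [hbad.compl_mem_cofinite, (Set.finite_singleton 0).compl_mem_cofinite]
        with n hn hn0
      have hpos : 0 < n := Nat.pos_of_ne_zero hn0
      rw [Real.norm_of_nonneg measureReal_nonneg]
      by_cases hPn : P n
      · rw [Set.indicator_of_mem (show n ∈ {n | P n} from hPn)]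
        exact (hk n hPn).2
      · rw [Set.indicator_of_notMem (show n ∉ {n | P n} from hPn), mul_zero]
        by_cases hdvd : p ∣ n
        · have : padicE p ψ n = ∅ := Set.not_nonempty_iff_eq_empty.1 fun h => hn ⟨hdvd, h⟩
          rw [this, measureReal_empty]
        · have hc := (Nat.Prime.coprime_iff_not_dvd hprime).2 hdvd
          refine (measureReal_padicE_eq_zero μ hc hpos ?_).le
          exact le_antisymm (not_lt.1 fun h => hPn ⟨hpos, hc, h⟩) (hψ n)
    refine hsum.tsum_ofReal_ne_top ?_
    rw [← hdiv]
    exact tsum_congr fun n => ENNReal.ofReal_toReal (measure_ne_top _ _)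
  have hone := measure_blimsup_eq_one μ hP hktend (measure_blimsup_ne_zero μ hP hns)
  refine le_antisymm prob_le_one (hone ▸ measure_mono fun x hx => ?_)
  rw [mem_blimsup_atTop_iff] at hx
  refine Nat.frequently_atTop_iff_infinite.1 (hx.mono fun n hn => ?_)
  obtain ⟨hxn, hPn⟩ := hn
  rw [mem_cthickening_padicFracs hPn.2.1 (by positivity)] at hxn
  obtain ⟨a, ha, hd⟩ := hxn
  exact (mem_padicE_iff hPn.2.1 hPn.1 x).2 ⟨a, ha, hd.trans (hk n hPn).1⟩
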